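/- (Global well-posedness for small data) Let $1<\gamma<\infty$, set $p=q=\gamma+1$, and let $F$ be a power-like nonlinearity of degree $\gamma$. Then there exist $\varepsilon>0$ and $\delta>0$ such that for every $f\in L^2(\mathbb{T})$ with $\|f\|_{L^2}\le\delta$, the integral equation $u(t)=e^{it\mathcal{L}}f-i\int_0^t e^{i(t-s)\mathcal{L}}F(u(s))\,ds$ has a unique solution $u$ in the ball of radius $\varepsilon$ of $X=C(\mathbb{R};L^2(\mathbb{T}))\cap L^{p}(\mathbb{R};L^{q}(\mathbb{T}))$, and the map $f\mapsto u$ is continuous (indeed Lipschitz) from $\{\|f\|_{L^2}\le\delta\}$ into $X$. -/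

import Mathlib

noncomputable section

open Complex MeasureTheory Filter
open scoped ENNReal NNReal Topology

/-- A homogeneous tree of degree `Q+1`: a connected acyclic graph in which every
vertex has exactly `Q+1` neighbours. -/
structure HomTree (Q : ℕ) : Type 1 where
  V : Type
  graph : SimpleGraph V
  isTree : graph.IsTree
  regular : ∀ x : V, {y : V | graph.Adj x y}.ncard = Q + 1

/-- `γ(0) = 2/(Q^{1/2} + Q^{-1/2})`. -/
def gammaZero (Q : ℕ) : ℝ := 2 / (Real.sqrt Q + (Real.sqrt Q)⁻¹)

/-- The radial Schrödinger kernel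
`s_t(n) = e^{it} (2/π) ∑_{k≥0} Q^{-n/2-k} ∫₀^π e^{-iγ(0)t cos λ} sin λ sin((n+2k+1)λ) dλ`. -/
def schKernel (Q : ℕ) (t : ℝ) (n : ℕ) : ℂ :=
  Complex.exp (Complex.I * t) * (2 / Real.pi) *
    ∑' k : ℕ, (((Q : ℝ) ^ (-(n : ℝ) / 2 - (k : ℝ)) : ℝ) : ℂ) *
      ∫ l in (0 : ℝ)..Real.pi,
        Complex.exp (-Complex.I * (gammaZero Q) * t * Real.cos l) *
          (Real.sin l : ℂ) * (Real.sin (((n : ℝ) + 2 * k + 1) * l) : ℂ)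

/-- The sum of `g` over the sphere of radius `n` centred at `x`. -/
def sphereSum {Q : ℕ} (T : HomTree Q) (g : T.V → ℂ) (x : T.V) (n : ℕ) : ℂ :=
  ∑' y : {y : T.V // T.graph.dist x y = n}, g y

/-- The Schrödinger propagator `e^{itℒ}`, realised (and extended to all
`L^p` spaces) as convolution with the radial kernel `s_t`:
`e^{itℒ}g(x) = ∑_{n≥0} s_t(n) ∑_{d(x,y)=n} g(y)`. -/
def propagate {Q : ℕ} (T : HomTree Q) (t : ℝ) (g : T.V → ℂ) (x : T.V) : ℂ :=
  ∑' n : ℕ, schKernel Q t n * sphereSum T g x n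

/-- The `L^q(𝕋)` norm (with the counting measure), valued in `ℝ≥0∞`, for an
exponent `q : ℝ≥0∞`. -/
def spaceNorm {Q : ℕ} (T : HomTree Q) (q : ℝ≥0∞) (g : T.V → ℂ) : ℝ≥0∞ :=
  if q = ∞ then ⨆ x : T.V, (‖g x‖₊ : ℝ≥0∞)
  else (∑' x : T.V, (‖g x‖₊ : ℝ≥0∞) ^ q.toReal) ^ (1 / q.toReal)

/-- The mixed Lebesgue norm `L^p_t L^q_x` over a time set `A ⊆ ℝ`
(with `sup` in time when `p = ∞`), valued in `ℝ≥0∞`. -/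
def mixedNorm {Q : ℕ} (T : HomTree Q) (p q : ℝ≥0∞) (A : Set ℝ)
    (u : ℝ → T.V → ℂ) : ℝ≥0∞ :=
  if p = ∞ then ⨆ t ∈ A, spaceNorm T q (u t)
  else (∫⁻ t in A, (spaceNorm T q (u t)) ^ p.toReal) ^ (1 / p.toReal)

/-- The admissible set `𝒞 = ((0,1/2] × [0,1/2)) ∪ {(0,1/2)}` for the couple
`(1/p, 1/q)`. -/
def admissiblePair (p q : ℝ≥0∞) : Prop :=
  (0 < p⁻¹ ∧ p⁻¹ ≤ 2⁻¹ ∧ q⁻¹ < 2⁻¹) ∨ (p⁻¹ = 0 ∧ q⁻¹ = 2⁻¹)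

/-- A power-like nonlinearity of degree `γ`: `|F(u)| ≤ C|u|^γ` and
`|F(u)-F(v)| ≤ C(|u|^{γ-1} + |v|^{γ-1})|u-v|`. -/
def PowerLike (F : ℂ → ℂ) (γ : ℝ) : Prop :=
  ∃ C : ℝ, 0 < C ∧ (∀ u : ℂ, ‖F u‖ ≤ C * ‖u‖ ^ γ) ∧
    ∀ u v : ℂ, ‖F u - F v‖ ≤ C * (‖u‖ ^ (γ - 1) + ‖v‖ ^ (γ - 1)) * ‖u - v‖

/-- The gauge invariance condition `Im (F(u) ū) = 0`. -/
def GaugeInvariant (F : ℂ → ℂ) : Prop :=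
  ∀ u : ℂ, (F u * (starRingEnd ℂ) u).im = 0

/-- `u` solves the semilinear Schrödinger equation `i∂ₜu + ℒu = F(u)`, `u(0)=f`,
in the Duhamel (integral) form
`u(t) = e^{itℒ}f - i∫₀ᵗ e^{i(t-s)ℒ}F(u(s)) ds`, on the time set `A`. -/
def SolvesNLS {Q : ℕ} (T : HomTree Q) (F : ℂ → ℂ) (f : T.V → ℂ)
    (u : ℝ → T.V → ℂ) (A : Set ℝ) : Prop :=
  ∀ t ∈ A, ∀ x : T.V, u t x = propagate T t f x -
    Complex.I * ∫ s in (0 : ℝ)..t, propagate T (t - s) (fun y => F (u s y)) x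

/-- `u : A → L²(𝕋)` is continuous in the `L²` norm. -/
def ContL2On {Q : ℕ} (T : HomTree Q) (u : ℝ → T.V → ℂ) (A : Set ℝ) : Prop :=
  ∀ t₀ ∈ A, Filter.Tendsto (fun t => spaceNorm T 2 (fun x => u t x - u t₀ x))
    (nhdsWithin t₀ A) (nhds 0)

/-- The norm of the space `X = C(A; L²(𝕋)) ∩ L^p(A; L^q(𝕋))`. -/
def Xnorm {Q : ℕ} (T : HomTree Q) (p q : ℝ≥0∞) (A : Set ℝ)
    (u : ℝ → T.V → ℂ) : ℝ≥0∞ :=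
  (⨆ t ∈ A, spaceNorm T 2 (u t)) + mixedNorm T p q A u

namespace HomTree

variable {Q : ℕ} (T : HomTree Q)

/-! ### Combinatorics of the homogeneous tree -/

lemma finite_neighborSet (x : T.V) : {y : T.V | T.graph.Adj x y}.Finite :=
  Set.finite_of_ncard_pos (by rw [T.regular x]; omega)

/-- The finset of neighbours of `x`. -/
def nb (x : T.V) : Finset T.V := (T.finite_neighborSet x).toFinset

@[simp] lemma mem_nb {x y : T.V} : y ∈ T.nb x ↔ T.graph.Adj x y := by simp [nb]

lemma card_nb (x : T.V) : (T.nb x).card = Q + 1 := by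
  rw [nb, ← Set.ncard_eq_toFinset_card _ (T.finite_neighborSet x), T.regular]

lemma exists_closer {x z : T.V} (h : x ≠ z) :
    ∃ y, T.graph.Adj x y ∧ T.graph.dist x z = T.graph.dist y z + 1 := by
  obtain ⟨p, hp, hl⟩ := T.isTree.connected.exists_path_of_dist x z
  cases p with
  | nil => exact absurd rfl h
  | @cons _ y _ hxy q =>
    refine ⟨y, hxy, ?_⟩
    have h1 := SimpleGraph.dist_le q
    have h2 := T.isTree.dist_eq_dist_add_one_of_adj z hxy
    simp only [SimpleGraph.Walk.length_cons] at hl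
    rw [SimpleGraph.dist_comm (u := z), SimpleGraph.dist_comm (u := z)] at h2
    omega

lemma closer_unique {x y y' z : T.V} (hy : T.graph.Adj x y) (hy' : T.graph.Adj x y')
    (h : T.graph.dist x z = T.graph.dist y z + 1) (h' : T.graph.dist x z = T.graph.dist y' z + 1) :
    y = y' := by
  have key : ∀ y, T.graph.Adj x y → T.graph.dist x z = T.graph.dist y z + 1 →
      ∃ p : T.graph.Walk x z, p.IsPath ∧ p.snd = y := by
    intro y hy h
    obtain ⟨q, hq, hl⟩ := T.isTree.connected.exists_path_of_dist y z
    refine ⟨SimpleGraph.Walk.cons hy q, ?_, by simp⟩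
    apply SimpleGraph.Walk.isPath_of_length_eq_dist
    rw [SimpleGraph.Walk.length_cons, hl, h]
  obtain ⟨p, hp, hps⟩ := key y hy h
  obtain ⟨p', hp', hps'⟩ := key y' hy' h'
  have : p = p' := (T.isTree.existsUnique_path x z).unique hp hp'
  rw [← hps, ← hps', this]

lemma dist_nb {x y : T.V} (z : T.V) (h : T.graph.Adj x y) :
    T.graph.dist x z = T.graph.dist y z + 1 ∨ T.graph.dist y z = T.graph.dist x z + 1 := by
  have h2 := T.isTree.dist_eq_dist_add_one_of_adj z h
  rwa [SimpleGraph.dist_comm (u := z), SimpleGraph.dist_comm (u := z)] at h2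

open Classical in
lemma card_closer {x z : T.V} (h : x ≠ z) :
    ((T.nb x).filter fun y => T.graph.dist x z = T.graph.dist y z + 1).card = 1 := by
  obtain ⟨y, hy, hd⟩ := T.exists_closer h
  rw [Finset.card_eq_one]
  refine ⟨y, ?_⟩
  ext y'
  simp only [Finset.mem_filter, mem_nb, Finset.mem_singleton]
  constructor
  · rintro ⟨h1, h2⟩
    exact T.closer_unique h1 hy h2 hd
  · rintro rfl
    exact ⟨hy, hd⟩

open Classical in
lemma card_farther {x z : T.V} (h : x ≠ z) :
    ((T.nb x).filter fun y => T.graph.dist y z = T.graph.dist x z + 1).card = Q := by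
  have h1 := T.card_closer h
  have h2 := Finset.card_filter_add_card_filter_not (s := T.nb x)
    (fun y => T.graph.dist x z = T.graph.dist y z + 1)
  rw [T.card_nb, h1] at h2
  have : ((T.nb x).filter fun y => T.graph.dist y z = T.graph.dist x z + 1) =
      (T.nb x).filter fun y => ¬ T.graph.dist x z = T.graph.dist y z + 1 := by
    apply Finset.filter_congr
    intro y hy
    have := T.dist_nb z (T.mem_nb.1 hy)
    omega
  rw [this]
  omega

lemma finite_sphere (x : T.V) (n : ℕ) : {y : T.V | T.graph.dist x y = n}.Finite := by
  induction n with
  | zero =>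
    refine (Set.finite_singleton x).subset ?_
    intro y hy
    exact (T.isTree.connected.dist_eq_zero_iff.1 hy).symm
  | succ n ih =>
    refine (ih.biUnion fun z _ => T.finite_neighborSet z).subset ?_
    intro y hy
    have hy : T.graph.dist x y = n + 1 := hy
    have hne : y ≠ x := by
      rintro rfl
      simp at hy
    obtain ⟨z, hz, hd⟩ := T.exists_closer hne
    simp only [Set.mem_iUnion]
    refine ⟨z, ?_, hz.symm⟩
    rw [SimpleGraph.dist_comm] at hy
    have : T.graph.dist z x = n := by omega
    rw [SimpleGraph.dist_comm] at this
    exact this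

instance countable_V : Countable T.V := by
  obtain ⟨x⟩ := T.isTree.connected.nonempty
  rw [← Set.countable_univ_iff]
  have : (Set.univ : Set T.V) = ⋃ n : ℕ, {y | T.graph.dist x y = n} := by
    ext y; simp
  rw [this]
  exact Set.countable_iUnion fun n => (T.finite_sphere x n).countable

/-- The sphere of radius `n` about `x`, as a finset. -/
def sph (x : T.V) (n : ℕ) : Finset T.V := (T.finite_sphere x n).toFinset

@[simp] lemma mem_sph {x y : T.V} {n : ℕ} : y ∈ T.sph x n ↔ T.graph.dist x y = n := by simp [sph]

lemma sphereSum_eq (g : T.V → ℂ) (x : T.V) (n : ℕ) :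
    sphereSum T g x n = ∑ y ∈ T.sph x n, g y := by
  have h : ((T.sph x n : Finset T.V) : Set T.V) = {y | T.graph.dist x y = n} := by
    ext; simp
  rw [sphereSum, ← Finset.tsum_subtype' (T.sph x n) g, h]
  rfl

lemma sphereSum_zero (g : T.V → ℂ) (x : T.V) : sphereSum T g x 0 = g x := by
  rw [sphereSum_eq]
  have : T.sph x 0 = {x} := by
    ext y
    simp [T.isTree.connected.dist_eq_zero_iff, eq_comm]
  simp [this]

lemma sphereSum_one (g : T.V → ℂ) (x : T.V) : sphereSum T g x 1 = ∑ y ∈ T.nb x, g y := by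
  rw [sphereSum_eq]
  congr 1
  ext y
  simp [SimpleGraph.dist_eq_one_iff_adj]

lemma sum_nb_sphereSum (g : T.V → ℂ) (x : T.V) (n : ℕ) :
    ∑ y ∈ T.nb x, sphereSum T g y (n + 1) = sphereSum T g x (n + 2) +
      (if n = 0 then (Q + 1 : ℂ) else Q) * sphereSum T g x n := by
  classical
  simp_rw [sphereSum_eq]
  have hdisj : Disjoint (T.sph x (n + 2)) (T.sph x n) := by
    rw [Finset.disjoint_left]
    intro z hz hz'
    rw [mem_sph] at hz hz'
    omega
  rw [Finset.sum_comm' (s := T.nb x) (t := fun y => T.sph y (n + 1))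
    (t' := T.sph x (n + 2) ∪ T.sph x n)
    (s' := fun z => (T.nb x).filter fun y => T.graph.dist y z = n + 1), Finset.sum_union hdisj,
    Finset.mul_sum]
  · congr 1
    · refine Finset.sum_congr rfl fun z hz => ?_
      rw [mem_sph] at hz
      rw [Finset.sum_const]
      have hne : x ≠ z := by
        rintro rfl
        simp at hz
      have := T.card_closer hne
      rw [hz] at this
      have h2 : ((T.nb x).filter fun y => T.graph.dist y z = n + 1) =
          (T.nb x).filter fun y => n + 2 = T.graph.dist y z + 1 :=
        Finset.filter_congr fun y _ => by omega
      rw [h2, this, one_smul]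
    · refine Finset.sum_congr rfl fun z hz => ?_
      rw [mem_sph] at hz
      rw [Finset.sum_const, nsmul_eq_mul]
      congr 1
      by_cases hn : n = 0
      · subst hn
        have hxz : x = z := T.isTree.connected.dist_eq_zero_iff.1 hz
        subst hxz
        have : ((T.nb x).filter fun y => T.graph.dist y x = 0 + 1) = T.nb x := by
          apply Finset.filter_true_of_mem
          intro y hy
          rw [mem_nb] at hy
          simpa [SimpleGraph.dist_eq_one_iff_adj] using hy.symm
        rw [this, T.card_nb]
        simp
      · have hne : x ≠ z := by
          rintro rfl
          simp at hz
          omega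
        have := T.card_farther hne
        rw [hz] at this
        rw [this, if_neg hn]
  · intro y z
    simp only [mem_nb, mem_sph, Finset.mem_filter, Finset.mem_union]
    constructor
    · rintro ⟨h1, h2⟩
      refine ⟨⟨h1, h2⟩, ?_⟩
      have := T.dist_nb z h1
      omega
    · rintro ⟨h, -⟩
      exact h

/-! ### Sums over balls of fixed parity -/

/-- `∑_{k ≤ m/2} sphereSum g x (m - 2k)`: the sum of `g` over the points at distance at most `m`
from `x` and of the same parity as `m`. -/
def parityBallSum (g : T.V → ℂ) (x : T.V) : ℕ → ℂ
  | 0 => sphereSum T g x 0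
  | 1 => sphereSum T g x 1
  | m + 2 => sphereSum T g x (m + 2) + parityBallSum g x m

lemma sum_nb_parityBallSum (g : T.V → ℂ) (x : T.V) (m : ℕ) :
    ∑ y ∈ T.nb x, T.parityBallSum g y (m + 1) =
      T.parityBallSum g x (m + 2) + Q * T.parityBallSum g x m := by
  induction m using Nat.twoStepInduction with
  | zero =>
    have := T.sum_nb_sphereSum g x 0
    simp only [parityBallSum, zero_add] at this ⊢
    rw [this]
    simp
    ring
  | one =>
    have h1 := T.sum_nb_sphereSum g x 1
    simp only [parityBallSum, zero_add, Finset.sum_add_distrib, sphereSum_zero,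
      ← sphereSum_one] at h1 ⊢
    norm_num at h1
    rw [h1]
    ring
  | more m ih _ =>
    have h1 := T.sum_nb_sphereSum g x (m + 2)
    simp only [parityBallSum, Finset.sum_add_distrib] at h1 ih ⊢
    rw [h1, ih]
    simp
    ring

lemma parityBallSum_eq (g : T.V → ℂ) (x : T.V) (m : ℕ) :
    T.parityBallSum g x m = ∑ k ∈ Finset.range (m / 2 + 1), sphereSum T g x (m - 2 * k) := by
  induction m using Nat.twoStepInduction with
  | zero => simp [parityBallSum]
  | one => simp [parityBallSum]
  | more m ih _ =>
    rw [parityBallSum, ih, show (m + 2) / 2 + 1 = (m / 2 + 1) + 1 by omega,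
      Finset.sum_range_succ' _ (m / 2 + 1), add_comm]
    simp only [mul_zero, Nat.sub_zero]
    congr 1
    refine Finset.sum_congr rfl fun k _ => congrArg (sphereSum T g x) ?_
    omega

end HomTree

namespace HomTree

variable {Q : ℕ} (T : HomTree Q)

/-! ### The adjacency operator on `ℓ²` -/

/-- The Hilbert space `ℓ²(𝕋)`. -/
abbrev L2 : Type := lp (fun _ : T.V => ℂ) 2

/-- `∑ₓ |g x|^p`. -/
def powSum (p : ℝ) (g : T.V → ℂ) : ℝ≥0∞ := ∑' x, ‖g x‖ₑ ^ p

variable {T}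

lemma L2.sub_apply (f g : T.L2) (x : T.V) : (f - g) x = f x - g x := rfl

lemma L2.smul_apply (c : ℂ) (f : T.L2) (x : T.V) : (c • f) x = c * f x := rfl

/-- Evaluation at a vertex. -/
def evalL (x : T.V) : T.L2 →L[ℂ] ℂ :=
  LinearMap.mkContinuous
    { toFun := fun f => f x, map_add' := fun _ _ => rfl, map_smul' := fun _ _ => rfl } 1
    (fun f => by
      rw [one_mul]
      exact lp.norm_apply_le_norm (by simp) f x)

@[simp] lemma evalL_apply (x : T.V) (f : T.L2) : evalL x f = f x := rfl

lemma L2.sum_apply {ι : Type*} (s : Finset ι) (f : ι → T.L2) (x : T.V) :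
    (∑ i ∈ s, f i) x = ∑ i ∈ s, f i x := map_sum (evalL x) f s

lemma enorm_rpow_two (f : T.L2) : ‖f‖ₑ ^ (2 : ℝ) = T.powSum 2 f := by
  have h := lp.hasSum_norm (p := 2) (by simp) f
  simp only [ENNReal.toReal_ofNat] at h
  have hterm : ∀ x, ‖f x‖ₑ ^ (2 : ℝ) = ENNReal.ofReal (‖f x‖ ^ (2 : ℝ)) := fun x => by
    rw [← ENNReal.ofReal_rpow_of_nonneg (norm_nonneg _) (by norm_num), ofReal_norm]
  rw [powSum, ← ofReal_norm, ENNReal.ofReal_rpow_of_nonneg (norm_nonneg _) (by norm_num),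
    ← h.tsum_eq, ENNReal.ofReal_tsum_of_nonneg (fun _ => by positivity) h.summable]
  exact tsum_congr fun x => (hterm x).symm

lemma memℓp_two_of_powSum {g : T.V → ℂ} (h : T.powSum 2 g ≠ ∞) : Memℓp g 2 := by
  apply memℓp_gen
  have := ENNReal.summable_toReal h
  refine this.congr fun x => ?_
  rw [← ENNReal.toReal_rpow]
  simp

lemma enorm_le_of_powSum_le {f g : T.L2} {c : ℝ≥0∞}
    (h : T.powSum 2 f ≤ c ^ (2 : ℝ) * T.powSum 2 g) : ‖f‖ₑ ≤ c * ‖g‖ₑ := by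
  rw [← enorm_rpow_two, ← enorm_rpow_two, ← ENNReal.mul_rpow_of_nonneg _ _ (by norm_num)] at h
  exact (ENNReal.rpow_le_rpow_iff (by norm_num)).1 h

variable (T)

open Classical in
lemma tsum_sum_nb_comm (f : T.V → T.V → ℝ≥0∞) :
    ∑' x, ∑ y ∈ T.nb x, f x y = ∑' y, ∑ x ∈ T.nb y, f x y := by
  have h1 : ∀ x, ∑ y ∈ T.nb x, f x y = ∑' y, if T.graph.Adj x y then f x y else 0 := fun x => by
    rw [tsum_eq_sum (s := T.nb x)]
    · exact Finset.sum_congr rfl fun y hy => by rw [if_pos (T.mem_nb.1 hy)]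
    · intro y hy
      rw [if_neg (by simpa using hy)]
  have h2 : ∀ y, ∑ x ∈ T.nb y, f x y = ∑' x, if T.graph.Adj x y then f x y else 0 := fun y => by
    rw [tsum_eq_sum (s := T.nb y)]
    · exact Finset.sum_congr rfl fun x hx => by rw [if_pos (T.mem_nb.1 hx).symm]
    · intro x hx
      rw [if_neg]
      simpa [SimpleGraph.adj_comm] using hx
  simp_rw [h1, h2]
  exact ENNReal.tsum_comm

open Classical in
lemma sum_nb_weight_le (hQ : 1 ≤ Q) (o x : T.V) :
    ∑ y ∈ T.nb x, (NNReal.sqrt Q)⁻¹ ^ T.graph.dist y o ≤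
      2 * NNReal.sqrt Q * (NNReal.sqrt Q)⁻¹ ^ T.graph.dist x o := by
  set s := NNReal.sqrt Q with hs
  have hss : s * s = Q := NNReal.mul_self_sqrt _
  have hs0 : s ≠ 0 := by
    rintro h
    rw [h, zero_mul] at hss
    have : Q = 0 := by exact_mod_cast hss.symm
    omega
  by_cases hx : x = o
  · subst hx
    have : ∀ y ∈ T.nb x, s⁻¹ ^ T.graph.dist y x = s⁻¹ := fun y hy => by
      rw [SimpleGraph.dist_eq_one_iff_adj.2 (T.mem_nb.1 hy).symm, pow_one]
    rw [Finset.sum_congr rfl this, Finset.sum_const, T.card_nb, nsmul_eq_mul,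
      SimpleGraph.dist_self, pow_zero, mul_one]
    rw [← div_eq_mul_inv, div_le_iff₀ (pos_iff_ne_zero.2 hs0), mul_assoc, hss]
    have : (1 : ℝ≥0) ≤ Q := by exact_mod_cast hQ
    push_cast
    linarith
  · rw [← Finset.sum_filter_add_sum_filter_not (T.nb x)
      (fun y => T.graph.dist x o = T.graph.dist y o + 1)]
    have e1 : ∀ y ∈ (T.nb x).filter fun y => T.graph.dist x o = T.graph.dist y o + 1,
        s⁻¹ ^ T.graph.dist y o = s * s⁻¹ ^ T.graph.dist x o := fun y hy => by
      rw [(Finset.mem_filter.1 hy).2, pow_succ]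
      field_simp
    have e2 : ∀ y ∈ (T.nb x).filter fun y => ¬ T.graph.dist x o = T.graph.dist y o + 1,
        s⁻¹ ^ T.graph.dist y o = s⁻¹ * s⁻¹ ^ T.graph.dist x o := fun y hy => by
      obtain ⟨h1, h2⟩ := Finset.mem_filter.1 hy
      have := T.dist_nb o (T.mem_nb.1 h1)
      rw [show T.graph.dist y o = T.graph.dist x o + 1 by omega, pow_succ, mul_comm]
    have c1 := T.card_closer hx
    have c2 : ((T.nb x).filter fun y => ¬ T.graph.dist x o = T.graph.dist y o + 1).card = Q := by
      have h2 := Finset.card_filter_add_card_filter_not (s := T.nb x)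
        (fun y => T.graph.dist x o = T.graph.dist y o + 1)
      rw [T.card_nb, c1] at h2
      omega
    rw [Finset.sum_congr rfl e1, Finset.sum_congr rfl e2, Finset.sum_const, Finset.sum_const, c1,
      c2, one_smul, nsmul_eq_mul, ← hss]
    apply le_of_eq
    field_simp
    ring

/-- Schur's test for the adjacency operator, with weight `Q^{-|x|/2}`. -/
lemma tsum_sq_sum_nb_le (hQ : 1 ≤ Q) (a : T.V → ℝ≥0) :
    ∑' x, (((∑ y ∈ T.nb x, a y) ^ 2 : ℝ≥0) : ℝ≥0∞) ≤
      ((2 * NNReal.sqrt Q) ^ 2 : ℝ≥0) * ∑' x, ((a x ^ 2 : ℝ≥0) : ℝ≥0∞) := by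
  obtain ⟨o⟩ := T.isTree.connected.nonempty
  set c : ℝ≥0 := 2 * NNReal.sqrt Q with hc
  set w : T.V → ℝ≥0 := fun x => (NNReal.sqrt Q)⁻¹ ^ T.graph.dist x o with hw
  have hs0 : (0 : ℝ≥0) < NNReal.sqrt Q := NNReal.sqrt_pos.2 (by exact_mod_cast hQ)
  have hw0 : ∀ x, w x ≠ 0 := fun x => pow_ne_zero _ (inv_ne_zero hs0.ne')
  have hS : ∀ x, ∑ y ∈ T.nb x, w y ≤ c * w x := T.sum_nb_weight_le hQ o
  calc ∑' x, (((∑ y ∈ T.nb x, a y) ^ 2 : ℝ≥0) : ℝ≥0∞)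
      ≤ ∑' x, ∑ y ∈ T.nb x, ((c * w x * (a y ^ 2 / w y) : ℝ≥0) : ℝ≥0∞) := by
        refine ENNReal.tsum_le_tsum fun x => ?_
        rw [← ENNReal.ofNNReal_finsetSum, ENNReal.coe_le_coe, ← Finset.mul_sum]
        calc (∑ y ∈ T.nb x, a y) ^ 2 ≤ (∑ y ∈ T.nb x, w y) * ∑ y ∈ T.nb x, a y ^ 2 / w y := by
              refine Finset.sum_sq_le_sum_mul_sum_of_sq_le_mul _ (fun _ _ => zero_le)
                (fun _ _ => zero_le) fun y _ => ?_
              exact (mul_div_cancel₀ _ (hw0 y)).ge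
          _ ≤ _ := by gcongr; exact hS x
    _ = ∑' y, ∑ x ∈ T.nb y, ((c * w x * (a y ^ 2 / w y) : ℝ≥0) : ℝ≥0∞) := T.tsum_sum_nb_comm _
    _ ≤ ∑' y, ((c ^ 2 * a y ^ 2 : ℝ≥0) : ℝ≥0∞) := by
        refine ENNReal.tsum_le_tsum fun y => ?_
        rw [← ENNReal.ofNNReal_finsetSum, ENNReal.coe_le_coe, ← Finset.sum_mul, ← Finset.mul_sum]
        calc c * (∑ x ∈ T.nb y, w x) * (a y ^ 2 / w y) ≤ c * (c * w y) * (a y ^ 2 / w y) := by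
              gcongr; exact hS y
          _ = c ^ 2 * a y ^ 2 := by
              have := hw0 y
              field_simp
    _ = _ := by
        simp_rw [ENNReal.coe_mul]
        rw [ENNReal.tsum_mul_left]

lemma powSum_sum_nb_le (hQ : 1 ≤ Q) (f : T.V → ℂ) :
    T.powSum 2 (fun x => ∑ y ∈ T.nb x, f y) ≤
      ((2 * NNReal.sqrt Q : ℝ≥0) : ℝ≥0∞) ^ (2 : ℝ) * T.powSum 2 f := by
  refine le_trans (ENNReal.tsum_le_tsum fun x => ?_)
    ((T.tsum_sq_sum_nb_le hQ fun x => ‖f x‖₊).trans_eq ?_)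
  · rw [ENNReal.coe_pow, ← ENNReal.rpow_natCast]
    push_cast
    gcongr
    exact_mod_cast nnnorm_sum_le (T.nb x) f
  · rw [powSum, ENNReal.coe_pow, ← ENNReal.rpow_natCast]
    push_cast
    congr 1
    refine tsum_congr fun x => ?_
    rw [← ENNReal.rpow_natCast]
    rfl

lemma memℓp_sum_nb (hQ : 1 ≤ Q) (f : T.L2) : Memℓp (fun x => ∑ y ∈ T.nb x, f y) 2 := by
  refine memℓp_two_of_powSum (ne_top_of_le_ne_top ?_ (T.powSum_sum_nb_le hQ f))
  rw [← enorm_rpow_two]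
  finiteness

/-- The adjacency operator on `ℓ²(𝕋)`. -/
def adjOp (hQ : 1 ≤ Q) : T.L2 →L[ℂ] T.L2 :=
  LinearMap.mkContinuous
    { toFun := fun f => ⟨fun x => ∑ y ∈ T.nb x, f y, T.memℓp_sum_nb hQ f⟩
      map_add' := fun f g => by
        ext x
        exact Finset.sum_add_distrib
      map_smul' := fun c f => by
        ext x
        exact (Finset.mul_sum _ _ _).symm }
    (2 * NNReal.sqrt Q) (fun f => by
      have h : ‖(⟨fun x => ∑ y ∈ T.nb x, f y, T.memℓp_sum_nb hQ f⟩ : T.L2)‖₊ ≤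
          2 * NNReal.sqrt Q * ‖f‖₊ := by
        rw [← ENNReal.coe_le_coe, ENNReal.coe_mul]
        exact enorm_le_of_powSum_le (T.powSum_sum_nb_le hQ f)
      exact_mod_cast h)

@[simp] lemma adjOp_apply (hQ : 1 ≤ Q) (f : T.L2) (x : T.V) :
    T.adjOp hQ f x = ∑ y ∈ T.nb x, f y := rfl

lemma norm_adjOp_le (hQ : 1 ≤ Q) : ‖T.adjOp hQ‖ ≤ 2 * √Q := by
  refine (LinearMap.mkContinuous_norm_le _ (by positivity) _).trans_eq ?_
  simp

lemma inner_adjOp (hQ : 1 ≤ Q) (f g : T.L2) :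
    inner ℂ f (T.adjOp hQ g) = inner ℂ (T.adjOp hQ f) g := by
  classical
  have h : ∀ x (c : ℂ), inner ℂ f (T.adjOp hQ (lp.single 2 x c)) =
      inner ℂ (T.adjOp hQ f) (lp.single 2 x c) := by
    intro x c
    have e : T.adjOp hQ (lp.single 2 x c) = ∑ y ∈ T.nb x, lp.single 2 y c := by
      ext z
      rw [L2.sum_apply, adjOp_apply]
      simp [Pi.single_apply, SimpleGraph.adj_comm]
    rw [e, inner_sum, lp.inner_single_right]
    simp_rw [lp.inner_single_right]
    simp [Finset.mul_sum]
  have hs := lp.hasSum_single (p := 2) (by simp) g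
  have h1 := ((innerSL ℂ f).comp (T.adjOp hQ)).hasSum hs
  have h2 := (innerSL ℂ (T.adjOp hQ f)).hasSum hs
  refine h1.unique ?_
  simpa only [ContinuousLinearMap.comp_apply, innerSL_apply_apply, h] using h2

end HomTree

namespace HomTree

section Chebyshev

variable {H : Type*} [NormedAddCommGroup H] [InnerProductSpace ℂ H]

/-- Chebyshev polynomials of the second kind evaluated at an operator. -/
def chebOp (X : H →L[ℂ] H) : ℕ → H →L[ℂ] H
  | 0 => 1
  | 1 => (2 : ℂ) • X
  | m + 2 => (2 : ℂ) • (X * chebOp X (m + 1)) - chebOp X m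

lemma norm_sq_sub_eq (X : H →L[ℂ] H) (a b : H) :
    ‖b - X a‖ ^ 2 = ‖b‖ ^ 2 + ‖X a‖ ^ 2 - 2 * (inner ℂ (X a) b).re := by
  rw [@norm_sub_sq ℂ, ← inner_conj_symm b (X a)]
  simp only [RCLike.re_eq_complex_re, conj_re]
  ring

lemma chebOp_energy {X : H →L[ℂ] H} (hX : ∀ a b, inner ℂ (X a) b = inner ℂ a (X b)) (v : H)
    (m : ℕ) :
    ‖chebOp X (m + 1) v‖ ^ 2 + ‖chebOp X m v‖ ^ 2 -
      2 * (inner ℂ (X (chebOp X m v)) (chebOp X (m + 1) v)).re = ‖v‖ ^ 2 := by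
  induction m with
  | zero =>
    simp only [chebOp, smul_apply, one_apply_eq_self, norm_smul, inner_smul_right, inner_self_eq_norm_sq_to_K]
    norm_num [← ofReal_pow]
    ring
  | succ m ih =>
    rw [← ih]
    set a := chebOp X m v
    set b := chebOp X (m + 1) v
    have h : chebOp X (m + 2) v = (2 : ℂ) • X b - a := rfl
    rw [h, @norm_sub_sq ℂ, inner_sub_right, inner_smul_right, inner_smul_left, norm_smul, mul_pow,
      inner_self_eq_norm_sq_to_K, hX b a]
    have e : (inner ℂ b (X a)).re = (inner ℂ (X a) b).re := inner_re_symm (𝕜 := ℂ) b (X a)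
    norm_num [← ofReal_pow, e]
    ring

lemma norm_chebOp_apply_le {X : H →L[ℂ] H} (hX : ∀ a b, inner ℂ (X a) b = inner ℂ a (X b))
    (hX1 : ‖X‖ ≤ 1) (v : H) (m : ℕ) : ‖chebOp X m v‖ ≤ (m + 1) * ‖v‖ := by
  induction m with
  | zero => simp [chebOp]
  | succ m ih =>
    have h1 := chebOp_energy hX v m
    have h2 := norm_sq_sub_eq X (chebOp X m v) (chebOp X (m + 1) v)
    have h3 : ‖X (chebOp X m v)‖ ≤ ‖chebOp X m v‖ := X.le_of_opNorm_le_of_le hX1 le_rfl |>.trans_eq (one_mul _)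
    have h4 : ‖chebOp X (m + 1) v - X (chebOp X m v)‖ ≤ ‖v‖ := by
      apply le_of_sq_le_sq _ (norm_nonneg _)
      nlinarith [norm_nonneg (X (chebOp X m v))]
    have h5 := norm_le_norm_sub_add (chebOp X (m + 1) v) (X (chebOp X m v))
    push_cast
    linarith

lemma norm_chebOp_le {X : H →L[ℂ] H} (hX : ∀ a b, inner ℂ (X a) b = inner ℂ a (X b))
    (hX1 : ‖X‖ ≤ 1) (m : ℕ) : ‖chebOp X m‖ ≤ m + 1 :=
  ContinuousLinearMap.opNorm_le_bound _ (by positivity) fun v => norm_chebOp_apply_le hX hX1 v m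

/-- The moments `(2/π) ∫₀^π cosᵏ λ sin λ sin((m+1)λ) dλ`. -/
def cosMoment (k m : ℕ) : ℝ :=
  2 / Real.pi * ∫ l in (0 : ℝ)..Real.pi, Real.cos l ^ k * Real.sin l * Real.sin ((m + 1) * l)

lemma abs_cosMoment_le (k m : ℕ) : |cosMoment k m| ≤ 2 := by
  have h : ‖∫ l in (0 : ℝ)..Real.pi, Real.cos l ^ k * Real.sin l * Real.sin ((m + 1) * l)‖ ≤
      1 * |Real.pi - 0| := by
    refine intervalIntegral.norm_integral_le_of_norm_le_const fun l _ => ?_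
    rw [norm_mul, norm_mul, norm_pow]
    have h1 : ‖Real.cos l‖ ^ k ≤ 1 := pow_le_one₀ (norm_nonneg _) (Real.abs_cos_le_one l)
    have h2 := Real.abs_sin_le_one l
    have h3 := Real.abs_sin_le_one ((m + 1) * l)
    exact mul_le_one₀ (mul_le_one₀ h1 (norm_nonneg _) h2) (norm_nonneg _) h3
  rw [cosMoment, abs_mul, abs_of_pos (by positivity)]
  rw [Real.norm_eq_abs, sub_zero, one_mul, abs_of_pos Real.pi_pos] at h
  calc _ ≤ 2 / Real.pi * Real.pi := by gcongr
    _ = 2 := by field_simp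

lemma cosMoment_succ_succ (k m : ℕ) :
    cosMoment (k + 1) (m + 1) = (cosMoment k (m + 2) + cosMoment k m) / 2 := by
  unfold cosMoment
  rw [← mul_add, ← intervalIntegral.integral_add, mul_div_assoc, ← intervalIntegral.integral_div]
  · congr 2
    ext l
    have h := Real.sin_add ((m + 2) * l) l
    have h' := Real.sin_sub ((m + 2) * l) l
    have e1 : ((m + 2 : ℕ) + 1 : ℝ) * l = (m + 2) * l + l := by push_cast; ring
    have e2 : (m + 1 : ℝ) * l = (m + 2) * l - l := by ring
    have e3 : ((m + 1 : ℕ) + 1 : ℝ) * l = (m + 2) * l := by push_cast; ring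
    rw [e1, e2, e3, h, h']
    ring
  all_goals exact Continuous.intervalIntegrable (by fun_prop) _ _

lemma cosMoment_succ_zero (k : ℕ) : cosMoment (k + 1) 0 = cosMoment k 1 / 2 := by
  unfold cosMoment
  rw [mul_div_assoc, ← intervalIntegral.integral_div]
  congr 2
  ext l
  have e1 : ((1 : ℕ) + 1 : ℝ) * l = 2 * l := by push_cast; ring
  rw [e1, Real.sin_two_mul]
  simp
  ring

lemma integral_cos_nat_mul (j : ℕ) :
    ∫ l in (0 : ℝ)..Real.pi, Real.cos (j * l) = if j = 0 then Real.pi else 0 := by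
  rcases eq_or_ne j 0 with rfl | hj
  · simp
  · rw [intervalIntegral.integral_comp_mul_left Real.cos (by exact_mod_cast hj)]
    simp [hj]

lemma cosMoment_zero (m : ℕ) : cosMoment 0 m = if m = 0 then 1 else 0 := by
  have h : ∀ l : ℝ, Real.cos l ^ 0 * Real.sin l * Real.sin ((m + 1) * l) =
      (Real.cos ((m : ℕ) * l) - Real.cos ((m + 2 : ℕ) * l)) / 2 := fun l => by
    have e1 : ((m + 2 : ℕ) : ℝ) * l = (m + 1) * l + l := by push_cast; ring
    have e2 : (m : ℝ) * l = (m + 1) * l - l := by ring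
    rw [e1, e2, Real.cos_add, Real.cos_sub]
    ring
  unfold cosMoment
  simp_rw [h]
  rw [intervalIntegral.integral_div, intervalIntegral.integral_sub, integral_cos_nat_mul,
    integral_cos_nat_mul]
  · have := Real.pi_ne_zero
    split_ifs <;> simp_all
  all_goals exact Continuous.intervalIntegrable (by fun_prop) _ _

lemma cosMoment_of_lt {k m : ℕ} (h : k < m) : cosMoment k m = 0 := by
  induction k generalizing m with
  | zero => rw [cosMoment_zero, if_neg (by omega)]
  | succ k ih =>
    obtain ⟨m, rfl⟩ : ∃ j, m = j + 1 := ⟨m - 1, by omega⟩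
    rw [cosMoment_succ_succ, ih (by omega), ih (by omega)]
    simp

lemma mul_chebOp_succ (X : H →L[ℂ] H) (m : ℕ) :
    X * chebOp X (m + 1) = (1 / 2 : ℂ) • (chebOp X (m + 2) + chebOp X m) := by
  rw [chebOp, sub_add_cancel, smul_smul]
  norm_num

lemma pow_eq_sum_chebOp (X : H →L[ℂ] H) {k N : ℕ} (h : k < N) :
    X ^ k = ∑ m ∈ Finset.range N, (cosMoment k m : ℂ) • chebOp X m := by
  induction k generalizing N with
  | zero =>
    simp [cosMoment_zero, h, chebOp]
  | succ k ih =>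
    obtain ⟨N, rfl⟩ : ∃ j, N = j + 2 := ⟨N - 2, by omega⟩
    set c : ℕ → ℂ := fun m => cosMoment k m
    have h1 : X ^ (k + 1) = ∑ m ∈ Finset.range (N + 1), c m • (X * chebOp X m) := by
      rw [pow_succ', ih (N := N + 1) (by omega), Finset.mul_sum]
      simp_rw [mul_smul_comm, c]
    have h2 : ∑ m ∈ Finset.range (N + 1), c m • (X * chebOp X m) =
        (1 / 2 : ℂ) • (c 0 • chebOp X 1 + (∑ m ∈ Finset.range N, c (m + 1) • chebOp X (m + 2) +
          ∑ m ∈ Finset.range N, c (m + 1) • chebOp X m)) := by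
      rw [Finset.sum_range_succ', ← Finset.sum_add_distrib, smul_add, Finset.smul_sum, add_comm]
      congr 1
      · simp only [chebOp, mul_one]
        module
      · refine Finset.sum_congr rfl fun m _ => ?_
        rw [mul_chebOp_succ]
        module
    have h3 : ∑ m ∈ Finset.range N, c (m + 1) • chebOp X m =
        ∑ m ∈ Finset.range (N + 2), c (m + 1) • chebOp X m := by
      rw [Finset.sum_range_succ, Finset.sum_range_succ]
      simp [c, cosMoment_of_lt (show k < N + 1 by omega),
        cosMoment_of_lt (show k < N + 1 + 1 by omega)]
    have h4 : ∑ m ∈ Finset.range (N + 2), (cosMoment (k + 1) m : ℂ) • chebOp X m =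
        (1 / 2 : ℂ) • (∑ m ∈ Finset.range (N + 1), c m • chebOp X (m + 1) +
          (∑ m ∈ Finset.range (N + 1), c (m + 2) • chebOp X (m + 1) + c 1 • chebOp X 0)) := by
      rw [Finset.sum_range_succ', ← add_assoc, ← Finset.sum_add_distrib, smul_add, Finset.smul_sum]
      congr 1
      · refine Finset.sum_congr rfl fun m _ => ?_
        rw [cosMoment_succ_succ]
        push_cast
        module
      · rw [cosMoment_succ_zero]
        push_cast
        module
    have h5 : ∑ m ∈ Finset.range (N + 1), c m • chebOp X (m + 1) =
        ∑ m ∈ Finset.range N, c (m + 1) • chebOp X (m + 2) + c 0 • chebOp X 1 :=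
      Finset.sum_range_succ' _ _
    have h6 : ∑ m ∈ Finset.range (N + 2), c (m + 1) • chebOp X m =
        ∑ m ∈ Finset.range (N + 1), c (m + 2) • chebOp X (m + 1) + c 1 • chebOp X 0 :=
      Finset.sum_range_succ' _ _
    rw [h1, h2, h3, h4, h5, h6]
    module

/-- `(2/π) ∫₀^π e^{z cos λ} sin λ sin((m+1)λ) dλ`. -/
def besselCoeff (z : ℂ) (m : ℕ) : ℂ :=
  2 / Real.pi * ∫ l in (0 : ℝ)..Real.pi,
    Complex.exp (z * Real.cos l) * (Real.sin l : ℂ) * (Real.sin ((m + 1) * l) : ℂ)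

lemma hasSum_besselCoeff (z : ℂ) (m : ℕ) :
    HasSum (fun k : ℕ => z ^ k / (k.factorial : ℂ) * cosMoment k m) (besselCoeff z m) := by
  have h := intervalIntegral.hasSum_integral_of_dominated_convergence (μ := volume)
    (a := 0) (b := Real.pi) (ι := ℕ)
    (F := fun k l => z ^ k / (k.factorial : ℂ) *
      ((Real.cos l ^ k * Real.sin l * Real.sin ((m + 1) * l) : ℝ) : ℂ))
    (f := fun l => Complex.exp (z * Real.cos l) * (Real.sin l : ℂ) *
      (Real.sin ((m + 1) * l) : ℂ))
    (fun k _ => ‖z‖ ^ k / k.factorial)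
    (fun k => Continuous.aestronglyMeasurable (by fun_prop))
    (fun k => .of_forall fun l _ => by
      rw [norm_mul, norm_div, norm_pow, norm_natCast, norm_real, norm_mul, norm_mul, norm_pow]
      have h1 : ‖Real.cos l‖ ^ k ≤ 1 := pow_le_one₀ (norm_nonneg _) (Real.abs_cos_le_one l)
      have h2 := Real.abs_sin_le_one l
      have h3 := Real.abs_sin_le_one ((m + 1) * l)
      exact mul_le_of_le_one_right (by positivity)
        (mul_le_one₀ (mul_le_one₀ h1 (norm_nonneg _) h2) (norm_nonneg _) h3))
    (.of_forall fun _ _ => Real.summable_pow_div_factorial _)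
    (by simp)
    (.of_forall fun l _ => by
      have := (NormedSpace.expSeries_div_hasSum_exp (z * Real.cos l)).mul_right
        ((Real.sin l : ℂ) * (Real.sin ((m + 1) * l) : ℂ))
      rw [← Complex.exp_eq_exp_ℂ, ← mul_assoc] at this
      refine this.congr_fun fun k => ?_
      push_cast
      ring)
  have h' := h.mul_left (2 / Real.pi : ℂ)
  refine h'.congr_fun fun k => ?_
  rw [intervalIntegral.integral_const_mul, intervalIntegral.integral_ofReal, cosMoment]
  push_cast
  ring

lemma summable_cosMoment_weight (z : ℂ) :
    Summable fun p : ℕ × ℕ => ‖z‖ ^ p.1 / p.1.factorial * |cosMoment p.1 p.2| * (p.2 + 1) := by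
  have hs : ∀ k : ℕ, HasSum (fun m : ℕ => ‖z‖ ^ k / k.factorial * |cosMoment k m| * (m + 1))
      (∑ m ∈ Finset.range (k + 1), ‖z‖ ^ k / k.factorial * |cosMoment k m| * (m + 1)) := fun k =>
    hasSum_sum_of_ne_finset_zero fun m hm => by
      rw [cosMoment_of_lt (by simpa using hm)]
      simp
  rw [summable_prod_of_nonneg (fun p => by positivity)]
  refine ⟨fun k => (hs k).summable, ?_⟩
  refine Summable.of_nonneg_of_le (fun k => tsum_nonneg fun m => by positivity) (fun k => ?_)
    ((Real.summable_pow_div_factorial (4 * ‖z‖)).mul_left 2)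
  rw [(hs k).tsum_eq]
  calc _ ≤ ∑ m ∈ Finset.range (k + 1), ‖z‖ ^ k / k.factorial * 2 * (k + 1) := by
        refine Finset.sum_le_sum fun m hm => ?_
        have : (m : ℝ) ≤ k := by exact_mod_cast Nat.lt_succ_iff.1 (Finset.mem_range.1 hm)
        gcongr
        exact abs_cosMoment_le k m
    _ = ‖z‖ ^ k / k.factorial * 2 * ((k + 1) * (k + 1)) := by simp; ring
    _ ≤ ‖z‖ ^ k / k.factorial * 2 * (2 ^ k * 2 ^ k) := by
        have : (k + 1 : ℝ) ≤ 2 ^ k := by exact_mod_cast Nat.lt_two_pow_self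
        gcongr
    _ = _ := by
        rw [← mul_pow, mul_pow 4]
        norm_num
        ring

lemma summable_besselCoeff_weight (z : ℂ) : Summable fun m : ℕ => (m + 1) * ‖besselCoeff z m‖ := by
  have h := (summable_cosMoment_weight z).prod_symm
  refine Summable.of_nonneg_of_le (fun m => by positivity) (fun m => ?_) h.prod
  have h1 : ∀ k : ℕ, ‖z ^ k / (k.factorial : ℂ) * cosMoment k m‖ * (m + 1) =
      ‖z‖ ^ k / k.factorial * |cosMoment k m| * (m + 1) := fun k => by
    rw [norm_mul, norm_div, norm_pow, norm_natCast, norm_real, Real.norm_eq_abs]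
  have h2 : Summable fun k : ℕ => ‖z ^ k / (k.factorial : ℂ) * cosMoment k m‖ * (m + 1) :=
    (h.prod_factor m).congr fun k => (h1 k).symm
  have h3 : Summable fun k : ℕ => ‖z ^ k / (k.factorial : ℂ) * cosMoment k m‖ :=
    (summable_mul_right_iff (by positivity)).1 h2
  calc (m + 1) * ‖besselCoeff z m‖
      ≤ (m + 1) * ∑' k : ℕ, ‖z ^ k / (k.factorial : ℂ) * cosMoment k m‖ := by
        rw [← (hasSum_besselCoeff z m).tsum_eq]
        gcongr
        exact norm_tsum_le_tsum_norm h3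
    _ = ∑' k : ℕ, ‖z ^ k / (k.factorial : ℂ) * cosMoment k m‖ * (m + 1) := by
        rw [tsum_mul_right, mul_comm]
    _ = _ := tsum_congr h1

lemma hasSum_besselCoeff_smul {E : Type*} [NormedRing E] [NormedAlgebra ℂ E] [CompleteSpace E]
    {X : E} {V : ℕ → E} (hV : ∀ m, ‖V m‖ ≤ m + 1)
    (hX : ∀ k, X ^ k = ∑ m ∈ Finset.range (k + 1), (cosMoment k m : ℂ) • V m) (z : ℂ) :
    HasSum (fun m => besselCoeff z m • V m) (NormedSpace.exp (z • X)) := by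
  let f : ℕ × ℕ → E := fun p => (z ^ p.1 / (p.1.factorial : ℂ) * cosMoment p.1 p.2) • V p.2
  have hf : Summable f := by
    refine Summable.of_norm_bounded (summable_cosMoment_weight z) fun p => ?_
    rw [norm_smul, norm_mul, norm_div, norm_pow, norm_natCast, norm_real, Real.norm_eq_abs]
    gcongr
    exact hV _
  have h1 : ∀ k, HasSum (fun m => f (k, m)) ((k.factorial⁻¹ : ℂ) • (z • X) ^ k) := fun k => by
    have h := hasSum_sum_of_ne_finset_zero (s := Finset.range (k + 1)) (f := fun m => f (k, m))
      (L := .unconditional ℕ) fun m hm => by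
        simp only [f]
        rw [cosMoment_of_lt (by simpa using hm)]
        simp
    convert h using 1
    rw [smul_pow, hX k, Finset.smul_sum, Finset.smul_sum]
    refine Finset.sum_congr rfl fun m _ => ?_
    simp only [f, smul_smul]
    congr 1
    ring
  have h2 : ∀ m, HasSum (fun k => f (k, m)) (besselCoeff z m • V m) := fun m =>
    (hasSum_besselCoeff z m).smul_const _
  have h3 := hf.hasSum.prod_fiberwise h1
  have h4 : HasSum (fun m => besselCoeff z m • V m) (∑' p, f p) :=
    HasSum.prod_fiberwise (f := f ∘ Prod.swap) ((Equiv.prodComm ℕ ℕ).hasSum_iff.2 hf.hasSum) h2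
  rwa [(NormedSpace.exp_series_hasSum_exp' (𝕂 := ℂ) (z • X)).unique h3]

lemma hasSum_besselCoeff_chebOp [CompleteSpace H] {X : H →L[ℂ] H}
    (hX : ∀ a b, inner ℂ (X a) b = inner ℂ a (X b)) (hX1 : ‖X‖ ≤ 1) (z : ℂ) :
    HasSum (fun m => besselCoeff z m • chebOp X m) (NormedSpace.exp (z • X)) :=
  hasSum_besselCoeff_smul (norm_chebOp_le hX hX1)
    (fun k => pow_eq_sum_chebOp X k.lt_succ_self) z

lemma norm_besselCoeff_le {z : ℂ} (hz : z.re = 0) (m : ℕ) : ‖besselCoeff z m‖ ≤ 2 := by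
  have h : ‖∫ l in (0 : ℝ)..Real.pi, Complex.exp (z * Real.cos l) * (Real.sin l : ℂ) *
      (Real.sin ((m + 1) * l) : ℂ)‖ ≤ 1 * |Real.pi - 0| := by
    refine intervalIntegral.norm_integral_le_of_norm_le_const fun l _ => ?_
    rw [norm_mul, norm_mul, norm_real, norm_real, Complex.norm_exp, re_mul_ofReal, hz, zero_mul,
      Real.exp_zero, one_mul]
    exact mul_le_one₀ (Real.abs_sin_le_one _) (norm_nonneg _) (Real.abs_sin_le_one _)
  rw [besselCoeff, norm_mul, norm_div, norm_real, Real.norm_eq_abs, abs_of_pos Real.pi_pos]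
  rw [sub_zero, one_mul, abs_of_pos Real.pi_pos] at h
  calc _ ≤ ‖(2 : ℂ)‖ / Real.pi * Real.pi := by gcongr
    _ = 2 := by
      have := Real.pi_ne_zero
      norm_num

lemma norm_mul_besselCoeff_le {z : ℂ} (hz : z.re = 0) (m : ℕ) :
    ‖z‖ * ‖besselCoeff z m‖ ≤ 2 * (m + 1) := by
  have hparts := intervalIntegral.integral_mul_deriv_eq_deriv_mul (a := 0) (b := Real.pi)
    (u := fun l : ℝ => (Real.sin ((m + 1) * l) : ℂ))
    (u' := fun l : ℝ => ((Real.cos ((m + 1) * l) * (m + 1) : ℝ) : ℂ))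
    (v := fun l : ℝ => Complex.exp (z * Real.cos l))
    (v' := fun l : ℝ => Complex.exp (z * Real.cos l) * (z * ((-Real.sin l : ℝ) : ℂ)))
    (fun l _ => (((Real.hasDerivAt_sin _).comp l
      ((hasDerivAt_id l).const_mul (m + 1 : ℝ))).ofReal_comp.congr_deriv (by simp)))
    (fun l _ => (((Real.hasDerivAt_cos l).ofReal_comp.const_mul z).cexp))
    (Continuous.intervalIntegrable (by fun_prop) _ _)
    (Continuous.intervalIntegrable (by fun_prop) _ _)
  have e : z * besselCoeff z m = 2 / Real.pi * ∫ l in (0 : ℝ)..Real.pi,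
      ((Real.cos ((m + 1) * l) * (m + 1) : ℝ) : ℂ) * Complex.exp (z * Real.cos l) := by
    have h1 : Real.sin ((m + 1) * Real.pi) = 0 := by
      exact_mod_cast Real.sin_nat_mul_pi (m + 1)
    rw [h1] at hparts
    simp only [ofReal_zero, zero_mul, mul_zero, Real.sin_zero, sub_zero, zero_sub] at hparts
    rw [← neg_eq_iff_eq_neg] at hparts
    rw [← hparts, ← intervalIntegral.integral_neg, besselCoeff, mul_left_comm,
      ← intervalIntegral.integral_const_mul]
    congr 2
    ext l
    push_cast
    ring
  have h : ‖∫ l in (0 : ℝ)..Real.pi, ((Real.cos ((m + 1) * l) * (m + 1) : ℝ) : ℂ) *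
      Complex.exp (z * Real.cos l)‖ ≤ (m + 1) * |Real.pi - 0| := by
    refine intervalIntegral.norm_integral_le_of_norm_le_const fun l _ => ?_
    rw [norm_mul, norm_real, norm_mul, Complex.norm_exp, re_mul_ofReal, hz, zero_mul,
      Real.exp_zero, mul_one, Real.norm_of_nonneg (by positivity : (0 : ℝ) ≤ m + 1)]
    exact mul_le_of_le_one_left (by positivity) (Real.abs_cos_le_one _)
  rw [← norm_mul, e, norm_mul, norm_div, norm_real, Real.norm_eq_abs, abs_of_pos Real.pi_pos]
  rw [sub_zero, abs_of_pos Real.pi_pos] at h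
  calc _ ≤ ‖(2 : ℂ)‖ / Real.pi * ((m + 1) * Real.pi) := by gcongr
    _ = 2 * (m + 1) := by
      have := Real.pi_ne_zero
      norm_num
      field_simp

lemma norm_besselCoeff_le_div {z : ℂ} (hz : z.re = 0) (m : ℕ) :
    ‖besselCoeff z m‖ ≤ 4 * (m + 1) / (1 + ‖z‖) := by
  rw [le_div_iff₀ (by positivity)]
  nlinarith [norm_mul_besselCoeff_le hz m, norm_besselCoeff_le hz m, (m.cast_nonneg : (0:ℝ) ≤ m)]

end Chebyshev
end HomTree

namespace HomTree

section Group

variable {H : Type*} [NormedAddCommGroup H] [InnerProductSpace ℂ H]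

/-- The unitary group `e^{it(1 - cX)}`. -/
def expGroup (c : ℝ) (X : H →L[ℂ] H) (t : ℝ) : H →L[ℂ] H :=
  Complex.exp (I * t) • NormedSpace.exp ((-I * c * t) • X)

variable (c : ℝ) (X : H →L[ℂ] H)

@[simp] lemma expGroup_zero : expGroup c X 0 = 1 := by
  simp [expGroup]

variable [CompleteSpace H]

lemma expGroup_add (s t : ℝ) : expGroup c X (s + t) = expGroup c X s * expGroup c X t := by
  let _ : NormedAlgebra ℚ (H →L[ℂ] H) := NormedAlgebra.restrictScalars ℚ ℂ _
  unfold expGroup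
  rw [smul_mul_smul_comm, ← Complex.exp_add, ← NormedSpace.exp_add_of_commute
    (((Commute.refl X).smul_left _).smul_right _), ← add_smul]
  push_cast
  congr 2
  · ring
  · congr 1
    ring

lemma analyticAt_expGroup (t : ℝ) : AnalyticAt ℝ (expGroup c X) t := by
  have h1 : AnalyticAt ℝ (fun t : ℝ => (-I * c * t) • X) t :=
    (analyticAt_const.mul (ofRealCLM.analyticAt t)).smul analyticAt_const
  have h2 : AnalyticAt ℝ (fun t : ℝ => Complex.exp (I * t)) t :=
    (analyticAt_cexp.restrictScalars (𝕜 := ℝ)).comp (analyticAt_const.mul (ofRealCLM.analyticAt t))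
  have h3 : AnalyticAt ℝ (NormedSpace.exp : (H →L[ℂ] H) → _) ((-I * c * t) • X) :=
    (NormedSpace.exp_analytic (𝕂 := ℂ) _).restrictScalars
  exact h2.smul (AnalyticAt.fun_comp (f := fun t : ℝ => (-I * c * t) • X) h3 h1)

variable {X}

lemma inner_expGroup (hX : ∀ a b, inner ℂ (X a) b = inner ℂ a (X b)) (t : ℝ) (a b : H) :
    inner ℂ (expGroup c X t a) b = inner ℂ a (expGroup c X (-t) b) := by
  have h : ContinuousLinearMap.adjoint (expGroup c X t) = expGroup c X (-t) := by
    rw [← ContinuousLinearMap.star_eq_adjoint]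
    have hs : star X = X := by
      rw [ContinuousLinearMap.star_eq_adjoint]
      exact ((ContinuousLinearMap.eq_adjoint_iff X X).2 hX).symm
    unfold expGroup
    rw [star_smul, NormedSpace.star_exp, star_smul, hs]
    simp [← Complex.exp_conj]
  rw [← h, ContinuousLinearMap.adjoint_inner_right]

lemma norm_expGroup_apply (hX : ∀ a b, inner ℂ (X a) b = inner ℂ a (X b)) (t : ℝ) (a : H) :
    ‖expGroup c X t a‖ = ‖a‖ := by
  have h : inner ℂ (expGroup c X t a) (expGroup c X t a) = inner ℂ a a := by
    rw [inner_expGroup c hX, ← mul_apply_eq_comp, ← expGroup_add, neg_add_cancel,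
      expGroup_zero]
    rfl
  rw [inner_self_eq_norm_sq_to_K, inner_self_eq_norm_sq_to_K] at h
  have h2 : ‖expGroup c X t a‖ ^ 2 = ‖a‖ ^ 2 := by exact_mod_cast h
  exact (pow_left_inj₀ (norm_nonneg _) (norm_nonneg _) two_ne_zero).1 h2

end Group
variable {Q : ℕ} (T : HomTree Q)

/-- The adjacency operator normalised to be a contraction. -/
def normAdj (hQ : 1 ≤ Q) : T.L2 →L[ℂ] T.L2 := ((2 * √Q : ℝ) : ℂ)⁻¹ • T.adjOp hQ

lemma norm_normAdj_le (hQ : 1 ≤ Q) : ‖T.normAdj hQ‖ ≤ 1 := by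
  have : (0 : ℝ) < 2 * √Q := by positivity
  rw [normAdj, norm_smul, norm_inv, norm_real, Real.norm_of_nonneg this.le]
  exact inv_mul_le_one_of_le₀ (T.norm_adjOp_le hQ) this.le

lemma inner_normAdj (hQ : 1 ≤ Q) (f g : T.L2) :
    inner ℂ (T.normAdj hQ f) g = inner ℂ f (T.normAdj hQ g) := by
  simp only [normAdj, smul_apply, inner_smul_left, inner_smul_right]
  rw [inner_adjOp, ← ofReal_inv, conj_ofReal]

lemma pow_mul_chebOp_apply (hQ : 1 ≤ Q) (g : T.L2) (x : T.V) (m : ℕ) :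
    ((√Q : ℝ) : ℂ) ^ m * chebOp (T.normAdj hQ) m g x = T.parityBallSum g x m := by
  have hs : ((√Q : ℝ) : ℂ) ≠ 0 := by
    have : (0 : ℝ) < √Q := by positivity
    exact_mod_cast this.ne'
  have hss : ((√Q : ℝ) : ℂ) * ((√Q : ℝ) : ℂ) = Q := by
    rw [← ofReal_mul, Real.mul_self_sqrt (by positivity)]
    simp
  have hX : ∀ (h : T.L2) x, ((√Q : ℝ) : ℂ) * ((2 : ℂ) • T.normAdj hQ h) x =
      ∑ y ∈ T.nb x, h y := fun h x => by
    rw [L2.smul_apply, normAdj, smul_apply, L2.smul_apply, adjOp_apply]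
    push_cast
    field_simp
  induction m using Nat.twoStepInduction generalizing x with
  | zero => simp [chebOp, parityBallSum, sphereSum_zero]
  | one => rw [pow_one, chebOp, smul_apply, hX, parityBallSum, sphereSum_one]
  | more m ih1 ih2 =>
    have h := T.sum_nb_parityBallSum g x m
    rw [← ih1 x, Finset.sum_congr rfl fun y _ => (ih2 y).symm, ← Finset.mul_sum] at h
    have h2 := hX (chebOp (T.normAdj hQ) (m + 1) g) x
    have h3 : chebOp (T.normAdj hQ) (m + 2) g =
        (2 : ℂ) • T.normAdj hQ (chebOp (T.normAdj hQ) (m + 1) g) - chebOp (T.normAdj hQ) m g := rfl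
    rw [← h2, ← hss] at h
    rw [h3, L2.sub_apply]
    linear_combination h

/-- The Schrödinger group `e^{itℒ}` on `ℓ²`. -/
def schGroup (hQ : 1 ≤ Q) : ℝ → T.L2 →L[ℂ] T.L2 := expGroup (gammaZero Q) (T.normAdj hQ)

lemma norm_evalL_apply_le (x : T.V) (f : T.L2) : ‖f x‖ ≤ ‖f‖ := by
  exact lp.norm_apply_le_norm (by simp) f x

lemma norm_parityBallSum_le (hQ : 1 ≤ Q) (g : T.L2) (x : T.V) (m : ℕ) :
    ‖T.parityBallSum g x m‖ ≤ √Q ^ m * ((m + 1) * ‖g‖) := by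
  rw [← T.pow_mul_chebOp_apply hQ, norm_mul, norm_pow, norm_real, Real.norm_of_nonneg (by positivity)]
  gcongr
  exact (T.norm_evalL_apply_le _ _).trans
    (norm_chebOp_apply_le (T.inner_normAdj hQ) (T.norm_normAdj_le hQ) g m)

lemma norm_sphereSum_le (hQ : 1 ≤ Q) (g : T.L2) (x : T.V) (n : ℕ) :
    ‖sphereSum T g x n‖ ≤ √Q ^ n * (2 * (n + 1) * ‖g‖) := by
  have h1 : 1 ≤ √(Q : ℝ) := Real.one_le_sqrt.2 (by exact_mod_cast hQ)
  match n with
  | 0 =>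
    have := T.norm_parityBallSum_le hQ g x 0
    simp only [parityBallSum] at this
    refine this.trans ?_
    gcongr
    push_cast
    linarith
  | 1 =>
    have := T.norm_parityBallSum_le hQ g x 1
    simp only [parityBallSum] at this
    refine this.trans ?_
    gcongr
    push_cast
    linarith
  | n + 2 =>
    have h : sphereSum T g x (n + 2) = T.parityBallSum g x (n + 2) - T.parityBallSum g x n := by
      rw [parityBallSum, add_sub_cancel_right]
    rw [h]
    calc _ ≤ √Q ^ (n + 2) * (((n + 2 : ℕ) + 1) * ‖g‖) + √Q ^ n * ((n + 1) * ‖g‖) :=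
          (norm_sub_le _ _).trans (add_le_add (T.norm_parityBallSum_le hQ g x _)
            (T.norm_parityBallSum_le hQ g x _))
      _ ≤ √Q ^ (n + 2) * (((n + 2 : ℕ) + 1) * ‖g‖) +
            √Q ^ (n + 2) * (((n + 2 : ℕ) + 1) * ‖g‖) := by
          gcongr
          · omega
          · omega
      _ = _ := by ring

lemma schKernel_eq (t : ℝ) (n : ℕ) :
    schKernel Q t n = Complex.exp (I * t) *
      ∑' k : ℕ, ((√Q ^ (n + 2 * k) : ℝ) : ℂ)⁻¹ *
        besselCoeff (-I * gammaZero Q * t) (n + 2 * k) := by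
  rw [schKernel, mul_assoc, ← tsum_mul_left]
  congr 2
  ext k
  have h : ((Q : ℝ) ^ (-(n : ℝ) / 2 - (k : ℝ)) : ℝ) = (√Q ^ (n + 2 * k))⁻¹ := by
    rw [Real.sqrt_eq_rpow, ← Real.rpow_natCast, ← Real.rpow_mul (by positivity),
      ← Real.rpow_neg (by positivity)]
    congr 1
    push_cast
    ring
  rw [h, besselCoeff, mul_left_comm, ofReal_inv]
  push_cast
  rfl

lemma summable_besselCoeff_shift (z : ℂ) :
    Summable fun p : ℕ × ℕ => (1 / 2 : ℝ) ^ p.2 *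
      (((p.1 + 2 * p.2 : ℕ) + 1) * ‖besselCoeff z (p.1 + 2 * p.2)‖) := by
  set b : ℕ → ℝ := fun m => (m + 1) * ‖besselCoeff z m‖ with hb
  have hbs : Summable b := summable_besselCoeff_weight z
  have hb0 : ∀ m, 0 ≤ b m := fun m => by positivity
  have hs : ∀ k, Summable fun n => b (n + k) := fun k => (summable_nat_add_iff k).2 hbs
  rw [← (Equiv.prodComm ℕ ℕ).summable_iff, summable_prod_of_nonneg fun p => by
    dsimp only [Function.comp]
    positivity]
  refine ⟨fun k => (hs (2 * k)).mul_left ((1 / 2 : ℝ) ^ k), ?_⟩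
  refine Summable.of_nonneg_of_le (fun k => tsum_nonneg fun m => mul_nonneg (by positivity) (hb0 _))
    (fun k => ?_) (summable_geometric_two.mul_right (∑' m, b m))
  refine (tsum_mul_left (f := fun n => b (n + 2 * k)) (a := (1 / 2 : ℝ) ^ k)).trans_le ?_
  refine mul_le_mul_of_nonneg_left ?_ (by positivity)
  exact Summable.tsum_le_tsum_of_inj (fun n => n + 2 * k) (add_left_injective _)
    (fun m _ => hb0 m) (fun n => le_rfl) (hs _) hbs

lemma propagate_eq_schGroup (hQ : 2 ≤ Q) (t : ℝ) (g : T.L2) (x : T.V) :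
    propagate T t g x = T.schGroup (one_le_two.trans hQ) t g x := by
  have hQ1 : 1 ≤ Q := one_le_two.trans hQ
  set z : ℂ := -I * gammaZero Q * t with hz
  set s : ℝ := √Q with hs
  have hs0 : 0 < s := by positivity
  have hss : s * s = Q := Real.mul_self_sqrt (by positivity)
  have he : ‖Complex.exp (I * t)‖ = 1 := by simp [Complex.norm_exp]
  set φ : ℕ × ℕ → ℂ := fun p => Complex.exp (I * t) *
    (((s ^ (p.1 + 2 * p.2) : ℝ) : ℂ)⁻¹ * besselCoeff z (p.1 + 2 * p.2)) * sphereSum T g x p.1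
    with hφdef
  have hφ : Summable φ := by
    refine Summable.of_norm_bounded ((summable_besselCoeff_shift z).mul_left (2 * ‖g‖)) fun p => ?_
    obtain ⟨n, k⟩ := p
    have h1 := T.norm_sphereSum_le hQ1 g x n
    have h2 : (s ^ (n + 2 * k))⁻¹ * s ^ n ≤ (1 / 2) ^ k := by
      rw [pow_add, pow_mul, sq, hss, mul_inv, mul_right_comm, inv_mul_cancel₀ (by positivity),
        one_mul, one_div, ← inv_pow]
      gcongr
      exact_mod_cast hQ
    rw [hφdef, norm_mul, norm_mul, he, one_mul, norm_mul, norm_inv, norm_real,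
      Real.norm_of_nonneg (by positivity)]
    calc _ ≤ (s ^ (n + 2 * k))⁻¹ * ‖besselCoeff z (n + 2 * k)‖ *
          (s ^ n * (2 * (n + 1) * ‖g‖)) := by gcongr
      _ = 2 * ‖g‖ * (((s ^ (n + 2 * k))⁻¹ * s ^ n) *
          ((n + 1) * ‖besselCoeff z (n + 2 * k)‖)) := by ring
      _ ≤ _ := by
        gcongr
        omega
  have h1 : ∀ n, ∑' k, φ (n, k) = schKernel Q t n * sphereSum T g x n := fun n => by
    rw [schKernel_eq, ← tsum_mul_left, ← tsum_mul_right]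
  have hL : propagate T t g x = ∑' p, φ p := by
    rw [hφ.tsum_prod]
    exact tsum_congr fun n => (h1 n).symm
  set ψ : ℕ × ℕ → ℂ := fun p => if 2 * p.2 ≤ p.1 then Complex.exp (I * t) *
    (((s ^ p.1 : ℝ) : ℂ)⁻¹ * besselCoeff z p.1) * sphereSum T g x (p.1 - 2 * p.2) else 0 with hψdef
  have hinj : Function.Injective fun p : ℕ × ℕ => (p.1 + 2 * p.2, p.2) := by
    rintro ⟨a, b⟩ ⟨c, d⟩ h
    simp only [Prod.mk.injEq] at h ⊢
    omega
  have hψ : HasSum ψ (∑' p, φ p) := by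
    rw [← hinj.hasSum_iff]
    · convert hφ.hasSum using 1
      ext ⟨n, k⟩
      simp [hφdef, hψdef]
    · rintro ⟨m, k⟩ h
      refine if_neg fun hk => h ⟨(m - 2 * k, k), ?_⟩
      simp only [Prod.mk.injEq, and_true] at hk ⊢
      omega
  have hrow : ∀ m, HasSum (fun k => ψ (m, k)) (Complex.exp (I * t) * (besselCoeff z m *
      chebOp (T.normAdj hQ1) m g x)) := fun m => by
    have h := hasSum_sum_of_ne_finset_zero (s := Finset.range (m / 2 + 1))
      (f := fun k => ψ (m, k)) (L := .unconditional ℕ) fun k hk => by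
        refine if_neg ?_
        simp only [Finset.mem_range] at hk ⊢
        omega
    convert h using 1
    have hV := T.pow_mul_chebOp_apply hQ1 g x m
    rw [parityBallSum_eq, ← hs] at hV
    have hs' : (((s ^ m : ℝ) : ℂ)) ≠ 0 := by exact_mod_cast (pow_pos hs0 m).ne'
    have hV' : chebOp (T.normAdj hQ1) m g x = ((s ^ m : ℝ) : ℂ)⁻¹ *
        ∑ k ∈ Finset.range (m / 2 + 1), sphereSum T g x (m - 2 * k) := by
      rw [← hV, ofReal_pow, inv_mul_cancel_left₀ (by simpa using hs')]
    rw [hV', Finset.mul_sum, Finset.mul_sum, Finset.mul_sum]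
    refine Finset.sum_congr rfl fun k hk => ?_
    simp only [hψdef]
    rw [if_pos (by simp only [Finset.mem_range] at hk; omega)]
    ring
  have hU : HasSum (fun m => Complex.exp (I * t) * (besselCoeff z m *
      chebOp (T.normAdj hQ1) m g x)) (T.schGroup hQ1 t g x) := by
    have h := hasSum_besselCoeff_chebOp (T.inner_normAdj hQ1) (T.norm_normAdj_le hQ1) z
    have h2 := h.mapL ((evalL x).comp (ContinuousLinearMap.apply ℂ T.L2 g))
    exact h2.mul_left _
  rw [hL]
  exact (hψ.prod_fiberwise hrow).unique hU

end HomTree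

namespace HomTree

lemma tsum_rpow_mul_rpow_le {ι : Type*} (f g : ι → ℝ≥0∞) {p q : ℝ} (hp : 0 ≤ p) (hq : 0 ≤ q)
    (hpq : p + q = 1) :
    ∑' i, f i ^ p * g i ^ q ≤ (∑' i, f i) ^ p * (∑' i, g i) ^ q := by
  let _ : MeasurableSpace ι := ⊤
  have := ENNReal.lintegral_mul_norm_pow_le (μ := Measure.count) (f := f) (g := g)
    (measurable_from_top.aemeasurable) (measurable_from_top.aemeasurable) hp hq hpq
  simpa only [lintegral_count] using this

variable {Q : ℕ} (T : HomTree Q)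

open scoped Classical in
/-- Vertices at distance at most `m` from `x`, of the same parity as `m`. -/
def parityBall (x : T.V) (m : ℕ) : Finset T.V :=
  (Finset.range (m / 2 + 1)).biUnion fun k => T.sph x (m - 2 * k)

lemma sum_parityBall (g : T.V → ℂ) (x : T.V) (m : ℕ) :
    ∑ y ∈ T.parityBall x m, g y = T.parityBallSum g x m := by
  classical
  rw [parityBallSum_eq, parityBall, Finset.sum_biUnion]
  · simp_rw [sphereSum_eq]
  · intro i hi j hj hij
    rw [Function.onFun, Finset.disjoint_left]
    intro y hy hy'
    rw [mem_sph] at hy hy'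
    simp only [Finset.coe_range, Set.mem_Iio] at hi hj
    omega

lemma enorm_parityBallSum_le (g : T.V → ℂ) (x : T.V) (m : ℕ) :
    ‖T.parityBallSum g x m‖ₑ ≤ ∑ y ∈ T.parityBall x m, ‖g y‖ₑ := by
  rw [← sum_parityBall]
  exact enorm_sum_le _ _

variable {T}

lemma enorm_inner_le_tsum (f g : T.L2) : ‖inner ℂ f g‖ₑ ≤ ∑' x, ‖f x‖ₑ * ‖g x‖ₑ := by
  rw [lp.inner_eq_tsum]
  refine enorm_tsum_le_tsum_enorm.trans_eq (tsum_congr fun x => ?_)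
  simp [enorm_mul, mul_comm]

lemma tsum_mul_parityBall_le (hQ : 1 ≤ Q) {a b : T.V → ℂ}
    (hb : T.powSum 2 b ≠ ∞) (m : ℕ) :
    ∑' x, ∑ y ∈ T.parityBall x m, ‖a x‖ₑ * ‖b y‖ₑ ≤
      ENNReal.ofReal (√Q ^ m * (m + 1)) * (T.powSum 2 a ^ (1 / 2 : ℝ) *
        T.powSum 2 b ^ (1 / 2 : ℝ)) := by
  have hb' : T.powSum 2 (fun x => (‖b x‖ : ℂ)) = T.powSum 2 b :=
    tsum_congr fun x => by rw [enorm_eq_iff_norm_eq.2 (norm_real _), enorm_norm]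
  let β : T.L2 := ⟨fun x => (‖b x‖ : ℂ), memℓp_two_of_powSum (by rwa [hb'])⟩
  let W : T.L2 := (((√Q : ℝ) : ℂ) ^ m) • chebOp (T.normAdj hQ) m β
  have hW : ∀ x, ‖W x‖ₑ = ∑ y ∈ T.parityBall x m, ‖b y‖ₑ := fun x => by
    have h : W x = ∑ y ∈ T.parityBall x m, ((‖b y‖ : ℝ) : ℂ) := by
      rw [sum_parityBall]
      exact T.pow_mul_chebOp_apply hQ β x m
    rw [h, ← ofReal_sum, enorm_eq_iff_norm_eq.2 (norm_real _),
      Real.enorm_of_nonneg (by positivity), ENNReal.ofReal_sum_of_nonneg fun _ _ => norm_nonneg _]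
    simp
  have hWn : ‖W‖ₑ ≤ ENNReal.ofReal (√Q ^ m * (m + 1)) * ‖β‖ₑ := by
    rw [← ofReal_norm, ← ofReal_norm, ← ENNReal.ofReal_mul (by positivity)]
    apply ENNReal.ofReal_le_ofReal
    rw [norm_smul, norm_pow, norm_real, Real.norm_of_nonneg (by positivity), mul_assoc]
    gcongr
    exact norm_chebOp_apply_le (T.inner_normAdj hQ) (T.norm_normAdj_le hQ) β m
  have hroot : ∀ f : T.L2, T.powSum 2 f ^ (1 / 2 : ℝ) = ‖f‖ₑ := fun f => by
    rw [← enorm_rpow_two, ← ENNReal.rpow_mul]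
    norm_num
  calc _ = ∑' x, (‖a x‖ₑ ^ (2 : ℝ)) ^ (1 / 2 : ℝ) * (‖W x‖ₑ ^ (2 : ℝ)) ^ (1 / 2 : ℝ) := by
        refine tsum_congr fun x => ?_
        rw [← ENNReal.rpow_mul, ← ENNReal.rpow_mul, hW, ← Finset.mul_sum]
        norm_num
    _ ≤ T.powSum 2 a ^ (1 / 2 : ℝ) * T.powSum 2 W ^ (1 / 2 : ℝ) :=
        tsum_rpow_mul_rpow_le _ _ (by norm_num) (by norm_num) (by norm_num)
    _ ≤ T.powSum 2 a ^ (1 / 2 : ℝ) * (ENNReal.ofReal (√Q ^ m * (m + 1)) * ‖β‖ₑ) := by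
        rw [hroot W]
        gcongr
    _ = _ := by
        rw [← hroot β, show T.powSum 2 β = T.powSum 2 b from hb']
        ring

lemma tsum_mul_parityBall_le_rpow (hQ : 1 ≤ Q) {q r : ℝ} (hqr : q.HolderConjugate r) (hq : 2 ≤ q)
    {a b : T.V → ℂ} (hb : T.powSum r b ≠ ∞) (m : ℕ) :
    ∑' x, ∑ y ∈ T.parityBall x m, ‖a x‖ₑ * ‖b y‖ₑ ≤
      ENNReal.ofReal (√Q ^ m * (m + 1)) ^ (2 / q) * (T.powSum r a ^ (1 / r) *
        T.powSum r b ^ (1 / r)) := by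
  have hq0 : 0 < q := by linarith
  have hr0 : 0 < r := hqr.symm.pos
  have hrq : r * q = r + q := hqr.symm.mul_eq_add
  have hθ : 2 / q ≤ 1 := (div_le_one hq0).2 hq
  have hsplit : ∀ z : ℂ, ‖z‖ₑ = (‖z‖ₑ ^ r) ^ (1 - 2 / q) * (‖z‖ₑ ^ (r / 2)) ^ (2 / q) := fun z => by
    rw [← ENNReal.rpow_mul, ← ENNReal.rpow_mul, ← ENNReal.rpow_add_of_nonneg _ _
      (mul_nonneg hr0.le (by linarith)) (by positivity)]
    have : r * (1 - 2 / q) + r / 2 * (2 / q) = 1 := by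
      field_simp
      linarith
    rw [this, ENNReal.rpow_one]
  have hpow : ∀ a : T.V → ℂ, T.powSum 2 (fun x => ((‖a x‖ ^ (r / 2) : ℝ) : ℂ)) = T.powSum r a :=
    fun a => tsum_congr fun x => by
      rw [enorm_eq_iff_norm_eq.2 (norm_real _), Real.enorm_rpow_of_nonneg (norm_nonneg _)
        (by positivity), enorm_norm, ← ENNReal.rpow_mul]
      congr 1
      ring
  have hen : ∀ z : ℂ, ‖((‖z‖ ^ (r / 2) : ℝ) : ℂ)‖ₑ = ‖z‖ₑ ^ (r / 2) := fun z => by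
    rw [enorm_eq_iff_norm_eq.2 (norm_real _), Real.enorm_rpow_of_nonneg (norm_nonneg _)
        (by positivity), enorm_norm]
  set A := T.powSum r a
  set B := T.powSum r b
  have h2 := tsum_mul_parityBall_le hQ (T := T) (a := fun x => ((‖a x‖ ^ (r / 2) : ℝ) : ℂ))
    (b := fun x => ((‖b x‖ ^ (r / 2) : ℝ) : ℂ)) (by rwa [hpow]) m
  rw [hpow, hpow] at h2
  simp only [hen] at h2
  have h1 : ∑' x, ∑ y ∈ T.parityBall x m, ‖a x‖ₑ ^ r * ‖b y‖ₑ ^ r ≤ A * B := by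
    rw [show A = ∑' x, ‖a x‖ₑ ^ r from rfl, ← ENNReal.tsum_mul_right]
    refine ENNReal.tsum_le_tsum fun x => ?_
    rw [← Finset.mul_sum]
    gcongr
    exact ENNReal.sum_le_tsum _
  have hσ : ∀ φ : T.V → T.V → ℝ≥0∞, ∑' x, ∑ y ∈ T.parityBall x m, φ x y =
      ∑' p : Σ x, T.parityBall x m, φ p.1 p.2 := fun φ => by
    rw [ENNReal.tsum_sigma']
    exact tsum_congr fun x => (Finset.tsum_subtype (T.parityBall x m) (φ x)).symm
  rw [hσ] at h1 h2 ⊢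
  calc _ = ∑' p : Σ x, T.parityBall x m, (‖a p.1‖ₑ ^ r * ‖b p.2‖ₑ ^ r) ^ (1 - 2 / q) *
          (‖a p.1‖ₑ ^ (r / 2) * ‖b p.2‖ₑ ^ (r / 2)) ^ (2 / q) := by
        refine tsum_congr fun p => ?_
        rw [ENNReal.mul_rpow_of_nonneg _ _ (by linarith),
          ENNReal.mul_rpow_of_nonneg _ _ (by positivity), mul_mul_mul_comm, ← hsplit, ← hsplit]
    _ ≤ _ := tsum_rpow_mul_rpow_le _ _ (by linarith) (by positivity) (by ring)
    _ ≤ (A * B) ^ (1 - 2 / q) * (ENNReal.ofReal (√Q ^ m * (m + 1)) *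
          (A ^ (1 / 2 : ℝ) * B ^ (1 / 2 : ℝ))) ^ (2 / q) := by
        refine mul_le_mul' (ENNReal.rpow_le_rpow h1 (by linarith)) (ENNReal.rpow_le_rpow h2 (by positivity))
    _ = _ := by
        rw [ENNReal.mul_rpow_of_nonneg _ _ (by positivity : 0 ≤ 2 / q),
          ← ENNReal.mul_rpow_of_nonneg A B (by positivity : (0 : ℝ) ≤ 1 / 2), ← ENNReal.rpow_mul,
          mul_left_comm, ← ENNReal.rpow_add_of_nonneg _ _ (by linarith) (by positivity),
          ← ENNReal.mul_rpow_of_nonneg A B (by positivity)]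
        congr 2
        field_simp
        linarith

lemma enorm_inner_chebOp_le (hQ : 1 ≤ Q) {q r : ℝ} (hqr : q.HolderConjugate r) (hq : 2 ≤ q)
    (f g : T.L2) (hg : T.powSum r g ≠ ∞) (m : ℕ) :
    ‖inner ℂ f (chebOp (T.normAdj hQ) m g)‖ₑ ≤
      ENNReal.ofReal ((√Q ^ (2 / q - 1)) ^ m * (m + 1)) * (T.powSum r f ^ (1 / r) *
        T.powSum r g ^ (1 / r)) := by
  have hs : (0 : ℝ) < √Q := by positivity
  have hq0 : 0 < q := by linarith
  have hV : ∀ x, ‖chebOp (T.normAdj hQ) m g x‖ₑ ≤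
      ENNReal.ofReal ((√Q ^ m)⁻¹) * ∑ y ∈ T.parityBall x m, ‖g y‖ₑ := fun x => by
    have h := T.pow_mul_chebOp_apply hQ g x m
    have h2 : chebOp (T.normAdj hQ) m g x = (((√Q ^ m)⁻¹ : ℝ) : ℂ) * T.parityBallSum g x m := by
      rw [← h, ← mul_assoc, ofReal_inv, ofReal_pow, inv_mul_cancel₀, one_mul]
      exact pow_ne_zero _ (by exact_mod_cast hs.ne')
    rw [h2, enorm_mul, enorm_eq_iff_norm_eq.2 (norm_real _), Real.enorm_of_nonneg (by positivity)]
    gcongr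
    exact T.enorm_parityBallSum_le _ _ _
  calc _ ≤ ∑' x, ‖f x‖ₑ * ‖chebOp (T.normAdj hQ) m g x‖ₑ := enorm_inner_le_tsum _ _
    _ ≤ ∑' x, ENNReal.ofReal ((√Q ^ m)⁻¹) * ∑ y ∈ T.parityBall x m, ‖f x‖ₑ * ‖g y‖ₑ := by
        refine ENNReal.tsum_le_tsum fun x => ?_
        rw [← Finset.mul_sum, mul_left_comm]
        gcongr
        exact hV x
    _ ≤ ENNReal.ofReal ((√Q ^ m)⁻¹) * (ENNReal.ofReal (√Q ^ m * (m + 1)) ^ (2 / q) *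
          (T.powSum r f ^ (1 / r) * T.powSum r g ^ (1 / r))) := by
        rw [ENNReal.tsum_mul_left]
        gcongr
        exact tsum_mul_parityBall_le_rpow hQ hqr hq hg m
    _ ≤ _ := by
        rw [← mul_assoc, ENNReal.ofReal_rpow_of_nonneg (by positivity) (by positivity),
          ← ENNReal.ofReal_mul (by positivity)]
        gcongr ENNReal.ofReal ?_ * _
        rw [Real.mul_rpow (by positivity) (by positivity), ← mul_assoc]
        have h1 : (√Q ^ m : ℝ)⁻¹ * (√Q ^ m : ℝ) ^ (2 / q) = (√Q ^ (2 / q - 1)) ^ m := by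
          rw [← Real.rpow_natCast, ← Real.rpow_natCast, ← Real.rpow_neg hs.le,
            ← Real.rpow_mul hs.le, ← Real.rpow_mul hs.le, ← Real.rpow_add hs]
          congr 1
          ring
        rw [h1]
        gcongr
        refine (Real.rpow_le_rpow_of_exponent_le (by linarith [(m.cast_nonneg : (0 : ℝ) ≤ m)])
          ((div_le_one hq0).2 hq)).trans_eq (Real.rpow_one _)

lemma gammaZero_pos (hQ : 1 ≤ Q) : 0 < gammaZero Q := by
  have : (0 : ℝ) < √Q := by positivity
  unfold gammaZero
  positivity

variable (T)

/-- The dispersive estimate for the Schrödinger group, in bilinear form. -/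
lemma exists_enorm_inner_schGroup_le (hQ : 2 ≤ Q) {q r : ℝ} (hqr : q.HolderConjugate r)
    (hq : 2 < q) :
    ∃ C : ℝ, 0 < C ∧ ∀ (t : ℝ) (f g : T.L2),
      ‖inner ℂ f (T.schGroup (one_le_two.trans hQ) t g)‖ₑ ≤
        ENNReal.ofReal (C / (1 + gammaZero Q * |t|)) * (T.powSum r f ^ (1 / r) *
          T.powSum r g ^ (1 / r)) := by
  have hQ1 : 1 ≤ Q := one_le_two.trans hQ
  have hq0 : 0 < q := by linarith
  have hr0 : 0 < r := hqr.symm.pos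
  have hs : (1 : ℝ) < √Q := Real.lt_sqrt_of_sq_lt (by norm_num; omega)
  have hγ := gammaZero_pos hQ1
  set ρ : ℝ := √Q ^ (2 / q - 1) with hρ
  have hρ0 : 0 < ρ := by positivity
  have hρ1 : ρ < 1 := Real.rpow_lt_one_of_one_lt_of_neg hs
    (by rw [sub_neg, div_lt_one hq0]; exact hq)
  have hsum : Summable fun m : ℕ => 4 * (m + 1) * (ρ ^ m * (m + 1)) := by
    have h := (summable_nat_add_iff 1).2 (summable_pow_mul_geometric_of_norm_lt_one 2
      (r := ρ) (by rwa [Real.norm_of_nonneg hρ0.le]))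
    refine (h.mul_left (4 / ρ)).congr fun m => ?_
    push_cast
    field_simp
    ring
  set S := ∑' m : ℕ, 4 * (m + 1) * (ρ ^ m * (m + 1))
  have hS : 0 ≤ S := tsum_nonneg fun m => by positivity
  refine ⟨S + 1, by positivity, fun t f g => ?_⟩
  have hzero : ∀ h : T.L2, T.powSum r h = 0 → h = 0 := fun h hh => by
    ext x
    have := ENNReal.tsum_eq_zero.1 hh x
    simpa [ENNReal.rpow_eq_zero_iff, hr0, hr0.not_gt] using this
  have htop : ∀ {a b : ℝ≥0∞}, a = ∞ → b ≠ 0 → a ^ (1 / r) * b ^ (1 / r) = ∞ := fun {a b} ha hb => by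
    rw [ha, ENNReal.top_rpow_of_pos (by positivity), ENNReal.top_mul]
    simp [ENNReal.rpow_eq_zero_iff, hb, hr0, hr0.not_gt]
  have hκ : ENNReal.ofReal ((S + 1) / (1 + gammaZero Q * |t|)) ≠ 0 := by
    rw [ENNReal.ofReal_ne_zero_iff]
    positivity
  by_cases hg : T.powSum r g = ∞
  · by_cases hf : T.powSum r f = 0
    · simp [hzero f hf]
    · rw [mul_comm (_ ^ _), htop hg hf, ENNReal.mul_top hκ]
      exact le_top
  set z : ℂ := -I * gammaZero Q * t with hz
  have hz0 : z.re = 0 := by simp [hz]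
  have hzn : ‖z‖ = gammaZero Q * |t| := by simp [hz, abs_of_pos hγ]
  have hsumU : HasSum (fun m => Complex.exp (I * t) * (besselCoeff z m *
      inner ℂ f (chebOp (T.normAdj hQ1) m g))) (inner ℂ f (T.schGroup hQ1 t g)) := by
    have h := hasSum_besselCoeff_chebOp (T.inner_normAdj hQ1) (T.norm_normAdj_le hQ1) z
    have h2 := h.mapL ((innerSL ℂ f).comp (ContinuousLinearMap.apply ℂ T.L2 g))
    have h3 := h2.mul_left (Complex.exp (I * t))
    have hv : inner ℂ f (T.schGroup hQ1 t g) = Complex.exp (I * t) *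
        inner ℂ f (NormedSpace.exp (z • T.normAdj hQ1) g) := inner_smul_right _ _ _
    rw [hv]
    refine h3.congr_fun fun m => ?_
    simp
  rw [← hsumU.tsum_eq]
  have he : ‖Complex.exp (I * t)‖ₑ = 1 := by
    rw [← ofReal_norm]
    simp [Complex.norm_exp]
  set N := T.powSum r f ^ (1 / r) * T.powSum r g ^ (1 / r)
  have hterm : ∀ m : ℕ, ‖Complex.exp (I * t) * (besselCoeff z m *
      inner ℂ f (chebOp (T.normAdj hQ1) m g))‖ₑ ≤
      ENNReal.ofReal (4 * (m + 1) * (ρ ^ m * (m + 1)) / (1 + gammaZero Q * |t|)) * N := fun m => by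
    rw [enorm_mul, he, one_mul, enorm_mul]
    calc _ ≤ ENNReal.ofReal (4 * (m + 1) / (1 + gammaZero Q * |t|)) *
          (ENNReal.ofReal (ρ ^ m * (m + 1)) * N) := by
          gcongr
          · rw [← ofReal_norm, ← hzn]
            exact ENNReal.ofReal_le_ofReal (norm_besselCoeff_le_div hz0 m)
          · exact enorm_inner_chebOp_le hQ1 hqr hq.le f g hg m
      _ = _ := by
          rw [← mul_assoc, ← ENNReal.ofReal_mul (by positivity)]
          congr 2
          ring
  calc _ ≤ ∑' m : ℕ, ENNReal.ofReal (4 * (m + 1) * (ρ ^ m * (m + 1)) /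
        (1 + gammaZero Q * |t|)) * N :=
        enorm_tsum_le_tsum_enorm.trans (ENNReal.tsum_le_tsum hterm)
    _ = ENNReal.ofReal (S / (1 + gammaZero Q * |t|)) * N := by
        rw [ENNReal.tsum_mul_right, ← ENNReal.ofReal_tsum_of_nonneg (fun m => by positivity)
          (hsum.div_const _), tsum_div_const]
    _ ≤ _ := by
        gcongr
        linarith

end HomTree

namespace HomTree

/-- A bilinear form of Young's convolution inequality. -/
lemma lintegral_lintegral_kernel_le {q r : ℝ} (hqr : q.HolderConjugate r) (hq : 2 < q)
    {κ w g : ℝ → ℝ≥0∞} (hκ : Measurable κ) (hw : AEMeasurable w) (hg : AEMeasurable g) :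
    ∫⁻ t, ∫⁻ s, κ (t - s) * (w t * g s) ≤
      (∫⁻ t, κ t ^ (q / 2)) ^ (2 / q) *
        ((∫⁻ t, w t ^ r) ^ (1 / r) * (∫⁻ t, g t ^ r) ^ (1 / r)) := by
  have hq0 : 0 < q := by linarith
  have hr0 : 0 < r := hqr.symm.pos
  have hrq : r * q = r + q := hqr.symm.mul_eq_add
  have hθ : 0 ≤ 1 - 2 / q := by rw [sub_nonneg, div_le_one hq0]; exact hq.le
  set K := ∫⁻ t, κ t ^ (q / 2)
  set A := ∫⁻ t, w t ^ r
  set B := ∫⁻ t, g t ^ r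
  have hw1 : AEMeasurable (fun p : ℝ × ℝ => w p.1) (volume.prod volume) := hw.comp_fst
  have hg1 : AEMeasurable (fun p : ℝ × ℝ => g p.2) (volume.prod volume) := hg.comp_snd
  have hκ1 : AEMeasurable (fun p : ℝ × ℝ => κ (p.1 - p.2)) (volume.prod volume) :=
    (hκ.comp (measurable_fst.sub measurable_snd)).aemeasurable
  let f : Fin 3 → ℝ × ℝ → ℝ≥0∞ := ![fun p => w p.1 ^ r * g p.2 ^ r,
    fun p => κ (p.1 - p.2) ^ (q / 2) * w p.1 ^ r, fun p => κ (p.1 - p.2) ^ (q / 2) * g p.2 ^ r]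
  let e : Fin 3 → ℝ := ![1 - 2 / q, 1 / q, 1 / q]
  have h := ENNReal.lintegral_prod_norm_pow_le (μ := (volume : Measure ℝ).prod volume)
    Finset.univ (f := f) (p := e)
    (by
      intro i _
      fin_cases i
      · exact (hw1.pow_const r).mul (hg1.pow_const r)
      · exact (hκ1.pow_const _).mul (hw1.pow_const r)
      · exact (hκ1.pow_const _).mul (hg1.pow_const r))
    (by
      simp only [e, Fin.sum_univ_three, Matrix.cons_val]
      ring)
    (by
      intro i _
      fin_cases i
      · exact hθ
      · change 0 ≤ 1 / q
        positivity
      · change 0 ≤ 1 / q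
        positivity)
  simp only [Fin.prod_univ_three, f, e, Matrix.cons_val] at h
  have h0 : ∫⁻ p : ℝ × ℝ, w p.1 ^ r * g p.2 ^ r ∂(volume.prod volume) = A * B := by
    exact lintegral_prod_mul (hw.pow_const r) (hg.pow_const r)
  have h1 : ∫⁻ p : ℝ × ℝ, κ (p.1 - p.2) ^ (q / 2) * w p.1 ^ r ∂(volume.prod volume) = K * A := by
    have hm : AEMeasurable (fun p : ℝ × ℝ => κ (p.1 - p.2) ^ (q / 2) * w p.1 ^ r)
      (volume.prod volume) := (hκ1.pow_const _).mul (hw1.pow_const r)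
    rw [lintegral_prod _ hm]
    simp only
    rw [← lintegral_const_mul'' K (hw.pow_const r)]
    refine lintegral_congr fun t => ?_
    rw [lintegral_mul_const'' _ (by fun_prop), lintegral_sub_left_eq_self (fun s => κ s ^ (q / 2)) t]
  have h2 : ∫⁻ p : ℝ × ℝ, κ (p.1 - p.2) ^ (q / 2) * g p.2 ^ r ∂(volume.prod volume) = K * B := by
    have hm : AEMeasurable (fun p : ℝ × ℝ => κ (p.1 - p.2) ^ (q / 2) * g p.2 ^ r)
      (volume.prod volume) := (hκ1.pow_const _).mul (hg1.pow_const r)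
    rw [lintegral_prod_symm _ hm]
    simp only
    rw [← lintegral_const_mul'' K (hg.pow_const r)]
    refine lintegral_congr fun t => ?_
    rw [lintegral_mul_const'' _ (by fun_prop), lintegral_sub_right_eq_self (fun s => κ s ^ (q / 2)) t]
  rw [h0, h1, h2] at h
  calc _ = ∫⁻ p : ℝ × ℝ, κ (p.1 - p.2) * (w p.1 * g p.2) ∂(volume.prod volume) := by
        have hm : AEMeasurable (fun p : ℝ × ℝ => κ (p.1 - p.2) * (w p.1 * g p.2))
          (volume.prod volume) := hκ1.mul (hw1.mul hg1)
        rw [lintegral_prod _ hm]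
    _ = _ := by
        refine lintegral_congr fun p => ?_
        have hs : ∀ z : ℝ≥0∞, z = (z ^ r) ^ (1 - 2 / q) * (z ^ r) ^ (1 / q) := fun z => by
          rw [← ENNReal.rpow_mul, ← ENNReal.rpow_mul,
            ← ENNReal.rpow_add_of_nonneg _ _ (by positivity) (by positivity)]
          have : r * (1 - 2 / q) + r * (1 / q) = 1 := by
            field_simp
            linarith
          rw [this, ENNReal.rpow_one]
        have hk : ∀ z : ℝ≥0∞, z = (z ^ (q / 2)) ^ (1 / q) * (z ^ (q / 2)) ^ (1 / q) := fun z => by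
          rw [← ENNReal.rpow_mul, ← ENNReal.rpow_add_of_nonneg _ _ (by positivity) (by positivity)]
          have : q / 2 * (1 / q) + q / 2 * (1 / q) = 1 := by
            field_simp
            norm_num
          rw [this, ENNReal.rpow_one]
        conv_lhs => rw [hs (w p.1), hs (g p.2), hk (κ (p.1 - p.2))]
        rw [ENNReal.mul_rpow_of_nonneg _ _ hθ,
          ENNReal.mul_rpow_of_nonneg _ _ (by positivity : 0 ≤ 1 / q),
          ENNReal.mul_rpow_of_nonneg _ _ (by positivity : 0 ≤ 1 / q)]
        ring
    _ ≤ _ := h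
    _ = _ := by
        rw [ENNReal.mul_rpow_of_nonneg _ _ hθ,
          ENNReal.mul_rpow_of_nonneg _ _ (by positivity : 0 ≤ 1 / q),
          ENNReal.mul_rpow_of_nonneg _ _ (by positivity : 0 ≤ 1 / q)]
        have hx : ∀ z : ℝ≥0∞, z ^ (1 - 2 / q) * z ^ (1 / q) = z ^ (1 / r) := fun z => by
          rw [← ENNReal.rpow_add_of_nonneg _ _ (by positivity) (by positivity)]
          congr 1
          field_simp
          linarith
        have hK : K ^ (1 / q) * K ^ (1 / q) = K ^ (2 / q) := by
          rw [← ENNReal.rpow_add_of_nonneg _ _ (by positivity) (by positivity)]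
          congr 1
          ring
        rw [← hx A, ← hx B, ← hK]
        ring

lemma lintegral_decay_ne_top {c C : ℝ} (hc : 0 < c) (hC : 0 < C) {a : ℝ} (ha : 1 < a) :
    ∫⁻ t : ℝ, ENNReal.ofReal (C / (1 + c * |t|)) ^ a ≠ ∞ := by
  have h := finite_integral_one_add_norm (E := ℝ) (μ := volume) (r := a) (by simpa using ha)
  set m := min 1 c with hm
  have hm0 : 0 < m := lt_min one_pos hc
  have hle : ∀ t : ℝ, ENNReal.ofReal (C / (1 + c * |t|)) ^ a ≤
      ENNReal.ofReal ((C / m) ^ a) * ENNReal.ofReal ((1 + ‖t‖) ^ (-a)) := fun t => by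
    rw [ENNReal.ofReal_rpow_of_nonneg (by positivity) (by linarith),
      ← ENNReal.ofReal_mul (by positivity)]
    apply ENNReal.ofReal_le_ofReal
    rw [Real.rpow_neg (by positivity), ← div_eq_mul_inv, ← Real.div_rpow (by positivity) (by positivity)]
    apply Real.rpow_le_rpow (by positivity) _ (by linarith)
    rw [div_div]
    apply div_le_div_of_nonneg_left hC.le (by positivity)
    rw [mul_add, Real.norm_eq_abs, mul_one]
    exact add_le_add (min_le_left _ _) (mul_le_mul_of_nonneg_right (min_le_right _ _) (abs_nonneg t))
  refine ne_top_of_le_ne_top ?_ (lintegral_mono hle)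
  rw [lintegral_const_mul' _ _ ENNReal.ofReal_ne_top]
  exact ENNReal.mul_ne_top ENNReal.ofReal_ne_top h.ne

variable {Q : ℕ} {T : HomTree Q}

lemma powSum_le_rpow {p : ℝ} (hp : 2 ≤ p) (f : T.L2) : T.powSum p f ≤ ‖f‖ₑ ^ p := by
  have h : ∀ x, ‖f x‖ₑ ^ p ≤ ‖f‖ₑ ^ (p - 2) * ‖f x‖ₑ ^ (2 : ℝ) := fun x => by
    have : ‖f x‖ₑ ≤ ‖f‖ₑ := by
      rw [← ofReal_norm, ← ofReal_norm]
      exact ENNReal.ofReal_le_ofReal (T.norm_evalL_apply_le x f)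
    calc _ = ‖f x‖ₑ ^ (p - 2) * ‖f x‖ₑ ^ (2 : ℝ) := by
          rw [← ENNReal.rpow_add_of_nonneg _ _ (by linarith) (by norm_num)]
          congr 1
          ring
      _ ≤ _ := by
        gcongr
  calc _ ≤ ∑' x, ‖f‖ₑ ^ (p - 2) * ‖f x‖ₑ ^ (2 : ℝ) := ENNReal.tsum_le_tsum h
    _ = ‖f‖ₑ ^ (p - 2) * ‖f‖ₑ ^ (2 : ℝ) := by
        rw [ENNReal.tsum_mul_left, enorm_rpow_two]
        rfl
    _ = _ := by
        rw [← ENNReal.rpow_add_of_nonneg _ _ (by linarith) (by norm_num)]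
        congr 1
        ring

lemma powSum_ne_top {p : ℝ} (hp : 2 ≤ p) (f : T.L2) : T.powSum p f ≠ ∞ :=
  ne_top_of_le_ne_top (ENNReal.rpow_ne_top_of_nonneg (by linarith) enorm_ne_top)
    (powSum_le_rpow hp f)

lemma enorm_norm_rpow_mul {q : ℝ} (hq : 2 ≤ q) (z : ℂ) :
    ‖((‖z‖ ^ (q - 2) : ℝ) : ℂ) * z‖ₑ = ‖z‖ₑ ^ (q - 1) := by
  rw [enorm_mul, enorm_eq_iff_norm_eq.2 (norm_real _), Real.enorm_rpow_of_nonneg (norm_nonneg _)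
    (by linarith), enorm_norm]
  nth_rw 2 [← ENNReal.rpow_one ‖z‖ₑ]
  rw [← ENNReal.rpow_add_of_nonneg _ _ (by linarith) (by norm_num)]
  congr 1
  ring

lemma powSum_norm_rpow_mul {q : ℝ} (hq : 2 ≤ q) (p : ℝ) (f : T.V → ℂ) :
    T.powSum p (fun x => ((‖f x‖ ^ (q - 2) : ℝ) : ℂ) * f x) = T.powSum ((q - 1) * p) f :=
  tsum_congr fun x => by rw [enorm_norm_rpow_mul hq, ← ENNReal.rpow_mul]

/-- The dual element `|f|^{q-2} f`. -/
def dualPow {q : ℝ} (hq : 2 ≤ q) (f : T.L2) : T.L2 :=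
  ⟨fun x => ((‖f x‖ ^ (q - 2) : ℝ) : ℂ) * f x, memℓp_two_of_powSum (by
    rw [powSum_norm_rpow_mul hq]
    exact powSum_ne_top (by linarith) f)⟩

lemma powSum_dualPow {q r : ℝ} (hqr : q.HolderConjugate r) (hq : 2 ≤ q) (f : T.L2) :
    T.powSum r (dualPow hq f) = T.powSum q f := by
  refine (powSum_norm_rpow_mul hq r f).trans ?_
  congr 1
  linarith [hqr.mul_eq_add]

lemma enorm_dualPow_le {q : ℝ} (hq : 2 ≤ q) (f : T.L2) : ‖dualPow hq f‖ₑ ≤ ‖f‖ₑ ^ (q - 1) := by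
  rw [← ENNReal.rpow_le_rpow_iff (z := 2) (by norm_num), enorm_rpow_two, ← ENNReal.rpow_mul]
  exact (powSum_norm_rpow_mul hq 2 f).trans_le (powSum_le_rpow (by linarith) f)

lemma inner_dualPow {q : ℝ} (hq : 2 ≤ q) (f : T.L2) :
    inner ℂ (dualPow hq f) f = ((T.powSum q f).toReal : ℂ) := by
  rw [lp.inner_eq_tsum, powSum, ENNReal.tsum_toReal_eq (fun x => by finiteness), ofReal_tsum]
  refine tsum_congr fun x => ?_
  have h : dualPow hq f x = ((‖f x‖ ^ (q - 2) : ℝ) : ℂ) * f x := rfl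
  rw [h, ← ENNReal.toReal_rpow, toReal_enorm, RCLike.inner_apply, map_mul, conj_ofReal, mul_left_comm,
    Complex.mul_conj', ← ofReal_pow, ← ofReal_mul]
  congr 1
  rw [← Real.rpow_natCast, ← Real.rpow_add_of_nonneg (norm_nonneg _) (by linarith) (by norm_num)]
  congr 1
  push_cast
  ring

variable {α : Type*} [MeasurableSpace α] {μ : Measure α}

lemma aestronglyMeasurable_of_apply {G : α → T.L2} (h : ∀ x, AEMeasurable (fun s => G s x) μ) :
    AEStronglyMeasurable G μ := by
  classical
  refine aestronglyMeasurable_of_tendsto_ae (atTop : Filter (Finset T.V))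
    (f := fun S s => ∑ x ∈ S, lp.single 2 x (G s x)) (fun S => ?_)
    (.of_forall fun s => lp.hasSum_single (p := 2) (by simp) (G s))
  refine Finset.aestronglyMeasurable_fun_sum S fun x _ => ?_
  have hc : Continuous fun c : ℂ => (lp.single 2 x c : T.L2) := by
    have : (fun c : ℂ => (lp.single 2 x c : T.L2)) = fun c => c • (lp.single 2 x 1 : T.L2) := by
      funext c
      rw [← lp.single_smul, smul_eq_mul, mul_one]
    rw [this]
    fun_prop
  exact hc.comp_aestronglyMeasurable (h x).aestronglyMeasurable

lemma aemeasurable_apply {G : α → T.L2} (h : AEStronglyMeasurable G μ) (x : T.V) :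
    AEMeasurable (fun s => G s x) μ :=
  ((evalL x).continuous.comp_aestronglyMeasurable h).aemeasurable

lemma aemeasurable_powSum {g : α → T.V → ℂ} (h : ∀ x, AEMeasurable (fun s => g s x) μ) (p : ℝ) :
    AEMeasurable (fun s => T.powSum p (g s)) μ :=
  AEMeasurable.tsum fun x => (h x).enorm.pow_const p

end HomTree

namespace HomTree

lemma rpow_one_div_le_of_le_mul {q r : ℝ} (hqr : q.HolderConjugate r) {a b : ℝ≥0∞} (ha : a ≠ ∞)
    (h : a ≤ a ^ (1 / r) * b) : a ^ (1 / q) ≤ b := by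
  have hq0 : 0 < q := hqr.pos
  have hr0 : 0 < r := hqr.symm.pos
  rcases eq_or_ne a 0 with rfl | ha0
  · rw [ENNReal.zero_rpow_of_pos (by positivity)]
    exact zero_le
  have hs : a = a ^ (1 / r) * a ^ (1 / q) := by
    rw [← ENNReal.rpow_add_of_nonneg _ _ (by positivity) (by positivity), one_div, one_div,
      add_comm, hqr.inv_add_inv_eq_one, ENNReal.rpow_one]
  nth_rw 1 [hs] at h
  refine (ENNReal.mul_le_mul_iff_right ?_ ?_).1 h
  · simp [ENNReal.rpow_eq_zero_iff, ha0, ha]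
  · exact ENNReal.rpow_ne_top_of_nonneg (by positivity) ha

lemma lintegral_le_of_forall_Icc {φ : ℝ → ℝ≥0∞} (hφ : AEMeasurable φ) {b : ℝ≥0∞} {a : ℝ}
    (h : ∀ n : ℕ, (∫⁻ t in Set.Icc (-n : ℝ) n, φ t) ^ a ≤ b) :
    (∫⁻ t, φ t) ^ a ≤ b := by
  have h1 : Tendsto (fun n : ℕ => (n : ℝ)) atTop atTop := tendsto_natCast_atTop_atTop
  have h2 := (aecover_Icc (μ := (volume : Measure ℝ)) (tendsto_neg_atTop_atBot.comp h1)
    h1).lintegral_tendsto_of_countably_generated hφ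
  exact le_of_tendsto' ((ENNReal.continuous_rpow_const.tendsto _).comp h2) h

section Measurability

variable {Q : ℕ} {T : HomTree Q} {α : Type*} [MeasurableSpace α] {μ : Measure α}

lemma aestronglyMeasurable_dualPow {q : ℝ} (hq : 2 ≤ q) {G : α → T.L2}
    (hG : AEStronglyMeasurable G μ) : AEStronglyMeasurable (fun t => dualPow hq (G t)) μ := by
  refine aestronglyMeasurable_of_apply fun x => ?_
  have h := aemeasurable_apply hG x
  have h1 : AEMeasurable (fun t => ‖G t x‖ ^ (q - 2)) μ := h.norm.pow_const _
  exact (Complex.measurable_ofReal.comp_aemeasurable h1).mul h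

lemma aemeasurable_powSum_L2 {G : α → T.L2} (hG : AEStronglyMeasurable G μ) (p : ℝ) :
    AEMeasurable (fun t => T.powSum p (G t)) μ :=
  aemeasurable_powSum (aemeasurable_apply hG) p

lemma powSum_zero {p : ℝ} (hp : 0 < p) : T.powSum p (0 : T.L2) = 0 := by
  simp [powSum, hp]

lemma lintegral_powSum_indicator {p : ℝ} (hp : 0 < p) (G : α → T.L2) {s : Set α}
    (hs : MeasurableSet s) :
    ∫⁻ t, T.powSum p (s.indicator G t : T.L2) ∂μ = ∫⁻ t in s, T.powSum p (G t) ∂μ := by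
  rw [← lintegral_indicator hs]
  refine lintegral_congr fun t => ?_
  by_cases ht : t ∈ s
  · simp [ht]
  · simp only [ht, not_false_eq_true, Set.indicator_of_notMem]
    exact powSum_zero hp

end Measurability

variable {Q : ℕ} (T : HomTree Q)

lemma continuous_schGroup (hQ : 1 ≤ Q) : Continuous (T.schGroup hQ) :=
  continuous_iff_continuousAt.2 fun t => (analyticAt_expGroup _ _ t).continuousAt

lemma schGroup_zero (hQ : 1 ≤ Q) : T.schGroup hQ 0 = 1 := expGroup_zero _ _

lemma schGroup_add_apply (hQ : 1 ≤ Q) (s t : ℝ) (f : T.L2) :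
    T.schGroup hQ (s + t) f = T.schGroup hQ s (T.schGroup hQ t f) := by
  rw [schGroup, expGroup_add]
  rfl

lemma norm_schGroup_apply (hQ : 1 ≤ Q) (t : ℝ) (f : T.L2) : ‖T.schGroup hQ t f‖ = ‖f‖ :=
  norm_expGroup_apply _ (T.inner_normAdj hQ) t f

lemma inner_schGroup (hQ : 1 ≤ Q) (t : ℝ) (f g : T.L2) :
    inner ℂ (T.schGroup hQ t f) g = inner ℂ f (T.schGroup hQ (-t) g) :=
  inner_expGroup _ (T.inner_normAdj hQ) t f g

variable {T}

lemma aestronglyMeasurable_schGroup_apply (hQ : 1 ≤ Q) {μ : Measure ℝ} {φ : ℝ → ℝ}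
    (hφ : Continuous φ) {G : ℝ → T.L2} (hG : AEStronglyMeasurable G μ) :
    AEStronglyMeasurable (fun s => T.schGroup hQ (φ s) (G s)) μ :=
  isBoundedBilinearMap_apply.continuous.comp_aestronglyMeasurable
    (((T.continuous_schGroup hQ).comp hφ).aestronglyMeasurable.prodMk hG)

lemma intervalIntegrable_schGroup_apply (hQ : 1 ≤ Q) {φ : ℝ → ℝ} (hφ : Continuous φ) {G : ℝ → T.L2}
    {a b : ℝ} (hG : IntervalIntegrable G volume a b) :
    IntervalIntegrable (fun s => T.schGroup hQ (φ s) (G s)) volume a b := by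
  rw [intervalIntegrable_iff] at hG ⊢
  refine Integrable.mono hG (aestronglyMeasurable_schGroup_apply hQ hφ hG.1) (.of_forall fun s => ?_)
  rw [norm_schGroup_apply]

variable (T) in
/-- The Duhamel integral, without the factor `-i`. -/
def duhamel (hQ : 1 ≤ Q) (G : ℝ → T.L2) (t : ℝ) : T.L2 :=
  T.schGroup hQ t (∫ s in (0 : ℝ)..t, T.schGroup hQ (-s) (G s))

lemma continuous_duhamel (hQ : 1 ≤ Q) {G : ℝ → T.L2}
    (hG : ∀ a b, IntervalIntegrable G volume a b) : Continuous (T.duhamel hQ G) :=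
  (T.continuous_schGroup hQ).clm_apply (intervalIntegral.continuous_primitive
    (fun a b => intervalIntegrable_schGroup_apply hQ continuous_neg (hG a b)) 0)

lemma enorm_inner_duhamel_le (hQ : 1 ≤ Q) {G : ℝ → T.L2}
    (hG : ∀ a b, IntervalIntegrable G volume a b) (w : T.L2) (t : ℝ) :
    ‖inner ℂ w (T.duhamel hQ G t)‖ₑ ≤ ∫⁻ s, ‖inner ℂ w (T.schGroup hQ (t - s) (G s))‖ₑ := by
  have h := intervalIntegrable_schGroup_apply hQ continuous_neg (hG 0 t)
  have h1 : inner ℂ w (T.duhamel hQ G t) =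
      ∫ s in (0 : ℝ)..t, inner ℂ w (T.schGroup hQ (t - s) (G s)) := by
    have h2 := ((innerSL ℂ w).comp (T.schGroup hQ t)).intervalIntegral_comp_comm h
    refine Eq.trans h2.symm (intervalIntegral.integral_congr fun s _ => ?_)
    simp only [ContinuousLinearMap.comp_apply, innerSL_apply_apply]
    rw [← schGroup_add_apply, sub_eq_add_neg]
  rw [h1, intervalIntegral.intervalIntegral_eq_integral_uIoc, enorm_smul]
  calc _ ≤ 1 * ∫⁻ s in Set.uIoc 0 t, ‖inner ℂ w (T.schGroup hQ (t - s) (G s))‖ₑ := by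
        gcongr
        · split_ifs <;> simp
        · exact enorm_integral_le_lintegral_enorm _
    _ ≤ _ := by
        rw [one_mul]
        exact setLIntegral_le_lintegral _ _

variable (T) in
lemma exists_lintegral_enorm_inner_schGroup_le (hQ : 2 ≤ Q) {q r : ℝ} (hqr : q.HolderConjugate r)
    (hq : 2 < q) : ∃ Y : ℝ≥0∞, Y ≠ ∞ ∧ ∀ W G : ℝ → T.L2, AEStronglyMeasurable W →
      AEStronglyMeasurable G →
      ∫⁻ t, ∫⁻ s, ‖inner ℂ (W t) (T.schGroup (one_le_two.trans hQ) (t - s) (G s))‖ₑ ≤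
        Y * ((∫⁻ t, T.powSum r (W t)) ^ (1 / r) * (∫⁻ t, T.powSum r (G t)) ^ (1 / r)) := by
  obtain ⟨C, hC, h⟩ := T.exists_enorm_inner_schGroup_le hQ hqr hq
  have hr0 : 0 < r := hqr.symm.pos
  set κ : ℝ → ℝ≥0∞ := fun t => ENNReal.ofReal (C / (1 + gammaZero Q * |t|))
  have hκ : Measurable κ := by fun_prop
  refine ⟨(∫⁻ t, κ t ^ (q / 2)) ^ (2 / q), ENNReal.rpow_ne_top_of_nonneg (by positivity)
    (lintegral_decay_ne_top (gammaZero_pos (one_le_two.trans hQ)) hC (by linarith)), ?_⟩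
  intro W G hW hG
  have hp : ∀ z : ℝ≥0∞, (z ^ (1 / r)) ^ r = z := fun z => by
    rw [← ENNReal.rpow_mul, one_div_mul_cancel hr0.ne', ENNReal.rpow_one]
  have h1 := lintegral_lintegral_kernel_le hqr hq hκ
    ((aemeasurable_powSum_L2 hW r).pow_const (1 / r))
    ((aemeasurable_powSum_L2 hG r).pow_const (1 / r))
  simp only [hp] at h1
  exact (lintegral_mono fun t => lintegral_mono fun s => h (t - s) (W t) (G s)).trans h1

lemma enorm_integral_schGroup_le (hQ : 2 ≤ Q) {r : ℝ} {Y : ℝ≥0∞} {G : ℝ → T.L2}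
    (h : ∫⁻ t, ∫⁻ s, ‖inner ℂ (G t) (T.schGroup (one_le_two.trans hQ) (t - s) (G s))‖ₑ ≤
        Y * ((∫⁻ t, T.powSum r (G t)) ^ (1 / r) * (∫⁻ t, T.powSum r (G t)) ^ (1 / r))) :
    ‖∫ s, T.schGroup (one_le_two.trans hQ) (-s) (G s)‖ₑ ≤
      Y ^ (1 / 2 : ℝ) * (∫⁻ t, T.powSum r (G t)) ^ (1 / r) := by
  set U := T.schGroup (one_le_two.trans hQ)
  set B := (∫⁻ t, T.powSum r (G t)) ^ (1 / r)
  by_cases hInt : Integrable (fun s => U (-s) (G s))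
  swap
  · rw [integral_undef hInt, enorm_zero]
    exact zero_le
  set V := ∫ s, U (-s) (G s) with hV
  have h1 : ∀ t, ‖inner ℂ V (U (-t) (G t))‖ₑ ≤ ∫⁻ s, ‖inner ℂ (G t) (U (t - s) (G s))‖ₑ := by
    intro t
    have : inner ℂ (U (-t) (G t)) V = ∫ s, inner ℂ (G t) (U (t - s) (G s)) := by
      rw [hV, ← integral_inner hInt]
      refine integral_congr_ae (.of_forall fun s => ?_)
      simp only
      rw [inner_schGroup, neg_neg, ← schGroup_add_apply, sub_eq_add_neg]
    rw [← inner_conj_symm, RCLike.enorm_conj, this]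
    exact enorm_integral_le_lintegral_enorm _
  have h2 : ‖V‖ₑ ^ (2 : ℝ) ≤ Y * (B * B) := by
    calc ‖V‖ₑ ^ (2 : ℝ) = ‖inner ℂ V V‖ₑ := by
          have : ‖(inner ℂ V V : ℂ)‖ = ‖V‖ ^ 2 := by
            rw [inner_self_eq_norm_sq_to_K, norm_pow, RCLike.norm_ofReal, abs_norm]
          rw [← ofReal_norm (inner ℂ V V), this, ENNReal.ofReal_pow (norm_nonneg _), ofReal_norm,
            ENNReal.rpow_two]
      _ = ‖∫ t, inner ℂ V (U (-t) (G t))‖ₑ := by rw [integral_inner hInt]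
      _ ≤ ∫⁻ t, ‖inner ℂ V (U (-t) (G t))‖ₑ := enorm_integral_le_lintegral_enorm _
      _ ≤ _ := lintegral_mono h1
      _ ≤ _ := h
  calc ‖V‖ₑ = (‖V‖ₑ ^ (2 : ℝ)) ^ (1 / 2 : ℝ) := by
        rw [← ENNReal.rpow_mul]
        norm_num
    _ ≤ (Y * (B * B)) ^ (1 / 2 : ℝ) := by gcongr
    _ = _ := by
        rw [ENNReal.mul_rpow_of_nonneg _ _ (by norm_num), ← sq, ← ENNReal.rpow_natCast,
          ← ENNReal.rpow_mul]
        norm_num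

lemma setLIntegral_powSum_ne_top {q : ℝ} (hq : 2 ≤ q) {D : ℝ → T.L2} (hD : Continuous D) (n : ℝ) :
    ∫⁻ t in Set.Icc (-n) n, T.powSum q (D t) ≠ ∞ := by
  obtain ⟨M, hM⟩ := isCompact_Icc.exists_bound_of_continuousOn (hD.continuousOn (s := Set.Icc (-n) n))
  refine ne_top_of_le_ne_top ?_ (setLIntegral_mono (g := fun _ => ENNReal.ofReal M ^ q)
    measurable_const fun t ht => (powSum_le_rpow hq (D t)).trans ?_)
  · rw [setLIntegral_const]
    exact ENNReal.mul_ne_top (ENNReal.rpow_ne_top_of_nonneg (by linarith) ENNReal.ofReal_ne_top)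
      measure_Icc_lt_top.ne
  · rw [← ofReal_norm]
    have := hM t ht
    gcongr

/-- Duality: `L^q_t ℓ^q` bounds follow from pairing with truncations of the dual element. -/
lemma lintegral_powSum_rpow_le_of_dual {q r : ℝ} (hqr : q.HolderConjugate r) (hq : 2 ≤ q)
    {D : ℝ → T.L2} (hD : Continuous D) {b : ℝ≥0∞}
    (h : ∀ W : ℝ → T.L2, Integrable W → (∫⁻ t, T.powSum r (W t)) ≠ ∞ →
      (∀ t, inner ℂ (W t) (D t) = ((‖inner ℂ (W t) (D t)‖ : ℝ) : ℂ)) →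
      ∫⁻ t, ‖inner ℂ (W t) (D t)‖ₑ ≤ (∫⁻ t, T.powSum r (W t)) ^ (1 / r) * b) :
    (∫⁻ t, T.powSum q (D t)) ^ (1 / q) ≤ b := by
  have hq0 : 0 < q := hqr.pos
  have hr0 : 0 < r := hqr.symm.pos
  refine lintegral_le_of_forall_Icc (aemeasurable_powSum_L2 hD.aestronglyMeasurable q)
    fun n => ?_
  refine rpow_one_div_le_of_le_mul hqr (setLIntegral_powSum_ne_top hq hD n) ?_
  set I := Set.Icc (-n : ℝ) n
  set W : ℝ → T.L2 := I.indicator fun t => dualPow hq (D t) with hW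
  have hI : MeasurableSet I := measurableSet_Icc
  have hWN : ∫⁻ t, T.powSum r (W t) = ∫⁻ t in I, T.powSum q (D t) := by
    rw [hW, lintegral_powSum_indicator hr0 _ hI]
    simp only [powSum_dualPow hqr hq]
  have hWD : ∀ t, inner ℂ (W t) (D t) = ((I.indicator (fun t => T.powSum q (D t)) t).toReal : ℂ) := by
    intro t
    by_cases ht : t ∈ I
    · simp only [hW, Set.indicator_of_mem ht, inner_dualPow]
    · simp [hW, ht]
  have hWm : AEStronglyMeasurable W :=
    (aestronglyMeasurable_dualPow hq hD.aestronglyMeasurable).indicator hI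
  have hWi : Integrable W := by
    obtain ⟨M, hM⟩ := isCompact_Icc.exists_bound_of_continuousOn (hD.continuousOn (s := I))
    refine ⟨hWm, ?_⟩
    refine lt_of_le_of_lt (lintegral_mono (g := I.indicator fun _ => ENNReal.ofReal M ^ (q - 1))
      fun t => ?_) ?_
    · by_cases ht : t ∈ I
      · simp only [hW, Set.indicator_of_mem ht]
        refine (enorm_dualPow_le hq _).trans ?_
        rw [← ofReal_norm]
        have := hM t ht
        gcongr
        linarith
      · simp [hW, ht]
    · rw [lintegral_indicator hI, setLIntegral_const]
      exact ENNReal.mul_lt_top (ENNReal.rpow_lt_top_of_nonneg (by linarith) ENNReal.ofReal_ne_top)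
        measure_Icc_lt_top
  have h1 := h W hWi (by rw [hWN]; exact setLIntegral_powSum_ne_top hq hD n) fun t => by
    rw [hWD, norm_real, Real.norm_of_nonneg ENNReal.toReal_nonneg]
  rw [hWN] at h1
  refine le_trans (le_of_eq ?_) h1
  rw [← lintegral_indicator hI]
  refine lintegral_congr fun t => ?_
  have hfin : I.indicator (fun t => T.powSum q (D t)) t ≠ ∞ := by
    by_cases ht : t ∈ I
    · simpa [ht] using powSum_ne_top hq (D t)
    · simp [ht]
  rw [hWD, ← ofReal_norm, norm_real, Real.norm_of_nonneg ENNReal.toReal_nonneg,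
    ENNReal.ofReal_toReal hfin]

variable (T) in
/-- Strichartz estimates in `L^q_t ℓ^q`, homogeneous and inhomogeneous. -/
theorem exists_strichartz (hQ : 2 ≤ Q) {q r : ℝ} (hqr : q.HolderConjugate r) (hq : 2 < q) :
    ∃ Y : ℝ≥0∞, Y ≠ ∞ ∧
      (∀ f : T.L2, (∫⁻ t, T.powSum q (T.schGroup (one_le_two.trans hQ) t f)) ^ (1 / q) ≤
        Y * ‖f‖ₑ) ∧
      ∀ G : ℝ → T.L2, AEStronglyMeasurable G → (∀ a b, IntervalIntegrable G volume a b) →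
        (∀ t, ‖T.duhamel (one_le_two.trans hQ) G t‖ₑ ≤
          Y * (∫⁻ t, T.powSum r (G t)) ^ (1 / r)) ∧
        (∫⁻ t, T.powSum q (T.duhamel (one_le_two.trans hQ) G t)) ^ (1 / q) ≤
          Y * (∫⁻ t, T.powSum r (G t)) ^ (1 / r) := by
  obtain ⟨Y, hY, h⟩ := T.exists_lintegral_enorm_inner_schGroup_le hQ hqr hq
  have hr0 : 0 < r := hqr.symm.pos
  set U := T.schGroup (one_le_two.trans hQ) with hU
  refine ⟨max Y (Y ^ (1 / 2 : ℝ)), ?_, ?_, ?_⟩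
  · exact (max_lt hY.lt_top (ENNReal.rpow_lt_top_of_nonneg (by norm_num) hY)).ne
  · intro f
    refine lintegral_powSum_rpow_le_of_dual hqr hq.le
      ((T.continuous_schGroup _).clm_apply continuous_const) fun W hWi _ hpos => ?_
    have hi : Integrable fun t => U (-t) (W t) :=
      hWi.mono (aestronglyMeasurable_schGroup_apply _ continuous_neg hWi.1)
        (.of_forall fun t => by rw [norm_schGroup_apply])
    have heq : ∀ t, inner ℂ (W t) (U t f) = inner ℂ (U (-t) (W t)) f := fun t => by
      rw [inner_schGroup, neg_neg]
    have hii : Integrable fun t => inner ℂ (W t) (U t f) := by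
      simp only [heq]
      exact hi.inner_const f
    have h1 : ∫⁻ t, ‖inner ℂ (W t) (U t f)‖ₑ = ‖∫ t, inner ℂ (W t) (U t f)‖ₑ := by
      have : ∫ t, inner ℂ (W t) (U t f) = ((∫ t, ‖inner ℂ (W t) (U t f)‖ : ℝ) : ℂ) := by
        rw [← integral_complex_ofReal]
        exact integral_congr_ae (.of_forall hpos)
      rw [this, ← ofReal_norm (((∫ t, ‖inner ℂ (W t) (U t f)‖ : ℝ) : ℂ)), norm_real,
        Real.norm_of_nonneg (integral_nonneg fun _ => norm_nonneg _),
        ofReal_integral_norm_eq_lintegral_enorm hii]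
    have h2 : ∫ t, inner ℂ (W t) (U t f) = inner ℂ (∫ t, U (-t) (W t)) f := by
      simp only [heq]
      rw [← inner_conj_symm, ← integral_inner hi, ← integral_conj]
      simp only [inner_conj_symm]
    rw [h1, h2]
    calc _ ≤ ‖∫ t, U (-t) (W t)‖ₑ * ‖f‖ₑ := by
          rw [← ofReal_norm, ← ofReal_norm, ← ofReal_norm, ← ENNReal.ofReal_mul (norm_nonneg _)]
          exact ENNReal.ofReal_le_ofReal (norm_inner_le_norm _ _)
      _ ≤ (Y ^ (1 / 2 : ℝ) * (∫⁻ t, T.powSum r (W t)) ^ (1 / r)) * ‖f‖ₑ := by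
          gcongr
          exact enorm_integral_schGroup_le hQ (h W W hWi.1 hWi.1)
      _ ≤ (max Y (Y ^ (1 / 2 : ℝ)) * (∫⁻ t, T.powSum r (W t)) ^ (1 / r)) * ‖f‖ₑ := by
          gcongr
          exact le_max_right _ _
      _ = _ := by ring
  · intro G hGm hG
    refine ⟨fun t => ?_, ?_⟩
    · rw [duhamel, ← ofReal_norm, norm_schGroup_apply, ofReal_norm,
        intervalIntegral.intervalIntegral_eq_integral_uIoc, enorm_smul,
        ← integral_indicator measurableSet_uIoc]
      set G' := (Set.uIoc 0 t).indicator G with hG'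
      have hi : (Set.uIoc 0 t).indicator (fun s => U (-s) (G s)) = fun s => U (-s) (G' s) := by
        funext s
        by_cases hs : s ∈ Set.uIoc 0 t
        · simp [hG', hs]
        · simp [hG', hs]
      rw [hi]
      have hG'm : AEStronglyMeasurable G' := hGm.indicator measurableSet_uIoc
      calc _ ≤ 1 * (Y ^ (1 / 2 : ℝ) * (∫⁻ t, T.powSum r (G' t)) ^ (1 / r)) := by
            gcongr
            · split_ifs <;> simp
            · exact enorm_integral_schGroup_le hQ (h G' G' hG'm hG'm)
        _ ≤ _ := by
            rw [one_mul, hG', lintegral_powSum_indicator hr0 _ measurableSet_uIoc]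
            gcongr
            · exact le_max_right _ _
            · exact Measure.restrict_le_self
    · refine lintegral_powSum_rpow_le_of_dual hqr hq.le (continuous_duhamel _ hG)
        fun W hWi _ _ => ?_
      calc _ ≤ ∫⁻ t, ∫⁻ s, ‖inner ℂ (W t) (U (t - s) (G s))‖ₑ :=
            lintegral_mono fun t => enorm_inner_duhamel_le _ hG (W t) t
        _ ≤ _ := h W G hWi.1 hGm
        _ ≤ max Y (Y ^ (1 / 2 : ℝ)) *
            ((∫⁻ t, T.powSum r (W t)) ^ (1 / r) * (∫⁻ t, T.powSum r (G t)) ^ (1 / r)) := by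
            gcongr
            exact le_max_left _ _
        _ = _ := by ring

end HomTree

lemma PowerLike.map_zero {F : ℂ → ℂ} {γ : ℝ} (hγ : 1 < γ) (hF : PowerLike F γ) : F 0 = 0 := by
  obtain ⟨C, -, h, -⟩ := hF
  have := h 0
  rw [norm_zero, Real.zero_rpow (by linarith), mul_zero] at this
  exact norm_le_zero_iff.1 this

namespace HomTree

variable {Q : ℕ} {T : HomTree Q}

lemma norm_le_mul_norm_of_forall_le {f g : T.L2} {c : ℝ} (hc : 0 ≤ c) (h : ∀ x, ‖f x‖ ≤ c * ‖g x‖) :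
    ‖f‖ ≤ c * ‖g‖ := by
  have h1 : T.powSum 2 f ≤ ENNReal.ofReal c ^ (2 : ℝ) * T.powSum 2 g := by
    rw [powSum, powSum, ← ENNReal.tsum_mul_left]
    refine ENNReal.tsum_le_tsum fun x => ?_
    rw [← ENNReal.mul_rpow_of_nonneg _ _ (by norm_num), ← ofReal_norm, ← ofReal_norm,
      ← ENNReal.ofReal_mul hc]
    exact ENNReal.rpow_le_rpow (ENNReal.ofReal_le_ofReal (h x)) (by norm_num)
  rw [← enorm_rpow_two, ← enorm_rpow_two, ← ENNReal.mul_rpow_of_nonneg _ _ (by norm_num),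
    ENNReal.rpow_le_rpow_iff (by norm_num), ← ofReal_norm, ← ofReal_norm, ← ENNReal.ofReal_mul hc,
    ENNReal.ofReal_le_ofReal_iff (by positivity)] at h1
  exact h1

lemma memℓp_powerLike {F : ℂ → ℂ} {γ : ℝ} (hγ : 1 < γ) (hF : PowerLike F γ) (f : T.L2) :
    Memℓp (fun x => F (f x)) 2 := by
  obtain ⟨C, hC, h, -⟩ := hF
  refine memℓp_two_of_powSum (ne_top_of_le_ne_top (b := ENNReal.ofReal C ^ (2 : ℝ) *
    T.powSum (γ * 2) f) ?_ ?_)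
  · exact ENNReal.mul_ne_top (by finiteness) (powSum_ne_top (by linarith) f)
  · rw [powSum, powSum, ← ENNReal.tsum_mul_left]
    refine ENNReal.tsum_le_tsum fun x => ?_
    rw [ENNReal.rpow_mul, ← ENNReal.mul_rpow_of_nonneg _ _ (by norm_num), ← ofReal_norm (F _),
      ← ofReal_norm (f x), ENNReal.ofReal_rpow_of_nonneg (norm_nonneg (f x)) (by linarith),
      ← ENNReal.ofReal_mul hC.le]
    exact ENNReal.rpow_le_rpow (ENNReal.ofReal_le_ofReal (h _)) (by norm_num)

/-- Composition with a power-like nonlinearity, as a map of `ℓ²`. -/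
def nonlin {F : ℂ → ℂ} {γ : ℝ} (hγ : 1 < γ) (hF : PowerLike F γ) (f : T.L2) : T.L2 :=
  ⟨fun x => F (f x), memℓp_powerLike hγ hF f⟩

section Nonlin

variable {F : ℂ → ℂ} {γ : ℝ} (hγ : 1 < γ) (hF : PowerLike F γ)

@[simp] lemma nonlin_apply (f : T.L2) (x : T.V) : nonlin hγ hF f x = F (f x) := rfl

lemma nonlin_zero : nonlin hγ hF (0 : T.L2) = 0 := by
  ext x
  exact hF.map_zero hγ

lemma exists_norm_nonlin_sub_le : ∃ C : ℝ, 0 < C ∧ ∀ f g : T.L2,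
    ‖nonlin hγ hF f - nonlin hγ hF g‖ ≤ C * (‖f‖ ^ (γ - 1) + ‖g‖ ^ (γ - 1)) * ‖f - g‖ := by
  obtain ⟨C, hC, -, h⟩ := hF
  refine ⟨C, hC, fun f g => norm_le_mul_norm_of_forall_le (by positivity) fun x => ?_⟩
  refine (h (f x) (g x)).trans ?_
  have h1 := T.norm_evalL_apply_le x f
  have h2 := T.norm_evalL_apply_le x g
  have h3 : 0 ≤ γ - 1 := by linarith
  have h4 : ‖f x - g x‖ = ‖(f - g) x‖ := rfl
  rw [h4]
  gcongr

lemma continuous_nonlin : Continuous (nonlin (T := T) hγ hF) := by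
  obtain ⟨C, hC, h⟩ := exists_norm_nonlin_sub_le (T := T) hγ hF
  refine continuous_iff_continuousAt.2 fun g => ?_
  rw [ContinuousAt, tendsto_iff_norm_sub_tendsto_zero]
  have h3 : 0 ≤ γ - 1 := by linarith
  have hc : Continuous fun f : T.L2 => C * (‖f‖ ^ (γ - 1) + ‖g‖ ^ (γ - 1)) * ‖f - g‖ :=
    (continuous_const.mul ((continuous_norm.rpow_const fun _ => .inr h3).add
      continuous_const)).mul (continuous_id.sub continuous_const).norm
  refine squeeze_zero (fun _ => norm_nonneg _) (fun f => h f g) ?_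
  simpa using hc.tendsto g

lemma exists_norm_nonlin_le (M : ℝ) : ∃ B : ℝ, ∀ f : T.L2, ‖f‖ ≤ M → ‖nonlin hγ hF f‖ ≤ B := by
  obtain ⟨C, hC, h⟩ := exists_norm_nonlin_sub_le (T := T) hγ hF
  have h3 : 0 < γ - 1 := by linarith
  refine ⟨C * (M ^ (γ - 1)) * M, fun f hf => ?_⟩
  have := h f 0
  rw [nonlin_zero, sub_zero, sub_zero, norm_zero, Real.zero_rpow h3.ne', add_zero] at this
  have hM : 0 ≤ M := (norm_nonneg f).trans hf
  refine this.trans ?_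
  gcongr

lemma intervalIntegrable_nonlin {u : ℝ → T.L2} {μ : Measure ℝ} [IsLocallyFiniteMeasure μ]
    (hu : AEStronglyMeasurable u μ)
    {M : ℝ} (hM : ∀ t, ‖u t‖ ≤ M) (a b : ℝ) :
    IntervalIntegrable (fun t => nonlin hγ hF (u t)) μ a b := by
  obtain ⟨B, hB⟩ := exists_norm_nonlin_le (T := T) hγ hF M
  refine (intervalIntegrable_const (c := B)).mono_fun
    ((continuous_nonlin hγ hF).comp_aestronglyMeasurable hu).restrict (.of_forall fun t => ?_)
  exact (hB _ (hM t)).trans (le_abs_self B)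

variable (T) in
/-- Hölder's inequality for differences of the nonlinearity. -/
lemma exists_lintegral_powSum_nonlin_sub_le : ∃ C : ℝ≥0∞, C ≠ ∞ ∧
    ∀ u v : ℝ → T.L2, AEStronglyMeasurable u → AEStronglyMeasurable v →
      (∫⁻ t, T.powSum ((γ + 1) / γ) (nonlin hγ hF (u t) - nonlin hγ hF (v t) : T.L2)) ^
          (1 / ((γ + 1) / γ)) ≤
        C * ((∫⁻ t, T.powSum (γ + 1) (u t)) + ∫⁻ t, T.powSum (γ + 1) (v t)) ^ ((γ - 1) / (γ + 1)) *
          (∫⁻ t, T.powSum (γ + 1) (u t - v t : T.L2)) ^ (1 / (γ + 1)) := by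
  have hF' := hF
  obtain ⟨C, hC, -, h⟩ := hF'
  have hγ0 : 0 < γ := by linarith
  have h1 : 0 < γ - 1 := by linarith
  set r := (γ + 1) / γ with hr
  have hr0 : 0 < r := by positivity
  have hθ : (γ - 1) / γ + 1 / γ = 1 := by field_simp; ring
  refine ⟨ENNReal.ofReal (2 * C), ENNReal.ofReal_ne_top, fun u v hu hv => ?_⟩
  have hpt : ∀ a b : ℂ, ‖F a - F b‖ₑ ^ r ≤ ENNReal.ofReal (2 * C) ^ r *
      ((‖a‖ₑ ^ (γ + 1) + ‖b‖ₑ ^ (γ + 1)) ^ ((γ - 1) / γ) * (‖a - b‖ₑ ^ (γ + 1)) ^ (1 / γ)) := by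
    intro a b
    have h2 : ‖F a - F b‖ₑ ≤ ENNReal.ofReal (2 * C) * max ‖a‖ₑ ‖b‖ₑ ^ (γ - 1) * ‖a - b‖ₑ := by
      have h3 : max ‖a‖ₑ ‖b‖ₑ = ENNReal.ofReal (max ‖a‖ ‖b‖) := by
        rw [ENNReal.ofReal_max, ofReal_norm, ofReal_norm]
      rw [h3, ← ofReal_norm, ← ofReal_norm,
        ENNReal.ofReal_rpow_of_nonneg (by positivity) h1.le, ← ENNReal.ofReal_mul (by positivity),
        ← ENNReal.ofReal_mul (by positivity)]
      apply ENNReal.ofReal_le_ofReal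
      refine (h a b).trans ?_
      gcongr ?_ * _
      have h4 : ‖a‖ ^ (γ - 1) ≤ max ‖a‖ ‖b‖ ^ (γ - 1) := by
        gcongr
        exact le_max_left _ _
      have h5 : ‖b‖ ^ (γ - 1) ≤ max ‖a‖ ‖b‖ ^ (γ - 1) := by
        gcongr
        exact le_max_right _ _
      nlinarith
    calc _ ≤ (ENNReal.ofReal (2 * C) * max ‖a‖ₑ ‖b‖ₑ ^ (γ - 1) * ‖a - b‖ₑ) ^ r := by gcongr
      _ = ENNReal.ofReal (2 * C) ^ r * ((max ‖a‖ₑ ‖b‖ₑ ^ (γ + 1)) ^ ((γ - 1) / γ) *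
          (‖a - b‖ₑ ^ (γ + 1)) ^ (1 / γ)) := by
          rw [ENNReal.mul_rpow_of_nonneg _ _ hr0.le, ENNReal.mul_rpow_of_nonneg _ _ hr0.le,
            ← ENNReal.rpow_mul, ← ENNReal.rpow_mul, ← ENNReal.rpow_mul, mul_assoc]
          congr 3
          · rw [hr]
            ring
          · rw [hr]
            ring
      _ ≤ _ := by
          gcongr
          rcases max_cases ‖a‖ₑ ‖b‖ₑ with ⟨h6, -⟩ | ⟨h6, -⟩
          · rw [h6]
            exact le_self_add
          · rw [h6]
            exact le_add_self
  have hsp : ∀ t, T.powSum r (nonlin hγ hF (u t) - nonlin hγ hF (v t) : T.L2) ≤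
      ENNReal.ofReal (2 * C) ^ r *
        ((T.powSum (γ + 1) (u t) + T.powSum (γ + 1) (v t)) ^ ((γ - 1) / γ) *
          T.powSum (γ + 1) (u t - v t : T.L2) ^ (1 / γ)) := by
    intro t
    calc _ ≤ ∑' x, ENNReal.ofReal (2 * C) ^ r *
          ((‖u t x‖ₑ ^ (γ + 1) + ‖v t x‖ₑ ^ (γ + 1)) ^ ((γ - 1) / γ) *
            (‖u t x - v t x‖ₑ ^ (γ + 1)) ^ (1 / γ)) :=
          ENNReal.tsum_le_tsum fun x => hpt (u t x) (v t x)
      _ ≤ _ := by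
          rw [ENNReal.tsum_mul_left]
          gcongr
          refine (tsum_rpow_mul_rpow_le _ _ (by positivity) (by positivity) hθ).trans_eq ?_
          rw [ENNReal.tsum_add]
          rfl
  have hmu := aemeasurable_powSum_L2 hu (γ + 1)
  have hmv := aemeasurable_powSum_L2 hv (γ + 1)
  have hmd := aemeasurable_powSum_L2 (hu.sub hv) (γ + 1)
  have hts : ∫⁻ t, T.powSum r (nonlin hγ hF (u t) - nonlin hγ hF (v t) : T.L2) ≤
      ENNReal.ofReal (2 * C) ^ r *
        (((∫⁻ t, T.powSum (γ + 1) (u t)) + ∫⁻ t, T.powSum (γ + 1) (v t)) ^ ((γ - 1) / γ) *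
          (∫⁻ t, T.powSum (γ + 1) (u t - v t : T.L2)) ^ (1 / γ)) := by
    refine (lintegral_mono hsp).trans ?_
    rw [lintegral_const_mul' _ _ (by finiteness), ← lintegral_add_left' hmu]
    gcongr
    exact ENNReal.lintegral_mul_norm_pow_le (hmu.add hmv) hmd (by positivity) (by positivity) hθ
  calc _ ≤ _ := ENNReal.rpow_le_rpow hts (by positivity)
    _ = _ := by
        rw [ENNReal.mul_rpow_of_nonneg _ _ (by positivity),
          ENNReal.mul_rpow_of_nonneg _ _ (by positivity), ← ENNReal.rpow_mul, ← ENNReal.rpow_mul,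
          ← ENNReal.rpow_mul, mul_one_div_cancel hr0.ne', ENNReal.rpow_one, ← mul_assoc]
        have e1 : (γ - 1) / γ * (1 / r) = (γ - 1) / (γ + 1) := by
          rw [hr]
          field_simp
        have e2 : 1 / γ * (1 / r) = 1 / (γ + 1) := by
          rw [hr]
          field_simp
        rw [e1, e2]

end Nonlin

/-- Minkowski's inequality in `ℓ^p`. -/
lemma powSum_add_rpow_le {p : ℝ} (hp : 1 ≤ p) (f g : T.V → ℂ) :
    T.powSum p (fun x => f x + g x) ^ (1 / p) ≤ T.powSum p f ^ (1 / p) + T.powSum p g ^ (1 / p) := by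
  let _ : MeasurableSpace T.V := ⊤
  have h := ENNReal.lintegral_Lp_add_le (μ := Measure.count) (f := fun x => ‖f x‖ₑ)
    (g := fun x => ‖g x‖ₑ) measurable_from_top.aemeasurable measurable_from_top.aemeasurable hp
  simp only [lintegral_count] at h
  refine le_trans ?_ h
  apply ENNReal.rpow_le_rpow _ (by positivity)
  refine ENNReal.tsum_le_tsum fun x => ?_
  exact ENNReal.rpow_le_rpow (enorm_add_le _ _) (by positivity)

/-- Minkowski's inequality in `L^p_t ℓ^p`. -/
lemma lintegral_powSum_add_rpow_le {p : ℝ} (hp : 1 ≤ p) {u v : ℝ → T.L2}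
    (hu : AEStronglyMeasurable u) (hv : AEStronglyMeasurable v) :
    (∫⁻ t, T.powSum p (u t + v t : T.L2)) ^ (1 / p) ≤
      (∫⁻ t, T.powSum p (u t)) ^ (1 / p) + (∫⁻ t, T.powSum p (v t)) ^ (1 / p) := by
  have hpw : ∀ z : ℝ≥0∞, (z ^ (1 / p)) ^ p = z := fun z => by
    rw [← ENNReal.rpow_mul, one_div_mul_cancel (by positivity), ENNReal.rpow_one]
  have h := ENNReal.lintegral_Lp_add_le (μ := volume)
    ((aemeasurable_powSum_L2 hu p).pow_const (1 / p))
    ((aemeasurable_powSum_L2 hv p).pow_const (1 / p)) hp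
  simp only [hpw] at h
  refine le_trans ?_ h
  apply ENNReal.rpow_le_rpow _ (by positivity)
  refine lintegral_mono fun t => ?_
  refine (hpw _).symm.trans_le (ENNReal.rpow_le_rpow ?_ (by positivity))
  exact powSum_add_rpow_le hp (u t) (v t)

end HomTree

namespace HomTree

section AnalyticCurve

variable {E : Type*} [NormedAddCommGroup E] [InnerProductSpace ℂ E]

/-- The vectors that pair measurably with a given, possibly nonmeasurable, curve. -/
def measurablePairing (H : ℝ → E) (μ : Measure ℝ) : Submodule ℂ E where
  carrier := {h | AEStronglyMeasurable (fun s => (inner ℂ h (H s) : ℂ)) μ}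
  add_mem' {a b} ha hb := by
    simp only [Set.mem_ofPred_eq, inner_add_left]
    exact AEStronglyMeasurable.add ha hb
  zero_mem' := by
    simp only [Set.mem_ofPred_eq, inner_zero_left]
    exact aestronglyMeasurable_const
  smul_mem' c a ha := by
    simp only [Set.mem_ofPred_eq, inner_smul_left]
    exact AEStronglyMeasurable.const_mul ha _

lemma mem_measurablePairing {H : ℝ → E} {μ : Measure ℝ} {h : E} :
    h ∈ measurablePairing H μ ↔ AEStronglyMeasurable (fun s => (inner ℂ h (H s) : ℂ)) μ := Iff.rfl

lemma isClosed_measurablePairing (H : ℝ → E) (μ : Measure ℝ) :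
    IsClosed (measurablePairing H μ : Set E) := by
  refine IsSeqClosed.isClosed fun x y hx hy => ?_
  refine aestronglyMeasurable_of_tendsto_ae atTop hx (.of_forall fun s => ?_)
  exact hy.inner tendsto_const_nhds

lemma aestronglyMeasurable_inner_of_forall {φ H : ℝ → E} (hφ : Continuous φ) {μ : Measure ℝ}
    (h : ∀ t, φ t ∈ measurablePairing H μ) :
    AEStronglyMeasurable (fun s => (inner ℂ (φ s) (H s) : ℂ)) μ := by
  refine aestronglyMeasurable_of_tendsto_ae atTop
    (f := fun (n : ℕ) s => (inner ℂ (φ ((⌊((n : ℝ) + 1) * s⌋ : ℝ) / ((n : ℝ) + 1))) (H s) : ℂ)) (fun n => ?_)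
    (.of_forall fun s => ?_)
  · have hU : (⋃ k : ℤ, {s : ℝ | ⌊((n : ℝ) + 1) * s⌋ = k}) = Set.univ := by
      ext s
      simp
    rw [← Measure.restrict_univ (μ := μ), ← hU, aestronglyMeasurable_iUnion_iff]
    intro k
    have hk : MeasurableSet {s : ℝ | ⌊((n : ℝ) + 1) * s⌋ = k} :=
      (Int.measurable_floor.comp (measurable_const_mul _)) (measurableSet_singleton k)
    refine AEStronglyMeasurable.congr (mem_measurablePairing.1 (h (k / (n + 1)))).restrict ?_
    filter_upwards [ae_restrict_mem hk] with s hs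
    have hs' : ⌊((n : ℝ) + 1) * s⌋ = k := hs
    simp only [hs']
  · refine Tendsto.inner (hφ.continuousAt.tendsto.comp ?_) tendsto_const_nhds
    have h1 : Tendsto (fun n : ℕ => s - 1 / ((n : ℝ) + 1)) atTop (𝓝 s) := by
      simpa using tendsto_const_nhds.sub (tendsto_one_div_add_atTop_nhds_zero_nat (𝕜 := ℝ))
    refine tendsto_of_tendsto_of_tendsto_of_le_of_le h1 tendsto_const_nhds (fun n => ?_)
      (fun n => ?_)
    · have hn : (0 : ℝ) < n + 1 := by positivity
      have := (Int.lt_floor_add_one (((n : ℝ) + 1) * s)).le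
      change s - 1 / ((n : ℝ) + 1) ≤ (⌊((n : ℝ) + 1) * s⌋ : ℝ) / ((n : ℝ) + 1)
      rw [le_div_iff₀ hn, sub_mul, one_div_mul_cancel hn.ne']
      linarith
    · have hn : (0 : ℝ) < n + 1 := by positivity
      have := Int.floor_le (((n : ℝ) + 1) * s)
      change (⌊((n : ℝ) + 1) * s⌋ : ℝ) / ((n : ℝ) + 1) ≤ s
      rw [div_le_iff₀ hn]
      linarith

lemma forall_mem_or_ae_notMem {φ : ℝ → E} (hφ : ∀ t, AnalyticAt ℝ φ t) [CompleteSpace E]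
    {M : Submodule ℂ E} (hM : IsClosed (M : Set E)) : (∀ t, φ t ∈ M) ∨ ∀ᵐ t, φ t ∉ M := by
  by_cases h : ∀ t, φ t ∈ M
  · exact .inl h
  right
  push Not at h
  obtain ⟨t₀, ht₀⟩ := h
  have : CompleteSpace M := hM.completeSpace_coe
  rw [← M.orthogonal_orthogonal, Submodule.mem_orthogonal] at ht₀
  push Not at ht₀
  obtain ⟨y, hy, hy0⟩ := ht₀
  have ha : AnalyticOnNhd ℝ (fun t => (inner ℂ y (φ t) : ℂ)) Set.univ := fun t _ =>
    (((innerSL ℂ y).restrictScalars ℝ).analyticAt _).comp (hφ t)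
  have h1 := ha.preimage_zero_mem_codiscrete hy0
  have h2 := ae_restrict_le_codiscreteWithin (μ := (volume : Measure ℝ)) MeasurableSet.univ h1
  rw [Measure.restrict_univ] at h2
  filter_upwards [h2] with t ht hmem
  exact ht (Submodule.inner_left_of_mem_orthogonal hmem hy)

lemma aestronglyMeasurable_Ioi_of_rat {g : ℝ → ℂ}
    (h : ∀ τ : ℚ, 0 < τ → AEStronglyMeasurable g (volume.restrict (Set.Ioc 0 (τ : ℝ))) ∨
      AEStronglyMeasurable g (volume.restrict (Set.Ioi (τ : ℝ)))) :
    AEStronglyMeasurable g (volume.restrict (Set.Ioi 0)) := by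
  classical
  let S : {τ : ℚ // 0 < τ} → Set ℝ := fun τ =>
    if AEStronglyMeasurable g (volume.restrict (Set.Ioc 0 ((τ : ℚ) : ℝ))) then Set.Ioc 0 ((τ : ℚ) : ℝ)
    else Set.Ioi ((τ : ℚ) : ℝ)
  have hS : AEStronglyMeasurable g (volume.restrict (⋃ τ, S τ)) := by
    rw [aestronglyMeasurable_iUnion_iff]
    intro τ
    by_cases hτ : AEStronglyMeasurable g (volume.restrict (Set.Ioc 0 ((τ : ℚ) : ℝ)))
    · simpa only [S, if_pos hτ] using hτ
    · simpa only [S, if_neg hτ] using (h τ τ.2).resolve_left hτ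
  have hsub : (Set.Ioi 0 \ ⋃ τ, S τ).Subsingleton := by
    have key : ∀ a b : ℝ, a ∈ Set.Ioi 0 \ ⋃ τ, S τ → b ∈ Set.Ioi 0 \ ⋃ τ, S τ → ¬ a < b := by
      rintro a b ⟨ha0, ha⟩ ⟨-, hb⟩ hab
      obtain ⟨τ, h1, h2⟩ := exists_rat_btwn hab
      have hτ : 0 < τ := by exact_mod_cast (Set.mem_Ioi.1 ha0).trans h1
      rw [Set.mem_iUnion, not_exists] at ha hb
      have ha' := ha ⟨τ, hτ⟩
      have hb' := hb ⟨τ, hτ⟩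
      by_cases hm : AEStronglyMeasurable g (volume.restrict (Set.Ioc 0 (τ : ℝ)))
      · simp only [S, if_pos hm] at ha'
        exact ha' ⟨ha0, h1.le⟩
      · simp only [S, if_neg hm] at hb'
        exact hb' h2
    intro a ha b hb
    exact le_antisymm (not_lt.1 (key b a hb ha)) (not_lt.1 (key a b ha hb))
  have h0 : AEStronglyMeasurable g (volume.restrict (Set.Ioi 0 \ ⋃ τ, S τ)) := by
    rw [Measure.restrict_eq_zero.2 (hsub.measure_zero _)]
    exact aestronglyMeasurable_zero_measure g
  refine (aestronglyMeasurable_union_iff.2 ⟨hS, h0⟩).mono_measure (Measure.restrict_mono ?_ le_rfl)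
  intro s hs
  by_cases hsU : s ∈ ⋃ τ, S τ
  · exact .inl hsU
  · exact .inr ⟨hs, hsU⟩

/-- If a function agrees with the pairing of an analytic curve with some curve `H`, and agrees with a
measurable function at every time before which the pairing is nonmeasurable, it is measurable. -/
lemma aestronglyMeasurable_Ioi_inner_of_analytic [CompleteSpace E] {φ H : ℝ → E}
    (hφ : ∀ t, AnalyticAt ℝ φ t)
    {w : ℝ → ℂ} (hw : AEStronglyMeasurable w)
    (h : ∀ t, 0 < t → φ t ∉ measurablePairing H (volume.restrict (Set.Ioc 0 t)) →
      inner ℂ (φ t) (H t) = w t) :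
    AEStronglyMeasurable (fun s => (inner ℂ (φ s) (H s) : ℂ)) (volume.restrict (Set.Ioi 0)) := by
  refine aestronglyMeasurable_Ioi_of_rat fun τ hτ => ?_
  rcases forall_mem_or_ae_notMem hφ
    (isClosed_measurablePairing H (volume.restrict (Set.Ioc 0 (τ : ℝ)))) with h1 | h1
  · left
    exact aestronglyMeasurable_inner_of_forall
      (continuous_iff_continuousAt.2 fun t => (hφ t).continuousAt) h1
  · right
    refine AEStronglyMeasurable.congr hw.restrict ?_
    filter_upwards [ae_restrict_of_ae h1, ae_restrict_mem measurableSet_Ioi] with t ht htτ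
    have hτ' : (0 : ℝ) < τ := by exact_mod_cast hτ
    refine (h t (hτ'.trans htτ) fun hm => ht ?_).symm
    rw [mem_measurablePairing] at hm ⊢
    exact hm.mono_measure (Measure.restrict_mono (Set.Ioc_subset_Ioc_right (le_of_lt htτ)) le_rfl)

end AnalyticCurve

variable {Q : ℕ} {T : HomTree Q}

lemma apply_eq_inner_single [DecidableEq T.V] (f : T.L2) (x : T.V) :
    f x = inner ℂ (lp.single 2 x (1 : ℂ) : T.L2) f := by
  rw [lp.inner_single_left]
  simp

lemma analyticAt_schGroup_apply (hQ : 1 ≤ Q) {φ : ℝ → ℝ} {t : ℝ} (hφ : AnalyticAt ℝ φ t)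
    (f : T.L2) : AnalyticAt ℝ (fun s => T.schGroup hQ (φ s) f) t := by
  have h : AnalyticAt ℝ (fun s => T.schGroup hQ (φ s)) t :=
    AnalyticAt.comp (g := T.schGroup hQ) (analyticAt_expGroup _ _ _) hφ
  exact ((ContinuousLinearMap.apply ℂ T.L2 f).restrictScalars ℝ).analyticAt _ |>.comp h

/-- One-sided measurability of the forcing term of a Duhamel equation. -/
lemma aestronglyMeasurable_Ioi_of_duhamel (hQ : 1 ≤ Q) (σ : ℝ) {G : ℝ → T.L2} (x : T.V)
    {w : ℝ → ℂ} (hw : AEStronglyMeasurable w)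
    (h : ∀ t, 0 < t → ¬ IntervalIntegrable
      (fun s => T.schGroup hQ (σ * (t - s)) (G s) x) volume 0 t → G t x = w t) :
    AEStronglyMeasurable (fun s => G s x) (volume.restrict (Set.Ioi 0)) := by
  classical
  have hkey : ∀ t s, inner ℂ (T.schGroup hQ (-σ * t) (lp.single 2 x (1 : ℂ) : T.L2))
      (T.schGroup hQ (-σ * s) (G s)) = T.schGroup hQ (σ * (t - s)) (G s) x := fun t s => by
    rw [inner_schGroup, ← schGroup_add_apply, apply_eq_inner_single]
    congr 3
    ring
  have hdiag : ∀ s, T.schGroup hQ (σ * (s - s)) (G s) x = G s x := fun s => by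
    rw [sub_self, mul_zero, schGroup_zero]
    rfl
  have := aestronglyMeasurable_Ioi_inner_of_analytic
    (φ := fun t => T.schGroup hQ (-σ * t) (lp.single 2 x (1 : ℂ) : T.L2))
    (H := fun s => T.schGroup hQ (-σ * s) (G s))
    (fun t => analyticAt_schGroup_apply hQ (by fun_prop) _) hw (fun t ht hn => by
      rw [hkey, hdiag]
      refine h t ht fun hi => hn ?_
      rw [mem_measurablePairing]
      simp only [hkey]
      rw [intervalIntegrable_iff, Set.uIoc_of_le ht.le] at hi
      exact hi.aestronglyMeasurable)
  simpa only [hkey, hdiag] using this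

lemma aestronglyMeasurable_of_duhamel (hQ : 1 ≤ Q) {G : ℝ → T.L2} (x : T.V)
    {w : ℝ → ℂ} (hw : Continuous w)
    (h : ∀ t, ¬ IntervalIntegrable
      (fun s => T.schGroup hQ (t - s) (G s) x) volume 0 t → G t x = w t) :
    AEStronglyMeasurable (fun s => G s x) := by
  have h1 := aestronglyMeasurable_Ioi_of_duhamel hQ 1 x hw.aestronglyMeasurable fun t _ hn =>
    h t (by simpa using hn)
  have h2 := aestronglyMeasurable_Ioi_of_duhamel hQ (-1) (G := fun s => G (-s)) x
    (w := fun s => w (-s)) (hw.comp continuous_neg).aestronglyMeasurable fun t _ hn =>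
    h (-t) fun hi => hn (by
      rw [IntervalIntegrable.iff_comp_neg, neg_zero, neg_neg] at hi
      refine hi.congr fun s _ => ?_
      simp only
      ring_nf)
  have h3 : AEStronglyMeasurable (fun s => G s x) (volume.restrict (Set.Iio 0)) := by
    have hp : MeasurePreserving (fun s : ℝ => -s) (volume.restrict (Set.Iio 0))
        (volume.restrict (Set.Ioi 0)) := by
      have := (Measure.measurePreserving_neg (volume : Measure ℝ)).restrict_preimage
        (measurableSet_Ioi (a := (0 : ℝ)))
      simpa using this
    have := h2.comp_measurePreserving hp
    simpa [Function.comp_def] using this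
  have h4 : AEStronglyMeasurable (fun s => G s x) (volume.restrict ({0} : Set ℝ)) := by
    rw [Measure.restrict_eq_zero.2 (measure_singleton 0)]
    exact aestronglyMeasurable_zero_measure _
  have h5 := aestronglyMeasurable_union_iff.2
    ⟨aestronglyMeasurable_union_iff.2 ⟨h3, h4⟩, h1⟩
  have hU : Set.Iio (0 : ℝ) ∪ {0} ∪ Set.Ioi 0 = Set.univ := by
    ext s
    simp
  rwa [hU, Measure.restrict_univ] at h5

end HomTree

namespace HomTree

variable {Q : ℕ} {T : HomTree Q}

/-! ### The norm of `C(ℝ; ℓ²) ∩ L^q(ℝ; ℓ^q)` -/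

/-- The norm of `C(ℝ; ℓ²) ∩ L^q(ℝ; ℓ^q)`. -/
def strichartzNorm (q : ℝ) (u : ℝ → T.L2) : ℝ≥0∞ :=
  (⨆ t, ‖u t‖ₑ) + (∫⁻ t, T.powSum q (u t)) ^ (1 / q)

section StrichartzNorm

variable {q : ℝ} {u v : ℝ → T.L2}

lemma enorm_le_strichartzNorm (q : ℝ) (u : ℝ → T.L2) (t : ℝ) : ‖u t‖ₑ ≤ strichartzNorm q u :=
  (le_iSup (fun t => ‖u t‖ₑ) t).trans le_self_add

lemma lintegral_powSum_le_strichartzNorm_rpow (hq : 0 < q) (u : ℝ → T.L2) :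
    ∫⁻ t, T.powSum q (u t) ≤ strichartzNorm q u ^ q := by
  have h : (∫⁻ t, T.powSum q (u t)) ^ (1 / q) ≤ strichartzNorm q u := le_add_self
  rwa [one_div, ENNReal.rpow_inv_le_iff hq] at h

lemma strichartzNorm_zero (hq : 0 < q) : strichartzNorm q (fun _ => (0 : T.L2)) = 0 := by
  simp only [strichartzNorm, powSum_zero hq, lintegral_zero, enorm_zero, iSup_const]
  rw [ENNReal.zero_rpow_of_pos (by positivity), add_zero]

lemma strichartzNorm_add_le (hq : 1 ≤ q) (hu : AEStronglyMeasurable u)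
    (hv : AEStronglyMeasurable v) :
    strichartzNorm q (fun t => u t + v t) ≤ strichartzNorm q u + strichartzNorm q v := by
  have h1 : ⨆ t, ‖u t + v t‖ₑ ≤ (⨆ t, ‖u t‖ₑ) + ⨆ t, ‖v t‖ₑ := iSup_le fun t =>
    (enorm_add_le _ _).trans (add_le_add (le_iSup (fun t => ‖u t‖ₑ) t)
      (le_iSup (fun t => ‖v t‖ₑ) t))
  refine (add_le_add h1 (lintegral_powSum_add_rpow_le hq hu hv)).trans_eq ?_
  simp only [strichartzNorm]
  ring

lemma strichartzNorm_smul_of_norm_eq_one {c : ℂ} (hc : ‖c‖ = 1) (q : ℝ) (u : ℝ → T.L2) :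
    strichartzNorm q (fun t => c • u t) = strichartzNorm q u := by
  have hc' : ‖c‖ₑ = 1 := by rw [← ofReal_norm, hc, ENNReal.ofReal_one]
  simp only [strichartzNorm, powSum, L2.smul_apply, enorm_mul, enorm_smul, hc', one_mul]

lemma eq_of_strichartzNorm_sub_eq_zero (h : strichartzNorm q (fun t => u t - v t) = 0) :
    u = v := by
  funext t
  have := enorm_le_strichartzNorm q (fun t => u t - v t) t
  rw [h, nonpos_iff_eq_zero, enorm_eq_zero, sub_eq_zero] at this
  exact this

/-- Fatou's lemma for `strichartzNorm`. -/
lemma strichartzNorm_le_of_tendsto (hq : 1 ≤ q) {w : ℕ → ℝ → T.L2}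
    (hw : ∀ n, AEStronglyMeasurable (w n)) (h : ∀ t, Tendsto (fun n => w n t) atTop (𝓝 (u t)))
    {a b : ℝ≥0∞} (ha : ∀ n t, ‖w n t‖ₑ ≤ a) (hb : ∀ n, (∫⁻ t, T.powSum q (w n t)) ≤ b) :
    strichartzNorm q u ≤ a + b ^ (1 / q) := by
  refine add_le_add (iSup_le fun t => le_of_tendsto (h t).enorm (.of_forall fun n => ha n t))
    (ENNReal.rpow_le_rpow ?_ (by positivity))
  let _ : MeasurableSpace T.V := ⊤
  have h1 : ∀ t, T.powSum q (u t) ≤ liminf (fun n => T.powSum q (w n t)) atTop := fun t => by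
    have h2 : ∀ x, Tendsto (fun n => ‖w n t x‖ₑ ^ q) atTop (𝓝 (‖u t x‖ₑ ^ q)) := fun x =>
      (ENNReal.continuous_rpow_const.tendsto _).comp
        (((evalL x).continuous.tendsto _).comp (h t)).enorm
    have h3 := lintegral_liminf_le (u := atTop) (μ := Measure.count) (f := fun n x => ‖w n t x‖ₑ ^ q)
      fun n => measurable_from_top
    simp only [lintegral_count, fun x => (h2 x).liminf_eq] at h3
    exact h3
  calc _ ≤ ∫⁻ t, liminf (fun n => T.powSum q (w n t)) atTop := lintegral_mono h1
    _ ≤ liminf (fun n => ∫⁻ t, T.powSum q (w n t)) atTop :=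
        lintegral_liminf_le' fun n => aemeasurable_powSum_L2 (hw n) q
    _ ≤ b := liminf_le_of_le (by isBoundedDefault) fun c hc => by
        obtain ⟨n, hn⟩ := hc.exists
        exact hn.trans (hb n)

end StrichartzNorm

lemma exists_strichartzNorm_schGroup_le (hQ : 2 ≤ Q) {q r : ℝ} (hqr : q.HolderConjugate r)
    (hq : 2 < q) (T : HomTree Q) : ∃ Y : ℝ≥0∞, Y ≠ ∞ ∧
      (∀ f : T.L2, strichartzNorm q (fun t => T.schGroup (one_le_two.trans hQ) t f) ≤ Y * ‖f‖ₑ) ∧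
      ∀ G : ℝ → T.L2, AEStronglyMeasurable G → (∀ a b, IntervalIntegrable G volume a b) →
        strichartzNorm q (T.duhamel (one_le_two.trans hQ) G) ≤
          Y * (∫⁻ t, T.powSum r (G t)) ^ (1 / r) := by
  obtain ⟨Y, hY, h1, h2⟩ := T.exists_strichartz hQ hqr hq
  refine ⟨1 + 2 * Y, by finiteness, fun f => ?_, fun G hG hGi => ?_⟩
  · calc _ ≤ ‖f‖ₑ + Y * ‖f‖ₑ := by
          refine add_le_add (iSup_le fun t => ?_) (h1 f)
          rw [← ofReal_norm, norm_schGroup_apply, ofReal_norm]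
      _ = (1 + Y) * ‖f‖ₑ := by ring
      _ ≤ _ := by
          gcongr
          exact le_mul_of_one_le_left' one_le_two
  · calc _ ≤ Y * (∫⁻ t, T.powSum r (G t)) ^ (1 / r) + Y * (∫⁻ t, T.powSum r (G t)) ^ (1 / r) :=
          add_le_add (iSup_le (h2 G hG hGi).1) (h2 G hG hGi).2
      _ = 2 * Y * (∫⁻ t, T.powSum r (G t)) ^ (1 / r) := by ring
      _ ≤ _ := by
          gcongr
          exact le_add_self

/-! ### The fixed point argument -/

lemma duhamel_sub (hQ : 1 ≤ Q) {G H : ℝ → T.L2} (hG : ∀ a b, IntervalIntegrable G volume a b)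
    (hH : ∀ a b, IntervalIntegrable H volume a b) (t : ℝ) :
    T.duhamel hQ (fun s => G s - H s) t = T.duhamel hQ G t - T.duhamel hQ H t := by
  simp only [duhamel, map_sub]
  rw [intervalIntegral.integral_sub
    (intervalIntegrable_schGroup_apply hQ continuous_neg (hG 0 t))
    (intervalIntegrable_schGroup_apply hQ continuous_neg (hH 0 t)), map_sub]

lemma duhamel_apply (hQ : 1 ≤ Q) {G : ℝ → T.L2} (hG : ∀ a b, IntervalIntegrable G volume a b)
    (t : ℝ) (x : T.V) :
    T.duhamel hQ G t x = ∫ s in (0 : ℝ)..t, T.schGroup hQ (t - s) (G s) x := by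
  have h2 := ((evalL x).comp (T.schGroup hQ t)).intervalIntegral_comp_comm
    (intervalIntegrable_schGroup_apply hQ continuous_neg (hG 0 t))
  refine Eq.trans h2.symm (intervalIntegral.integral_congr fun s _ => ?_)
  simp only [ContinuousLinearMap.comp_apply, evalL_apply]
  rw [← schGroup_add_apply, sub_eq_add_neg]

section FixedPoint

variable {F : ℂ → ℂ} {γ : ℝ} (hγ : 1 < γ) (hF : PowerLike F γ) (hQ : 1 ≤ Q)

/-- The Picard map of the integral equation. -/
def picard (f : T.L2) (u : ℝ → T.L2) (t : ℝ) : T.L2 :=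
  T.schGroup hQ t f - Complex.I • T.duhamel hQ (fun s => nonlin hγ hF (u s)) t

variable {hγ hF} in
lemma intervalIntegrable_nonlin_of_strichartzNorm {q : ℝ} {u : ℝ → T.L2} (hu : Continuous u)
    (h : strichartzNorm q u ≠ ∞) (a b : ℝ) :
    IntervalIntegrable (fun s => nonlin hγ hF (u s)) volume a b := by
  refine intervalIntegrable_nonlin hγ hF hu.aestronglyMeasurable
    (M := (strichartzNorm q u).toReal) (fun t => ?_) a b
  rw [← toReal_enorm]
  exact ENNReal.toReal_mono h (enorm_le_strichartzNorm q u t)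

variable {hγ hF} in
lemma continuous_picard {q : ℝ} (f : T.L2) {u : ℝ → T.L2} (hu : Continuous u)
    (h : strichartzNorm q u ≠ ∞) : Continuous (picard hγ hF hQ f u) := by
  have h1 := continuous_duhamel hQ
    (intervalIntegrable_nonlin_of_strichartzNorm (hγ := hγ) (hF := hF) hu h)
  exact ((T.continuous_schGroup hQ).clm_apply continuous_const).sub (h1.const_smul Complex.I)

end FixedPoint

/-- On a small ball, the nonlinear part of the Picard map is a contraction. -/
lemma exists_strichartzNorm_duhamel_sub_le (hQ : 2 ≤ Q) (T : HomTree Q) {F : ℂ → ℂ} {γ : ℝ}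
    (hγ : 1 < γ) (hF : PowerLike F γ) : ∃ A ε : ℝ≥0∞, A ≠ ∞ ∧ 0 < ε ∧ ε ≠ ∞ ∧
      (∀ f : T.L2, strichartzNorm (γ + 1) (fun t => T.schGroup (one_le_two.trans hQ) t f) ≤
        A * ‖f‖ₑ) ∧
      ∀ u v : ℝ → T.L2, Continuous u → Continuous v →
        strichartzNorm (γ + 1) u ≤ ε → strichartzNorm (γ + 1) v ≤ ε →
        strichartzNorm (γ + 1) (fun t =>
          T.duhamel (one_le_two.trans hQ) (fun s => nonlin hγ hF (u s)) t -
          T.duhamel (one_le_two.trans hQ) (fun s => nonlin hγ hF (v s)) t) ≤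
        2⁻¹ * strichartzNorm (γ + 1) (fun t => u t - v t) := by
  have hqr : (γ + 1).HolderConjugate ((γ + 1) / γ) := by
    rw [Real.holderConjugate_iff]
    refine ⟨by linarith, ?_⟩
    field_simp
    ring
  obtain ⟨Y, hY, h1, h2⟩ := exists_strichartzNorm_schGroup_le hQ hqr (by linarith) T
  obtain ⟨C, hC, h3⟩ := exists_lintegral_powSum_nonlin_sub_le T hγ hF
  have hlim : Tendsto (fun e : ℝ≥0∞ => Y * (C * (e ^ (γ + 1) + e ^ (γ + 1)) ^ ((γ - 1) / (γ + 1))))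
      (𝓝 0) (𝓝 0) := by
    have hc : Tendsto (fun e : ℝ≥0∞ => (e ^ (γ + 1) + e ^ (γ + 1)) ^ ((γ - 1) / (γ + 1)))
        (𝓝 0) (𝓝 0) := by
      have : Continuous fun e : ℝ≥0∞ => (e ^ (γ + 1) + e ^ (γ + 1)) ^ ((γ - 1) / (γ + 1)) :=
        ENNReal.continuous_rpow_const.comp
          (ENNReal.continuous_rpow_const.add ENNReal.continuous_rpow_const)
      refine (this.tendsto 0).trans_eq ?_
      rw [ENNReal.zero_rpow_of_pos (by linarith), add_zero,
        ENNReal.zero_rpow_of_pos (div_pos (by linarith) (by linarith))]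
    have := ENNReal.Tendsto.const_mul (a := Y)
      (ENNReal.Tendsto.const_mul (a := C) hc (.inr hC)) (.inr hY)
    simpa using this
  have hne : (𝓝[>] (0 : ℝ≥0∞)).NeBot := nhdsGT_neBot_of_exists_gt ⟨1, one_pos⟩
  obtain ⟨ε, ⟨hε1, hε2⟩, hε0⟩ :=
    ((((hlim.eventually_lt_const (ENNReal.inv_pos.2 ENNReal.ofNat_ne_top : 0 < (2 : ℝ≥0∞)⁻¹)).and
      (gt_mem_nhds one_pos)).filter_mono nhdsWithin_le_nhds).and
      (eventually_mem_nhdsWithin (a := (0 : ℝ≥0∞)) (s := Set.Ioi 0))).exists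
  refine ⟨Y, ε, hY, hε0, (hε2.trans ENNReal.one_lt_top).ne, h1, fun u v hu hv hue hve => ?_⟩
  have hε : ε ≠ ∞ := (hε2.trans ENNReal.one_lt_top).ne
  have hui := intervalIntegrable_nonlin_of_strichartzNorm (hγ := hγ) (hF := hF) hu
    (ne_top_of_le_ne_top hε hue)
  have hvi := intervalIntegrable_nonlin_of_strichartzNorm (hγ := hγ) (hF := hF) hv
    (ne_top_of_le_ne_top hε hve)
  have hq : 0 < γ + 1 := by linarith
  simp only [← duhamel_sub (one_le_two.trans hQ) hui hvi]
  calc _ ≤ _ := h2 _ ((((continuous_nonlin hγ hF).comp hu).sub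
        ((continuous_nonlin hγ hF).comp hv)).aestronglyMeasurable) fun a b => (hui a b).sub (hvi a b)
    _ ≤ _ := mul_le_mul_right (h3 u v hu.aestronglyMeasurable hv.aestronglyMeasurable) Y
    _ ≤ Y * (C * (ε ^ (γ + 1) + ε ^ (γ + 1)) ^ ((γ - 1) / (γ + 1)) *
          strichartzNorm (γ + 1) (fun t => u t - v t)) := by
        refine mul_le_mul_right (mul_le_mul' (mul_le_mul_right (ENNReal.rpow_le_rpow
          (add_le_add ?_ ?_) (div_nonneg (by linarith) hq.le)) C) le_add_self) Y
        · exact (lintegral_powSum_le_strichartzNorm_rpow hq u).trans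
            (ENNReal.rpow_le_rpow hue hq.le)
        · exact (lintegral_powSum_le_strichartzNorm_rpow hq v).trans
            (ENNReal.rpow_le_rpow hve hq.le)
    _ = Y * (C * (ε ^ (γ + 1) + ε ^ (γ + 1)) ^ ((γ - 1) / (γ + 1))) *
          strichartzNorm (γ + 1) (fun t => u t - v t) := by ring
    _ ≤ _ := mul_le_mul_left hε1.le _

end HomTree

namespace HomTree

variable {Q : ℕ} {T : HomTree Q}

section FixedPoint

variable {F : ℂ → ℂ} {γ : ℝ} {hγ : 1 < γ} {hF : PowerLike F γ} {hQ : 1 ≤ Q} {A ε : ℝ≥0∞}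

lemma picard_zero (hγ : 1 < γ) (hF : PowerLike F γ) (hQ : 1 ≤ Q) :
    picard hγ hF hQ (0 : T.L2) (fun _ => 0) = fun _ => 0 := by
  funext t
  simp [picard, duhamel, nonlin_zero]

lemma strichartzNorm_picard_sub_le (hε : ε ≠ ∞)
    (hlin : ∀ f : T.L2, strichartzNorm (γ + 1) (fun t => T.schGroup hQ t f) ≤ A * ‖f‖ₑ)
    (hcon : ∀ u v : ℝ → T.L2, Continuous u → Continuous v →
      strichartzNorm (γ + 1) u ≤ ε → strichartzNorm (γ + 1) v ≤ ε →
      strichartzNorm (γ + 1) (fun t => T.duhamel hQ (fun s => nonlin hγ hF (u s)) t -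
        T.duhamel hQ (fun s => nonlin hγ hF (v s)) t) ≤
      2⁻¹ * strichartzNorm (γ + 1) (fun t => u t - v t))
    (f g : T.L2) {u v : ℝ → T.L2} (hu : Continuous u) (hv : Continuous v)
    (hue : strichartzNorm (γ + 1) u ≤ ε) (hve : strichartzNorm (γ + 1) v ≤ ε) :
    strichartzNorm (γ + 1) (fun t => picard hγ hF hQ f u t - picard hγ hF hQ g v t) ≤
      A * ‖f - g‖ₑ + 2⁻¹ * strichartzNorm (γ + 1) (fun t => u t - v t) := by
  have h1 := continuous_duhamel hQ (intervalIntegrable_nonlin_of_strichartzNorm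
    (hγ := hγ) (hF := hF) hu (ne_top_of_le_ne_top hε hue))
  have h2 := continuous_duhamel hQ (intervalIntegrable_nonlin_of_strichartzNorm
    (hγ := hγ) (hF := hF) hv (ne_top_of_le_ne_top hε hve))
  have h3 : (fun t => picard hγ hF hQ f u t - picard hγ hF hQ g v t) = fun t =>
      T.schGroup hQ t (f - g) + (-Complex.I) • (T.duhamel hQ (fun s => nonlin hγ hF (u s)) t -
        T.duhamel hQ (fun s => nonlin hγ hF (v s)) t) := by
    funext t
    rw [picard, picard, map_sub, neg_smul, smul_sub]
    abel
  rw [h3]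
  have h4 : Continuous fun t => (-Complex.I) • (T.duhamel hQ (fun s => nonlin hγ hF (u s)) t -
        T.duhamel hQ (fun s => nonlin hγ hF (v s)) t) := by
    exact (h1.sub h2).const_smul (-Complex.I)
  refine (strichartzNorm_add_le (by linarith) ((T.continuous_schGroup hQ).clm_apply
    continuous_const).aestronglyMeasurable h4.aestronglyMeasurable).trans ?_
  rw [strichartzNorm_smul_of_norm_eq_one (by simp)]
  exact add_le_add (hlin _) (hcon u v hu hv hue hve)

lemma tendsto_picard {q : ℝ} (f : T.L2) {w : ℕ → ℝ → T.L2} {u : ℝ → T.L2}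
    (hw : ∀ n, Continuous (w n)) (hε : ε ≠ ∞) (hwε : ∀ n, strichartzNorm q (w n) ≤ ε)
    (h : ∀ t, Tendsto (fun n => w n t) atTop (𝓝 (u t))) (t : ℝ) :
    Tendsto (fun n => picard hγ hF hQ f (w n) t) atTop (𝓝 (picard hγ hF hQ f u t)) := by
  obtain ⟨B, hB⟩ := exists_norm_nonlin_le (T := T) hγ hF ε.toReal
  refine tendsto_const_nhds.sub (Tendsto.const_smul ?_ _)
  refine ((T.schGroup hQ t).continuous.tendsto _).comp ?_
  refine intervalIntegral.tendsto_integral_filter_of_dominated_convergence (fun _ => B)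
    (.of_forall fun n => ?_) (.of_forall fun n => .of_forall fun s _ => ?_)
    intervalIntegrable_const (.of_forall fun s _ => ?_)
  · exact aestronglyMeasurable_schGroup_apply hQ continuous_neg
      ((continuous_nonlin hγ hF).comp (hw n)).aestronglyMeasurable
  · rw [norm_schGroup_apply]
    refine hB _ ?_
    rw [← toReal_enorm]
    exact ENNReal.toReal_mono hε ((enorm_le_strichartzNorm q (w n) s).trans (hwε n))
  · exact ((T.schGroup hQ (-s)).continuous.tendsto _).comp
      (((continuous_nonlin hγ hF).tendsto _).comp (h s))

lemma exists_eq_picard (hε : ε ≠ ∞)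
    (hlin : ∀ f : T.L2, strichartzNorm (γ + 1) (fun t => T.schGroup hQ t f) ≤ A * ‖f‖ₑ)
    (hcon : ∀ u v : ℝ → T.L2, Continuous u → Continuous v →
      strichartzNorm (γ + 1) u ≤ ε → strichartzNorm (γ + 1) v ≤ ε →
      strichartzNorm (γ + 1) (fun t => T.duhamel hQ (fun s => nonlin hγ hF (u s)) t -
        T.duhamel hQ (fun s => nonlin hγ hF (v s)) t) ≤
      2⁻¹ * strichartzNorm (γ + 1) (fun t => u t - v t))
    (f : T.L2) (hf : A * ‖f‖ₑ ≤ 2⁻¹ * (2⁻¹ * ε)) :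
    ∃ u : ℝ → T.L2, Continuous u ∧ strichartzNorm (γ + 1) u ≤ ε ∧ picard hγ hF hQ f u = u := by
  have hq : 0 < γ + 1 := by linarith
  have hhalf : ∀ z : ℝ≥0∞, 2⁻¹ * z + 2⁻¹ * z = z := fun z => by
    rw [← add_mul, ENNReal.inv_two_add_inv_two, one_mul]
  have hle : 2⁻¹ * ε ≤ ε := le_self_add.trans (hhalf ε).le
  have hzero : strichartzNorm (γ + 1) (fun _ => (0 : T.L2)) ≤ ε := by simp [strichartzNorm_zero hq]
  set w : ℕ → ℝ → T.L2 := fun n => (picard hγ hF hQ f)^[n] (fun _ => 0) with hwdef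
  have hsucc : ∀ n, w (n + 1) = picard hγ hF hQ f (w n) := fun n =>
    Function.iterate_succ_apply' _ _ _
  have hw : ∀ n, Continuous (w n) ∧ strichartzNorm (γ + 1) (w n) ≤ 2⁻¹ * ε := by
    intro n
    induction n with
    | zero => exact ⟨continuous_const, by simp [hwdef, strichartzNorm_zero hq]⟩
    | succ n ih =>
      rw [hsucc]
      have hn := ih.2.trans hle
      refine ⟨continuous_picard hQ f ih.1 (ne_top_of_le_ne_top hε hn), ?_⟩
      have := strichartzNorm_picard_sub_le hε hlin hcon f 0 ih.1 continuous_const hn hzero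
      rw [picard_zero] at this
      simp only [sub_zero] at this
      refine (this.trans (add_le_add hf (mul_le_mul_right ih.2 _))).trans_eq (hhalf _)
  have hwε : ∀ n, strichartzNorm (γ + 1) (w n) ≤ ε := fun n => (hw n).2.trans hle
  have hstep : ∀ n, strichartzNorm (γ + 1) (fun t => w (n + 1) t - w n t) ≤ 2⁻¹ ^ n * ε := by
    intro n
    induction n with
    | zero => simpa [hwdef] using hwε 1
    | succ n ih =>
      rw [hsucc (n + 1), hsucc n]
      have := strichartzNorm_picard_sub_le hε hlin hcon f f (hw (n + 1)).1 (hw n).1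
        (hwε _) (hwε _)
      rw [sub_self, enorm_zero, mul_zero, zero_add] at this
      rw [← hsucc n] at this ⊢
      refine this.trans ?_
      rw [pow_succ', mul_assoc]
      exact mul_le_mul_right ih _
  have hdist : ∀ t n, dist (w n t) (w (n + 1) t) ≤ 2 * ε.toReal / 2 / 2 ^ n := fun t n => by
    rw [dist_comm, dist_eq_norm, ← toReal_enorm]
    refine (ENNReal.toReal_mono (by finiteness)
      ((enorm_le_strichartzNorm _ (fun t => w (n + 1) t - w n t) t).trans (hstep n))).trans_eq ?_
    simp only [ENNReal.toReal_mul, ENNReal.toReal_pow, ENNReal.toReal_inv, ENNReal.toReal_ofNat]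
    rw [inv_pow]
    field_simp
  choose u hu using fun t => cauchySeq_tendsto_of_complete (cauchySeq_of_le_geometric_two (hdist t))
  have hunif : TendstoUniformly w u atTop := by
    rw [Metric.tendstoUniformly_iff]
    intro e he
    have h1 : Tendsto (fun n : ℕ => 2 * ε.toReal / 2 ^ n) atTop (𝓝 0) :=
      tendsto_const_nhds.div_atTop (tendsto_pow_atTop_atTop_of_one_lt one_lt_two)
    filter_upwards [h1.eventually_lt_const he] with n hn t
    rw [dist_comm]
    exact (dist_le_of_le_geometric_two_of_tendsto (hdist t) (hu t) n).trans_lt hn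
  refine ⟨u, hunif.continuous (.of_forall fun n => (hw n).1), ?_, ?_⟩
  · refine (strichartzNorm_le_of_tendsto (a := 2⁻¹ * ε) (b := (2⁻¹ * ε) ^ (γ + 1)) (by linarith)
      (fun n => (hw n).1.aestronglyMeasurable) hu
      (fun n t => (enorm_le_strichartzNorm _ (w n) t).trans (hw n).2)
      (fun n => (lintegral_powSum_le_strichartzNorm_rpow hq _).trans
        (ENNReal.rpow_le_rpow (hw n).2 hq.le))).trans_eq ?_
    rw [one_div, ENNReal.rpow_rpow_inv hq.ne', hhalf]
  · funext t
    refine tendsto_nhds_unique (tendsto_picard f (fun n => (hw n).1) hε hwε hu t) ?_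
    simp only [← hsucc]
    exact (hu t).comp (tendsto_add_atTop_nat 1)

lemma strichartzNorm_sub_le_of_eq_picard (hε : ε ≠ ∞)
    (hlin : ∀ f : T.L2, strichartzNorm (γ + 1) (fun t => T.schGroup hQ t f) ≤ A * ‖f‖ₑ)
    (hcon : ∀ u v : ℝ → T.L2, Continuous u → Continuous v →
      strichartzNorm (γ + 1) u ≤ ε → strichartzNorm (γ + 1) v ≤ ε →
      strichartzNorm (γ + 1) (fun t => T.duhamel hQ (fun s => nonlin hγ hF (u s)) t -
        T.duhamel hQ (fun s => nonlin hγ hF (v s)) t) ≤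
      2⁻¹ * strichartzNorm (γ + 1) (fun t => u t - v t))
    {f g : T.L2} {u v : ℝ → T.L2} (hu : Continuous u) (hv : Continuous v)
    (hue : strichartzNorm (γ + 1) u ≤ ε) (hve : strichartzNorm (γ + 1) v ≤ ε)
    (hup : picard hγ hF hQ f u = u) (hvp : picard hγ hF hQ g v = v) :
    strichartzNorm (γ + 1) (fun t => u t - v t) ≤ 2 * A * ‖f - g‖ₑ := by
  have h := strichartzNorm_picard_sub_le hε hlin hcon f g hu hv hue hve
  rw [hup, hvp] at h
  set N := strichartzNorm (γ + 1) (fun t => u t - v t) with hN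
  have hfin : N ≠ ∞ := by
    have h1 : strichartzNorm (γ + 1) (fun t => (-1 : ℂ) • v t) = strichartzNorm (γ + 1) v :=
      strichartzNorm_smul_of_norm_eq_one (by simp) _ _
    have h2 := strichartzNorm_add_le (q := γ + 1) (by linarith) hu.aestronglyMeasurable
      (hv.const_smul (-1 : ℂ)).aestronglyMeasurable
    simp only [Pi.smul_apply, neg_smul, one_smul, ← sub_eq_add_neg] at h1 h2
    refine ne_top_of_le_ne_top (ENNReal.add_ne_top.2 ⟨hε, hε⟩) (h2.trans (add_le_add hue ?_))
    exact h1.le.trans hve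
  have hsplit : 2⁻¹ * N + 2⁻¹ * N = N := by
    rw [← add_mul, ENNReal.inv_two_add_inv_two, one_mul]
  have h3 : 2⁻¹ * N ≤ A * ‖f - g‖ₑ := by
    refine (ENNReal.add_le_add_iff_right (a := 2⁻¹ * N) (by finiteness)).1 ?_
    rwa [hsplit]
  calc N = 2⁻¹ * N + 2⁻¹ * N := hsplit.symm
    _ ≤ A * ‖f - g‖ₑ + A * ‖f - g‖ₑ := add_le_add h3 h3
    _ = _ := by ring

end FixedPoint

end HomTree

namespace HomTree

variable {Q : ℕ} {T : HomTree Q}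

/-! ### Comparison with the norms of the statement -/

lemma spaceNorm_ofReal {q : ℝ} (hq : 0 < q) (g : T.V → ℂ) :
    spaceNorm T (ENNReal.ofReal q) g = T.powSum q g ^ (1 / q) := by
  rw [spaceNorm, if_neg ENNReal.ofReal_ne_top, ENNReal.toReal_ofReal hq.le]
  rfl

lemma spaceNorm_two (g : T.V → ℂ) : spaceNorm T 2 g = T.powSum 2 g ^ (1 / 2 : ℝ) := by
  rw [← spaceNorm_ofReal two_pos, ENNReal.ofReal_ofNat]

lemma spaceNorm_two_coe (f : T.L2) : spaceNorm T 2 f = ‖f‖ₑ := by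
  rw [spaceNorm_two, ← enorm_rpow_two, one_div, ENNReal.rpow_rpow_inv two_ne_zero]

lemma memℓp_two_of_spaceNorm {g : T.V → ℂ} (h : spaceNorm T 2 g ≠ ∞) : Memℓp g 2 := by
  refine memℓp_two_of_powSum fun h1 => h ?_
  rw [spaceNorm_two, h1, ENNReal.top_rpow_of_pos (by norm_num)]

lemma Xnorm_coe {q : ℝ} (hq : 0 < q) (u : ℝ → T.L2) :
    Xnorm T (ENNReal.ofReal q) (ENNReal.ofReal q) Set.univ (fun t => u t) = strichartzNorm q u := by
  simp only [Xnorm, Set.mem_univ, iSup_pos, spaceNorm_two_coe, mixedNorm,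
    if_neg ENNReal.ofReal_ne_top, ENNReal.toReal_ofReal hq.le, spaceNorm_ofReal hq,
    Measure.restrict_univ, one_div, ENNReal.rpow_inv_rpow hq.ne', strichartzNorm]

lemma contL2On_coe {u : ℝ → T.L2} (hu : Continuous u) : ContL2On T (fun t => u t) Set.univ := by
  intro t₀ _
  rw [nhdsWithin_univ]
  have h : ∀ t, spaceNorm T 2 (fun x => u t x - u t₀ x) = ‖u t - u t₀‖ₑ := fun t =>
    spaceNorm_two_coe (u t - u t₀)
  simp only [h]
  have := ((hu.sub continuous_const).tendsto t₀ : Tendsto (fun t => u t - u t₀) _ _).enorm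
  simpa using this

section Solves

variable {F : ℂ → ℂ} {γ : ℝ} (hγ : 1 < γ) (hF : PowerLike F γ)

lemma solvesNLS_of_eq_picard (hQ : 2 ≤ Q) {q : ℝ} {f : T.L2} {u : ℝ → T.L2} (hu : Continuous u)
    (hfin : strichartzNorm q u ≠ ∞) (h : picard hγ hF (one_le_two.trans hQ) f u = u) :
    SolvesNLS T F f (fun t => u t) Set.univ := by
  intro t _ x
  have h1 := congrArg (fun g : T.L2 => g x) (congrFun h t)
  simp only [picard, L2.sub_apply, L2.smul_apply] at h1
  rw [duhamel_apply _ (intervalIntegrable_nonlin_of_strichartzNorm hu hfin)] at h1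
  simp only [← h1, propagate_eq_schGroup T hQ]
  congr 2
  exact intervalIntegral.integral_congr fun s _ =>
    (propagate_eq_schGroup T hQ (t - s) (nonlin hγ hF (u s)) x).symm

/-- A bounded solution of the integral equation is a continuous fixed point of the Picard map. -/
lemma exists_continuous_eq_picard (hQ : 2 ≤ Q) {f : T.L2} {u : ℝ → T.V → ℂ}
    (h : SolvesNLS T F f u Set.univ) {ε : ℝ≥0∞} (hε : ε ≠ ∞)
    (hu : ∀ t, spaceNorm T 2 (u t) ≤ ε) :
    ∃ u' : ℝ → T.L2, (u = fun t => ⇑(u' t)) ∧ Continuous u' ∧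
      picard hγ hF (one_le_two.trans hQ) f u' = u' := by
  have hQ1 : 1 ≤ Q := one_le_two.trans hQ
  set u' : ℝ → T.L2 := fun t =>
    ⟨u t, memℓp_two_of_spaceNorm (ne_top_of_le_ne_top hε (hu t))⟩ with hu'
  have hM : ∀ t, ‖u' t‖ ≤ ε.toReal := fun t => by
    rw [← toReal_enorm, ← spaceNorm_two_coe]
    exact ENNReal.toReal_mono hε (hu t)
  obtain ⟨B, hB⟩ := exists_norm_nonlin_le (T := T) hγ hF ε.toReal
  have hsol : ∀ t x, u' t x = T.schGroup hQ1 t f x -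
      Complex.I * ∫ s in (0 : ℝ)..t, T.schGroup hQ1 (t - s) (nonlin hγ hF (u' s)) x := by
    intro t x
    refine (h t trivial x).trans ?_
    rw [propagate_eq_schGroup T hQ]
    congr 2
    exact intervalIntegral.integral_congr fun s _ =>
      propagate_eq_schGroup T hQ (t - s) (nonlin hγ hF (u' s)) x
  have hmeas : AEStronglyMeasurable fun s => nonlin hγ hF (u' s) := by
    refine aestronglyMeasurable_of_apply fun x => AEStronglyMeasurable.aemeasurable ?_
    refine aestronglyMeasurable_of_duhamel hQ1 x
      (w := fun t => nonlin hγ hF (T.schGroup hQ1 t f) x) ?_ fun t ht => ?_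
    · exact (evalL x).continuous.comp ((continuous_nonlin hγ hF).comp
        ((T.continuous_schGroup hQ1).clm_apply continuous_const))
    · have := hsol t x
      rw [intervalIntegral.integral_undef ht, mul_zero, sub_zero] at this
      rw [nonlin_apply, nonlin_apply, this]
  have hInt : ∀ a b, IntervalIntegrable (fun s => nonlin hγ hF (u' s)) volume a b := fun a b =>
    (intervalIntegrable_const (c := B)).mono_fun hmeas.restrict (.of_forall fun t =>
      (hB _ (hM t)).trans (le_abs_self B))
  have hpic : picard hγ hF hQ1 f u' = u' := by
    funext t
    ext x
    rw [hsol, ← duhamel_apply hQ1 hInt]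
    rfl
  have hdc := continuous_duhamel hQ1 hInt
  refine ⟨u', rfl, ?_, hpic⟩
  rw [← hpic]
  exact ((T.continuous_schGroup hQ1).clm_apply continuous_const).sub (hdc.const_smul Complex.I)

end Solves

end HomTree

open HomTree

/-- Global well-posedness for small `L²` data, with `p = q = γ + 1`: there are
`ε, δ > 0` such that for every `f` with `‖f‖_{L²} ≤ δ` the NLS has a unique
solution in the `ε`-ball of `X = C(ℝ; L²) ∩ L^{γ+1}(ℝ; L^{γ+1})`, and the
data-to-solution map is Lipschitz continuous. -/
theorem small_data_global_wellposedness (Q : ℕ) (hQ : 2 ≤ Q) (T : HomTree Q)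
    (γ : ℝ) (hγ : 1 < γ) (F : ℂ → ℂ) (hF : PowerLike F γ) :
    ∃ ε : ℝ≥0∞, 0 < ε ∧ ε < ∞ ∧ ∃ δ : ℝ≥0∞, 0 < δ ∧
      (∀ f : T.V → ℂ, spaceNorm T 2 f ≤ δ →
        ∃ u : ℝ → T.V → ℂ,
          (SolvesNLS T F f u Set.univ ∧ ContL2On T u Set.univ ∧
            Xnorm T (ENNReal.ofReal (γ + 1)) (ENNReal.ofReal (γ + 1)) Set.univ u ≤ ε) ∧
          ∀ v : ℝ → T.V → ℂ, SolvesNLS T F f v Set.univ → ContL2On T v Set.univ →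
            Xnorm T (ENNReal.ofReal (γ + 1)) (ENNReal.ofReal (γ + 1)) Set.univ v ≤ ε →
            v = u) ∧
      ∃ K : ℝ≥0, 0 < K ∧ ∀ (f₁ f₂ : T.V → ℂ) (u₁ u₂ : ℝ → T.V → ℂ),
        spaceNorm T 2 f₁ ≤ δ → spaceNorm T 2 f₂ ≤ δ →
        SolvesNLS T F f₁ u₁ Set.univ →
        Xnorm T (ENNReal.ofReal (γ + 1)) (ENNReal.ofReal (γ + 1)) Set.univ u₁ ≤ ε →
        SolvesNLS T F f₂ u₂ Set.univ →
        Xnorm T (ENNReal.ofReal (γ + 1)) (ENNReal.ofReal (γ + 1)) Set.univ u₂ ≤ ε →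
        Xnorm T (ENNReal.ofReal (γ + 1)) (ENNReal.ofReal (γ + 1)) Set.univ
            (fun t x => u₁ t x - u₂ t x) ≤
          (K : ℝ≥0∞) * spaceNorm T 2 (fun x => f₁ x - f₂ x) := by

  obtain ⟨A, ε, hA, hε0, hε, hlin, hcon⟩ := exists_strichartzNorm_duhamel_sub_le hQ T hγ hF
  have hq : 0 < γ + 1 := by linarith
  have hA1 : 1 + A ≠ ∞ := by finiteness
  have hlift : ∀ {f : T.L2} {u : ℝ → T.V → ℂ}, SolvesNLS T F f u Set.univ →
      Xnorm T (ENNReal.ofReal (γ + 1)) (ENNReal.ofReal (γ + 1)) Set.univ u ≤ ε →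
      ∃ u' : ℝ → T.L2, (u = fun t => ⇑(u' t)) ∧ Continuous u' ∧
        strichartzNorm (γ + 1) u' ≤ ε ∧ picard hγ hF (one_le_two.trans hQ) f u' = u' := by
    intro f u hu hue
    have hb : ∀ t, spaceNorm T 2 (u t) ≤ ε := fun t =>
      (le_iSup₂ (f := fun t (_ : t ∈ Set.univ) => spaceNorm T 2 (u t)) t trivial).trans
        (le_self_add.trans hue)
    obtain ⟨u', rfl, hc, hp⟩ := exists_continuous_eq_picard hγ hF hQ hu hε hb
    exact ⟨u', rfl, hc, by rwa [Xnorm_coe hq] at hue, hp⟩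
  set δ : ℝ≥0∞ := 2⁻¹ * (2⁻¹ * ε) / (1 + A) with hδ
  have hδtop : δ ≠ ∞ := (ENNReal.div_lt_top (by finiteness) (one_pos.trans_le le_self_add).ne').ne
  refine ⟨ε, hε0, hε.lt_top, δ, ENNReal.div_pos (by simp [hε0.ne']) hA1, fun f hf => ?_,
    (2 * (1 + A)).toNNReal, ENNReal.toNNReal_pos (by positivity) (by finiteness),
    fun f₁ f₂ u₁ u₂ hf₁ hf₂ hu₁ hu₁ε hu₂ hu₂ε => ?_⟩
  · obtain ⟨f, rfl⟩ : ∃ g : T.L2, f = g :=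
      ⟨⟨f, memℓp_two_of_spaceNorm (ne_top_of_le_ne_top hδtop hf)⟩, rfl⟩
    rw [spaceNorm_two_coe] at hf
    have hAf : A * ‖f‖ₑ ≤ 2⁻¹ * (2⁻¹ * ε) :=
      calc A * ‖f‖ₑ ≤ (1 + A) * δ := mul_le_mul' le_add_self hf
        _ ≤ _ := ENNReal.mul_div_le
    obtain ⟨u, hu, hue, hup⟩ := exists_eq_picard hε hlin hcon f hAf
    refine ⟨fun t => u t, ⟨solvesNLS_of_eq_picard hγ hF hQ hu (ne_top_of_le_ne_top hε hue) hup,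
      contL2On_coe hu, (Xnorm_coe hq u).le.trans hue⟩, fun v hv _ hve => ?_⟩
    obtain ⟨v, rfl, hvc, hve, hvp⟩ := hlift hv hve
    have := strichartzNorm_sub_le_of_eq_picard hε hlin hcon hvc hu hve hue hvp hup
    rw [sub_self, enorm_zero, mul_zero, nonpos_iff_eq_zero] at this
    rw [eq_of_strichartzNorm_sub_eq_zero this]
  · obtain ⟨f₁, rfl⟩ : ∃ g : T.L2, f₁ = g :=
      ⟨⟨f₁, memℓp_two_of_spaceNorm (ne_top_of_le_ne_top hδtop hf₁)⟩, rfl⟩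
    obtain ⟨f₂, rfl⟩ : ∃ g : T.L2, f₂ = g :=
      ⟨⟨f₂, memℓp_two_of_spaceNorm (ne_top_of_le_ne_top hδtop hf₂)⟩, rfl⟩
    obtain ⟨v₁, rfl, hc₁, he₁, hp₁⟩ := hlift hu₁ hu₁ε
    obtain ⟨v₂, rfl, hc₂, he₂, hp₂⟩ := hlift hu₂ hu₂ε
    rw [ENNReal.coe_toNNReal (by finiteness)]
    calc _ = strichartzNorm (γ + 1) (fun t => v₁ t - v₂ t) := Xnorm_coe hq fun t => v₁ t - v₂ t
      _ ≤ 2 * A * ‖f₁ - f₂‖ₑ :=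
          strichartzNorm_sub_le_of_eq_picard hε hlin hcon hc₁ hc₂ he₁ he₂ hp₁ hp₂
      _ ≤ 2 * (1 + A) * ‖f₁ - f₂‖ₑ := by
          gcongr
          exact le_add_self
      _ = _ := by rw [← spaceNorm_two_coe]; rfl
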